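/- Let Ξ ⊆ Ω be of the form Ξ = { ω ∈ Ω : (ω, ⟨ω⟩) ∈ Ξ̄ } for a set Ξ̄ ⊆ C[0,T]×C[0,T] satisfying condition (A2). Then M(Ξ) = { Q̄ ∘ S̄^{−1} : Q̄ ∈ M̄(Ξ̄) } and M̄(Ξ̄) = { Q ∘ ψ^{−1} : Q ∈ M(Ξ) }. Moreover, if Z̄ : Ω̄ → [1,∞] is a function and Z := Z̄ ∘ ψ, then M_Z(Ξ) = { Q̄ ∘ S̄^{−1} : Q̄ ∈ M̄_{Z̄}(Ξ̄) } and M̄_{Z̄}(Ξ̄) = { Q ∘ ψ^{−1} : Q ∈ M_Z(Ξ) }. -/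

import Mathlib

open MeasureTheory Filter Set Topology
open scoped ENNReal Classical

noncomputable section

namespace PathwiseSuperhedging

/-- The path space `C[0,T]`: continuous functions on `[0,T]` with the sup-norm. -/
abbrev Path (T : ℝ) := C(Set.Icc (0:ℝ) T, ℝ)

variable (T : ℝ)

instance : MeasurableSpace (Path T) := borel _
instance : BorelSpace (Path T) := ⟨rfl⟩

variable (hT : 0 ≤ T)

/-- time `0` as an element of `[0,T]`. -/
def t0 : Set.Icc (0:ℝ) T := ⟨0, le_refl 0, hT⟩

/-- clamp a real time into `[0,T]`. -/
def clamp (t : ℝ) : Set.Icc (0:ℝ) T := Set.projIcc 0 T hT t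

/-- evaluation of a path at a (clamped) real time. -/
def ev (ω : Path T) (t : ℝ) : ℝ := ω (clamp T hT t)

/-- The stopping times `σ^m_k`:  `σ^m_0 = 0` and
`σ^m_{k+1} = inf { t ≥ σ^m_k : |S_t - S_{σ^m_k}| ≥ 2^{-m} }` (equal to `T+1` if no such
time `t ≤ T` exists). -/
def sig (m : ℕ) : ℕ → Path T → ℝ
  | 0 => fun _ => 0
  | k + 1 => fun ω =>
      sInf ({t : ℝ | sig m k ω ≤ t ∧ t ≤ T ∧
        (2:ℝ) ^ (-(m:ℤ)) ≤ |ev T hT ω t - ev T hT ω (sig m k ω)|} ∪ {T + 1})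

/-- The discretized integral `𝕊^m_t = ∑_k S_{σ^m_k} (S_{σ^m_{k+1} ∧ t} - S_{σ^m_k ∧ t})`. -/
def Sm (m : ℕ) (t : ℝ) (ω : Path T) : ℝ :=
  ∑' k : ℕ, ev T hT ω (sig T hT m k ω) *
    (ev T hT ω (min (sig T hT m (k + 1) ω) t) - ev T hT ω (min (sig T hT m k ω) t))

/-- The pathwise integral `𝕊_t = liminf_m 𝕊^m_t`. -/
def SS (t : ℝ) (ω : Path T) : ℝ := Filter.liminf (fun m => Sm T hT m t ω) Filter.atTop

/-- The candidate quadratic variation `S_t² - S_0² - 2 𝕊_t`. -/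
def qvRaw (ω : Path T) (t : ℝ) : ℝ := (ev T hT ω t) ^ 2 - (ev T hT ω 0) ^ 2 - 2 * SS T hT t ω

/-- The set `Ω` of paths for which `𝕊^m → 𝕊` uniformly and
`t ↦ S_t² - S_0² - 2𝕊_t` is nondecreasing. -/
def BigOmega : Set (Path T) :=
  {ω | TendstoUniformly (fun m (t : Set.Icc (0:ℝ) T) => Sm T hT m (t : ℝ) ω)
        (fun t => SS T hT (t : ℝ) ω) Filter.atTop ∧
      MonotoneOn (qvRaw T hT ω) (Set.Icc (0:ℝ) T)}

/-- The pathwise quadratic variation `⟨ω⟩`, as an element of `C[0,T]`; it equals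
`S² - S_0² - 2𝕊` for `ω ∈ Ω` (this function being continuous there) and `0` otherwise. -/
def qv (ω : Path T) : Path T :=
  if h : ω ∈ BigOmega T hT ∧ Continuous fun t : Set.Icc (0:ℝ) T => qvRaw T hT ω (t : ℝ)
  then ⟨fun t => qvRaw T hT ω (t : ℝ), h.2⟩ else 0

/-- The raw filtration `F_t = σ(S_s : s ≤ t)` generated by the canonical process. -/
def Fraw (t : ℝ) : MeasurableSpace (Path T) :=
  ⨆ (s : Set.Icc (0:ℝ) T) (_ : (s : ℝ) ≤ t),
    MeasurableSpace.comap (fun ω : Path T => ω s) inferInstance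

/-- The right-continuous filtration `F_{t+} = ⋂_{s > t} F_{s ∧ T}`. -/
def Fplus (t : ℝ) : MeasurableSpace (Path T) :=
  ⨅ (s : ℝ) (_ : t < s), Fraw T (min s T)

/-- `τ` is a stopping time for the raw filtration `𝔽`. -/
def IsStopRaw (τ : Path T → ℝ) : Prop :=
  ∀ t ∈ Set.Icc (0:ℝ) T, MeasurableSet[Fraw T t] {ω | τ ω ≤ t}

/-- `τ` is a stopping time for the right-continuous filtration `𝔽₊`. -/
def IsStopPlus (τ : Path T → ℝ) : Prop :=
  ∀ t ∈ Set.Icc (0:ℝ) T, MeasurableSet[Fplus T t] {ω | τ ω ≤ t}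

/-- `f` is measurable with respect to the σ-field `F_{τ+}`. -/
def MeasAtStopPlus (τ f : Path T → ℝ) : Prop :=
  ∀ B : Set ℝ, MeasurableSet B → ∀ t ∈ Set.Icc (0:ℝ) T,
    MeasurableSet[Fplus T t] (f ⁻¹' B ∩ {ω | τ ω ≤ t})

/-- The set `ℋ` of simple trading strategies `H = ∑_{l=1}^L h_l 1_{(τ_l, τ_{l+1}]}`
with `𝔽₊`-stopping times `0 ≤ τ_1 ≤ ⋯ ≤ τ_{L+1} ≤ T` and bounded `F_{τ_l+}`-measurable
coefficients `h_l`. -/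
structure SimpleStrategy where
  L : ℕ
  τ : Fin (L + 1) → Path T → ℝ
  coeff : Fin L → Path T → ℝ
  τ_nonneg : ∀ ω, 0 ≤ τ 0 ω
  τ_mono : ∀ (l : Fin L) (ω), τ l.castSucc ω ≤ τ l.succ ω
  τ_le : ∀ ω, τ (Fin.last L) ω ≤ T
  τ_stop : ∀ l, IsStopPlus T (τ l)
  coeff_bdd : ∀ l, ∃ C : ℝ, ∀ ω, |coeff l ω| ≤ C
  coeff_meas : ∀ l : Fin L, MeasAtStopPlus T (τ l.castSucc) (coeff l)

/-- The pathwise stochastic integral `(H · X)_t(ω)` of a simple strategy against a process. -/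
def integ (H : SimpleStrategy T) (X : ℝ → Path T → ℝ) (t : ℝ) (ω : Path T) : ℝ :=
  ∑ l : Fin H.L, H.coeff l ω *
    (X (min (H.τ l.succ ω) t) ω - X (min (H.τ l.castSucc ω) t) ω)

/-- The canonical process `S_t(ω) = ω(t)`. -/
def Sproc (t : ℝ) (ω : Path T) : ℝ := ev T hT ω t

/-- `X` is a `Q`-`𝔽`-martingale (on the time interval `[0,T]`). -/
def IsMart (Q : Measure (Path T)) (X : ℝ → Path T → ℝ) : Prop :=
  (∀ t ∈ Set.Icc (0:ℝ) T, Integrable (X t) Q) ∧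
  ∀ s t : ℝ, s ∈ Set.Icc (0:ℝ) T → t ∈ Set.Icc (0:ℝ) T → s ≤ t →
    ∀ A : Set (Path T), MeasurableSet[Fraw T s] A →
      ∫ ω in A, X t ω ∂Q = ∫ ω in A, X s ω ∂Q

/-- `X` is a `Q`-`𝔽`-local martingale: there are `𝔽`-stopping times increasing `Q`-a.s.
to `∞` such that each stopped process is a `Q`-`𝔽`-martingale. -/
def IsLocalMart (Q : Measure (Path T)) (X : ℝ → Path T → ℝ) : Prop :=
  ∃ τ : ℕ → Path T → ℝ,
    (∀ m, IsStopRaw T (τ m)) ∧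
    (∀ᵐ ω ∂Q, Monotone (fun m => τ m ω) ∧ Tendsto (fun m => τ m ω) atTop atTop) ∧
    (∀ m, IsMart T Q (fun t ω => X (min (τ m ω) t) ω))

/-- The set `M(Ξ)` of local martingale measures concentrated on `Ξ`. -/
def MSet (Ξ : Set (Path T)) : Set (Measure (Path T)) :=
  {Q | IsProbabilityMeasure Q ∧ IsLocalMart T Q (Sproc T hT) ∧ Q Ξ = 1}

/-- The set `M_Z(Ξ)` of local martingale measures concentrated on `Ξ` with `E_Q[Z] < ∞`. -/
def MZSet (Ξ : Set (Path T)) (Z : Path T → ℝ≥0∞) : Set (Measure (Path T)) :=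
  {Q | IsProbabilityMeasure Q ∧ IsLocalMart T Q (Sproc T hT) ∧ Q Ξ = 1 ∧
       ∫⁻ ω, Z ω ∂Q ≠ ⊤}

/-- The stopped path `ω^t(s) = ω(t ∧ s)`. -/
def stopPath (ω : Path T) (t : Set.Icc (0:ℝ) T) : Path T :=
  ⟨fun s => ω ⟨min t.1 s.1, le_min t.2.1 s.2.1, (min_le_left _ _).trans t.2.2⟩,
    ω.continuous.comp ((continuous_const.min continuous_subtype_val).subtype_mk _)⟩

/-- Assumption A on the prediction set `Ξ` and its lift `Ξ̄`. -/
structure AssumptionA (Ξ : Set (Path T)) (Xibar : Set (Path T × Path T)) : Prop where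
  xi_nonempty : Ξ.Nonempty
  xibar_nonempty : Xibar.Nonempty
  xi_eq : Ξ = {ω ∈ BigOmega T hT | (ω, qv T hT ω) ∈ Xibar}
  A1 : ∃ K : ℕ → Set (Path T × Path T), (∀ n, IsCompact (K n)) ∧ Xibar = ⋃ n, K n
  A2 : ∀ p ∈ Xibar, p.2 (t0 T hT) = 0 ∧ Monotone p.2
  A3 : ∀ p ∈ Xibar, ∀ t : Set.Icc (0:ℝ) T, (stopPath T p.1 t, stopPath T p.2 t) ∈ Xibar

/-! ### The enlarged space -/

/-- The enlarged space `Ω̄ = C[0,T] × C[0,T]`. -/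
abbrev PathPair (T : ℝ) := Path T × Path T

/-- The embedding `ψ(ω) = (ω, ⟨ω⟩)`. -/
def psiMap (ω : Path T) : PathPair T := (ω, qv T hT ω)

/-- The diagonal set `Δ̄ = ψ(Ω)`. -/
def Delta : Set (PathPair T) := psiMap T hT '' BigOmega T hT

/-- The first canonical process `S̄_t(ω,ν) = ω(t)` on the enlarged space. -/
def SbarProc (t : ℝ) (p : PathPair T) : ℝ := ev T hT p.1 t

/-- The second canonical process `V̄_t(ω,ν) = ν(t)` on the enlarged space. -/
def VbarProc (t : ℝ) (p : PathPair T) : ℝ := ev T hT p.2 t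

/-- The process `𝕊̄ = (S̄² - S̄_0² - V̄)/2` on the enlarged space. -/
def SSbarProc (t : ℝ) (p : PathPair T) : ℝ :=
  ((ev T hT p.1 t) ^ 2 - (ev T hT p.1 0) ^ 2 - ev T hT p.2 t) / 2

/-- The raw filtration `F̄_t = σ(S̄_s, V̄_s : s ≤ t)` on the enlarged space. -/
def FbarRaw (t : ℝ) : MeasurableSpace (PathPair T) :=
  ⨆ (s : Set.Icc (0:ℝ) T) (_ : (s : ℝ) ≤ t),
    MeasurableSpace.comap (fun p : PathPair T => (p.1 s, p.2 s)) inferInstance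

/-- The right-continuous filtration `F̄_{t+} = ⋂_{s>t} F̄_{s ∧ T}` on the enlarged space. -/
def FbarPlus (t : ℝ) : MeasurableSpace (PathPair T) :=
  ⨅ (s : ℝ) (_ : t < s), FbarRaw T (min s T)

/-- The σ-field generated by all subsets of `Δ̄ᶜ`. -/
def nullDelta : MeasurableSpace (PathPair T) :=
  MeasurableSpace.generateFrom {N : Set (PathPair T) | N ⊆ (Delta T hT)ᶜ}

/-- The `Δ̄`-augmented raw filtration `F̄^Δ_t`. -/
def FbarDelta (t : ℝ) : MeasurableSpace (PathPair T) := FbarRaw T t ⊔ nullDelta T hT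

/-- The `Δ̄`-augmented right-continuous filtration `F̄^Δ_{t+}`. -/
def FbarDeltaPlus (t : ℝ) : MeasurableSpace (PathPair T) := FbarPlus T t ⊔ nullDelta T hT

/-- `τ` is a stopping time for the raw filtration `𝔽̄` on the enlarged space. -/
def IsStopBarRaw (τ : PathPair T → ℝ) : Prop :=
  ∀ t ∈ Set.Icc (0:ℝ) T, MeasurableSet[FbarRaw T t] {p | τ p ≤ t}

/-- `τ` is a stopping time for the filtration `𝔽̄₊^Δ`. -/
def IsStopBarDeltaPlus (τ : PathPair T → ℝ) : Prop :=
  ∀ t ∈ Set.Icc (0:ℝ) T, MeasurableSet[FbarDeltaPlus T hT t] {p | τ p ≤ t}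

/-- `f` is measurable with respect to `F̄^Δ_{τ+}`. -/
def MeasAtStopBarDeltaPlus (τ f : PathPair T → ℝ) : Prop :=
  ∀ B : Set ℝ, MeasurableSet B → ∀ t ∈ Set.Icc (0:ℝ) T,
    MeasurableSet[FbarDeltaPlus T hT t] (f ⁻¹' B ∩ {p | τ p ≤ t})

/-- The set `ℋ̄` of simple strategies on the enlarged space. -/
structure SimpleStrategyBar where
  L : ℕ
  τ : Fin (L + 1) → PathPair T → ℝ
  coeff : Fin L → PathPair T → ℝ
  τ_nonneg : ∀ p, 0 ≤ τ 0 p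
  τ_mono : ∀ (l : Fin L) (p), τ l.castSucc p ≤ τ l.succ p
  τ_le : ∀ p, τ (Fin.last L) p ≤ T
  τ_stop : ∀ l, IsStopBarDeltaPlus T hT (τ l)
  coeff_bdd : ∀ l, ∃ C : ℝ, ∀ p, |coeff l p| ≤ C
  coeff_meas : ∀ l : Fin L, MeasAtStopBarDeltaPlus T hT (τ l.castSucc) (coeff l)

/-- The pathwise stochastic integral on the enlarged space. -/
def integBar (H : SimpleStrategyBar T hT) (X : ℝ → PathPair T → ℝ) (t : ℝ)
    (p : PathPair T) : ℝ :=
  ∑ l : Fin H.L, H.coeff l p *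
    (X (min (H.τ l.succ p) t) p - X (min (H.τ l.castSucc p) t) p)

/-- `X` is a `Q̄`-`𝔽̄`-martingale on the enlarged space. -/
def IsMartBar (Q : Measure (PathPair T)) (X : ℝ → PathPair T → ℝ) : Prop :=
  (∀ t ∈ Set.Icc (0:ℝ) T, Integrable (X t) Q) ∧
  ∀ s t : ℝ, s ∈ Set.Icc (0:ℝ) T → t ∈ Set.Icc (0:ℝ) T → s ≤ t →
    ∀ A : Set (PathPair T), MeasurableSet[FbarRaw T s] A →
      ∫ p in A, X t p ∂Q = ∫ p in A, X s p ∂Q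

/-- `X` is a `Q̄`-`𝔽̄`-local martingale on the enlarged space. -/
def IsLocalMartBar (Q : Measure (PathPair T)) (X : ℝ → PathPair T → ℝ) : Prop :=
  ∃ τ : ℕ → PathPair T → ℝ,
    (∀ m, IsStopBarRaw T (τ m)) ∧
    (∀ᵐ p ∂Q, Monotone (fun m => τ m p) ∧ Tendsto (fun m => τ m p) atTop atTop) ∧
    (∀ m, IsMartBar T Q (fun t p => X (min (τ m p) t) p))

/-- The set `M̄(Ξ̄)` of measures on the enlarged space under which `S̄` and `𝕊̄` are local
martingales and which are concentrated on `Ξ̄`. -/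
def MbarSet (Xibar : Set (PathPair T)) : Set (Measure (PathPair T)) :=
  {Q | IsProbabilityMeasure Q ∧ IsLocalMartBar T Q (SbarProc T hT) ∧
       IsLocalMartBar T Q (SSbarProc T hT) ∧ Q Xibar = 1}

/-- The set `M̄_{Z̄}(Ξ̄)`. -/
def MbarZSet (Xibar : Set (PathPair T)) (Zbar : PathPair T → ℝ≥0∞) :
    Set (Measure (PathPair T)) :=
  {Q | IsProbabilityMeasure Q ∧ IsLocalMartBar T Q (SbarProc T hT) ∧
       IsLocalMartBar T Q (SSbarProc T hT) ∧ Q Xibar = 1 ∧ ∫⁻ p, Zbar p ∂Q ≠ ⊤}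

/-! ### Expectations and superhedging functionals -/

/-- The positive part of an extended real number, as an element of `[0,∞]`. -/
def erealPos (x : EReal) : ℝ≥0∞ := if x = ⊤ then ⊤ else ENNReal.ofReal x.toReal

/-- The expectation `E_Q[ξ]` of an extended-real-valued random variable, as an
extended real number (positive part minus negative part). -/
def expEReal {α : Type*} [MeasurableSpace α] (Q : Measure α) (ξ : α → EReal) : EReal :=
  ((∫⁻ x, erealPos (ξ x) ∂Q : ℝ≥0∞) : EReal) - ((∫⁻ x, erealPos (-ξ x) ∂Q : ℝ≥0∞) : EReal)

/-- The set of initial capitals `λ` that allow superhedging `ξ` on `Ξ`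
(trading in `S` and `𝕊` with simple strategies, in the liminf sense). -/
def PhiSet (Ξ : Set (Path T)) (ξ : Path T → EReal) : Set ℝ :=
  {lam : ℝ | ∃ H G : ℕ → SimpleStrategy T,
    (∀ n : ℕ, ∀ t ∈ Set.Icc (0:ℝ) T, ∀ ω ∈ Ξ,
      0 ≤ lam + integ T (H n) (Sproc T hT) t ω + integ T (G n) (SS T hT) t ω) ∧
    (∀ ω ∈ Ξ, ξ ω ≤ (lam : EReal) +
      Filter.liminf (fun n =>
        ((integ T (H n) (Sproc T hT) T ω + integ T (G n) (SS T hT) T ω : ℝ) : EReal))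
        Filter.atTop)}

/-- The superhedging price `Φ(ξ)`. -/
def Phi (Ξ : Set (Path T)) (ξ : Path T → EReal) : EReal :=
  sInf ((fun lam : ℝ => (lam : EReal)) '' PhiSet T hT Ξ ξ)

/-- The supremum of the pricing functionals `E_Q[ξ]` over `Q ∈ M(Ξ)`,
for a nonnegative claim `ξ`. -/
def supMart (Ξ : Set (Path T)) (ξ : Path T → ℝ≥0∞) : ℝ≥0∞ :=
  ⨆ Q ∈ MSet T hT Ξ, ∫⁻ ω, ξ ω ∂Q

/-- The liminf-closure `𝒢^Ξ_λ`: the smallest set of functions `C[0,T] → [-∞,∞]`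
containing `λ + (H·S)_T` for admissible simple `H` and closed under countable liminf. -/
inductive GG (Ξ : Set (Path T)) (lam : ℝ) : (Path T → EReal) → Prop
  | base (H : SimpleStrategy T)
      (hadm : ∀ t ∈ Set.Icc (0:ℝ) T, ∀ ω ∈ Ξ, 0 ≤ lam + integ T H (Sproc T hT) t ω) :
      GG Ξ lam (fun ω => ((lam + integ T H (Sproc T hT) T ω : ℝ) : EReal))
  | lim (X : ℕ → Path T → EReal) (h : ∀ n, GG Ξ lam (X n)) :
      GG Ξ lam (fun ω => Filter.liminf (fun n => X n ω) Filter.atTop)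

/-- The superhedging price `Φ^cl(ξ)` defined via the liminf-closure. -/
def PhiCl (Ξ : Set (Path T)) (ξ : Path T → EReal) : EReal :=
  sInf {x : EReal | ∃ lam : ℝ, x = (lam : EReal) ∧
    ∃ Y : Path T → EReal, GG T hT Ξ lam Y ∧ ∀ ω ∈ Ξ, ξ ω ≤ Y ω}


/-- The set of initial capitals allowing superhedging on the enlarged space
(superhedging on `Δ̄ ∩ Ξ̄`). -/
def PhiBarSet (Xibar : Set (PathPair T)) (ξ : PathPair T → EReal) : Set ℝ :=
  {lam : ℝ | ∃ H G : ℕ → SimpleStrategyBar T hT,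
    (∀ n : ℕ, ∀ t ∈ Set.Icc (0:ℝ) T, ∀ p ∈ Delta T hT ∩ Xibar,
      0 ≤ lam + integBar T hT (H n) (SbarProc T hT) t p
            + integBar T hT (G n) (SSbarProc T hT) t p) ∧
    (∀ p ∈ Delta T hT ∩ Xibar, ξ p ≤ (lam : EReal) +
      Filter.liminf (fun n =>
        ((integBar T hT (H n) (SbarProc T hT) T p
          + integBar T hT (G n) (SSbarProc T hT) T p : ℝ) : EReal)) Filter.atTop)}

/-- The superhedging price `Φ̄(ξ̄)` on the enlarged space. -/
def PhiBar (Xibar : Set (PathPair T)) (ξ : PathPair T → EReal) : EReal :=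
  sInf ((fun lam : ℝ => (lam : EReal)) '' PhiBarSet T hT Xibar ξ)

/-- The supremum of pricing functionals over `M̄(Ξ̄)` for a nonnegative claim. -/
def supMartBar (Xibar : Set (PathPair T)) (ξ : PathPair T → ℝ≥0∞) : ℝ≥0∞ :=
  ⨆ Q ∈ MbarSet T hT Xibar, ∫⁻ p, ξ p ∂Q

/-- Assumption B on the prediction set `Ξ`, determined by a growth function `Z̄`
(with values in `[1,∞]`). -/
structure AssumptionB (Ξ : Set (Path T)) (Zbar : PathPair T → ℝ≥0∞) : Prop where
  xi_nonempty : Ξ.Nonempty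
  one_le : ∀ p, 1 ≤ Zbar p
  xi_eq : Ξ = {ω ∈ BigOmega T hT | Zbar (ω, qv T hT ω) ≠ ⊤}
  B1 : ∀ c : ℝ≥0∞, c ≠ ⊤ → IsCompact {p : PathPair T | Zbar p ≤ c}
  B2 : ∀ p : PathPair T, Zbar p ≠ ⊤ → p.2 (t0 T hT) = 0 ∧ Monotone p.2
  B3 : ∀ p : PathPair T, ENNReal.ofReal (‖p.1‖ + ‖p.2‖) ≤ Zbar p

/-- The set of initial capitals allowing `Z`-admissible superhedging of `ξ` on `Ξ`. -/
def PhiZSet (Ξ : Set (Path T)) (Z : Path T → ℝ≥0∞) (ξ : Path T → EReal) : Set ℝ :=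
  {lam : ℝ | ∃ c : ℝ, 0 ≤ c ∧ ∃ H G : ℕ → SimpleStrategy T,
    (∀ n : ℕ, ∀ ω ∈ Ξ,
      -(c * (Z ω).toReal) ≤
        lam + integ T (H n) (Sproc T hT) T ω + integ T (G n) (SS T hT) T ω) ∧
    (∀ ω ∈ Ξ, ξ ω ≤ (lam : EReal) +
      Filter.liminf (fun n =>
        ((integ T (H n) (Sproc T hT) T ω + integ T (G n) (SS T hT) T ω : ℝ) : EReal))
        Filter.atTop)}

/-- The superhedging price `Φ^Z(ξ)`. -/
def PhiZ (Ξ : Set (Path T)) (Z : Path T → ℝ≥0∞) (ξ : Path T → EReal) : EReal :=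
  sInf ((fun lam : ℝ => (lam : EReal)) '' PhiZSet T hT Ξ Z ξ)

/-- The `α`-Hölder norm `‖ω‖_α = |ω(0)| + sup_{s ≠ t} |ω(t) - ω(s)| / |t-s|^α`,
with values in `[0,∞]`. -/
def holderNormE (α : ℝ) (ω : Path T) : ℝ≥0∞ :=
  ENNReal.ofReal |ω (t0 T hT)| +
    ⨆ (s : Set.Icc (0:ℝ) T) (t : Set.Icc (0:ℝ) T) (_ : s ≠ t),
      ENNReal.ofReal (|ω t - ω s| / |t.1 - s.1| ^ α)

/-- The set of Hölder continuous paths `⋃_n { ω : ‖ω‖_{1/n} ≤ n }`. -/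
def CHolder : Set (Path T) :=
  ⋃ n : ℕ, {ω : Path T | 0 < n ∧ holderNormE T hT (1 / n) ω ≤ (n : ℝ≥0∞)}

end PathwiseSuperhedging

namespace PathwiseSuperhedging
section P1
variable {T : ℝ}



lemma measurable_path {α : Type*} {mα : MeasurableSpace α} {f : α → Path T}
    (h : ∀ t, Measurable (fun a => f a t)) : Measurable f := by
  obtain ⟨D, hDc, hDd⟩ := TopologicalSpace.exists_countable_dense (Set.Icc (0:ℝ) T)
  have : Countable D := hDc.to_subtype
  let e : Path T → (D → ℝ) := fun ω d => ω d
  have he : Measurable e := measurable_pi_lambda _ fun d =>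
    (continuous_eval_const (F := Path T) (d : Set.Icc (0:ℝ) T)).measurable
  have hi : Function.Injective e := by
    intro ω ω' hh
    apply ContinuousMap.ext
    intro t
    have := Continuous.ext_on hDd ω.continuous ω'.continuous (fun d hd => congrFun hh ⟨d, hd⟩)
    exact congrFun this t
  rw [← (he.measurableEmbedding hi).measurable_comp_iff]
  exact measurable_pi_lambda _ fun d => h d

variable (hT : 0 ≤ T)

lemma clamp_val (r : ℝ) : ((clamp T hT r : Set.Icc (0:ℝ) T) : ℝ) = max 0 (min T r) := rfl

lemma clamp_of_mem {r : ℝ} (h : r ∈ Set.Icc (0:ℝ) T) : clamp T hT r = ⟨r, h⟩ :=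
  Set.projIcc_of_mem hT h

lemma clamp_coe (t : Set.Icc (0:ℝ) T) : clamp T hT t = t := Set.projIcc_val hT t

lemma ev_coe (ω : Path T) (t : Set.Icc (0:ℝ) T) : ev T hT ω t = ω t := by
  unfold ev; rw [clamp_coe]

lemma ev_neg (ω : Path T) {r : ℝ} (h : r ≤ 0) : ev T hT ω r = ev T hT ω 0 := by
  unfold ev; congr 1; apply Subtype.ext; rw [clamp_val, clamp_val]
  rw [min_eq_right (h.trans hT), min_eq_right hT, max_eq_left h, max_self]

lemma ev_max (ω : Path T) (r : ℝ) : ev T hT ω (max 0 r) = ev T hT ω r := by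
  rcases le_total r 0 with h | h
  · rw [max_eq_left h, ev_neg hT ω h]
  · rw [max_eq_right h]

lemma ev_ge (ω : Path T) {r : ℝ} (h : T ≤ r) : ev T hT ω r = ev T hT ω T := by
  unfold ev; congr 1; apply Subtype.ext; rw [clamp_val, clamp_val]
  rw [min_eq_left h, min_self]

lemma continuous_clamp : Continuous (clamp T hT) := continuous_projIcc (h := hT)

lemma ev_cont2 : Continuous (fun q : Path T × ℝ => ev T hT q.1 q.2) := by
  unfold ev
  exact continuous_eval.comp (continuous_fst.prodMk ((continuous_clamp hT).comp continuous_snd))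

lemma ev_cont (ω : Path T) : Continuous (ev T hT ω) :=
  ω.continuous.comp (continuous_clamp hT)

lemma ev_stop (ω : Path T) (t : Set.Icc (0:ℝ) T) (r : ℝ) :
    ev T hT (stopPath T ω t) r = ev T hT ω (min t r) := by
  unfold ev stopPath
  simp only [ContinuousMap.coe_mk]
  congr 1; apply Subtype.ext
  simp only [clamp_val]
  rcases t with ⟨t, h0, h1⟩
  simp only
  rw [min_max_distrib_left, min_eq_right h0, ← min_assoc, ← min_assoc, min_comm t T]

/-- pair stopping -/
def stopPair (p : PathPair T) (t : Set.Icc (0:ℝ) T) : PathPair T :=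
  (stopPath T p.1 t, stopPath T p.2 t)

lemma Fraw_le (t : ℝ) : Fraw T t ≤ (inferInstance : MeasurableSpace (Path T)) := by
  unfold Fraw
  refine iSup_le fun s => iSup_le fun _ => ?_
  rw [← measurable_iff_comap_le]
  exact (continuous_eval_const (F := Path T) s).measurable

lemma FbarRaw_le (t : ℝ) : FbarRaw T t ≤ (inferInstance : MeasurableSpace (PathPair T)) := by
  unfold FbarRaw
  refine iSup_le fun s => iSup_le fun _ => ?_
  rw [← measurable_iff_comap_le]
  exact ((continuous_eval_const (F := Path T) s).measurable.comp measurable_fst).prodMk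
    ((continuous_eval_const (F := Path T) s).measurable.comp measurable_snd)

lemma Fraw_mono {s t : ℝ} (h : s ≤ t) : Fraw T s ≤ Fraw T t := by
  unfold Fraw
  exact iSup_mono fun u => iSup_mono' fun hu => ⟨hu.trans h, le_rfl⟩

lemma FbarRaw_mono {s t : ℝ} (h : s ≤ t) : FbarRaw T s ≤ FbarRaw T t := by
  unfold FbarRaw
  exact iSup_mono fun u => iSup_mono' fun hu => ⟨hu.trans h, le_rfl⟩

lemma meas_eval_Fraw (t : ℝ) (s : Set.Icc (0:ℝ) T) (h : (s:ℝ) ≤ t) :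
    Measurable[Fraw T t] (fun ω : Path T => ω s) := by
  rw [measurable_iff_comap_le]
  unfold Fraw
  exact le_iSup₂_of_le s h le_rfl

lemma meas_eval_Fbar (t : ℝ) (s : Set.Icc (0:ℝ) T) (h : (s:ℝ) ≤ t) :
    Measurable[FbarRaw T t] (fun p : PathPair T => (p.1 s, p.2 s)) := by
  rw [measurable_iff_comap_le]
  unfold FbarRaw
  exact le_iSup₂_of_le s h le_rfl

lemma meas_stopPath (t : Set.Icc (0:ℝ) T) :
    Measurable[Fraw T t] (fun ω : Path T => stopPath T ω t) := by
  refine @measurable_path T _ (Fraw T t) _ fun s => ?_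
  exact meas_eval_Fraw (t:ℝ) ⟨min t.1 s.1, le_min t.2.1 s.2.1, (min_le_left _ _).trans t.2.2⟩
    (min_le_left _ _)

lemma meas_stopPair (t : Set.Icc (0:ℝ) T) :
    Measurable[FbarRaw T t] (fun p : PathPair T => stopPair p t) := by
  have h : ∀ s : Set.Icc (0:ℝ) T, Measurable[FbarRaw T t] (fun p : PathPair T => 
    ((stopPath T p.1 t) s, (stopPath T p.2 t) s)) := fun s =>
    meas_eval_Fbar (t:ℝ) ⟨min t.1 s.1, le_min t.2.1 s.2.1, (min_le_left _ _).trans t.2.2⟩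
    (min_le_left _ _)
  change Measurable[FbarRaw T t] (fun p : PathPair T => (stopPath T p.1 t, stopPath T p.2 t))
  refine @Measurable.prodMk _ (FbarRaw T t) _ _ _ _ _ _ ?_ ?_
  · refine @measurable_path T _ (FbarRaw T t) _ fun s => ?_
    exact measurable_fst.comp (h s)
  · refine @measurable_path T _ (FbarRaw T t) _ fun s => ?_
    exact measurable_snd.comp (h s)

/-- Galmarino-type criterion. -/
lemma gal_path {β : Type*} [MeasurableSpace β] {f : Path T → β} (hf : Measurable f)
    (t : Set.Icc (0:ℝ) T) (h : ∀ ω, f (stopPath T ω t) = f ω) : Measurable[Fraw T t] f := by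
  have := hf.comp (meas_stopPath t)
  convert this using 1
  funext ω; exact (h ω).symm

lemma gal {β : Type*} [MeasurableSpace β] {f : PathPair T → β} (hf : Measurable f)
    (t : Set.Icc (0:ℝ) T) (h : ∀ ω, f (stopPair ω t) = f ω) : Measurable[FbarRaw T t] f := by
  have := hf.comp (meas_stopPair t)
  convert this using 1
  funext ω; exact (h ω).symm

lemma gal_fst {β : Type*} [MeasurableSpace β] {f : Path T → β} (t : ℝ)
    (hf : Measurable[Fraw T t] f) : Measurable[FbarRaw T t] (fun p : PathPair T => f p.1) := by
  have : @Measurable _ _ (FbarRaw T t) (Fraw T t) (fun p : PathPair T => p.1) := by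
    rw [measurable_iff_comap_le]
    unfold Fraw
    simp only [MeasurableSpace.comap_iSup, MeasurableSpace.comap_comp]
    refine iSup_le fun s => iSup_le fun hs => ?_
    have := measurable_fst.comp (meas_eval_Fbar t s hs)
    rw [measurable_iff_comap_le] at this
    exact this
  exact hf.comp this

/-- sets in the raw filtration are determined by the stopped path -/
lemma mem_stopPair_iff {s : ℝ} (hs : s ∈ Set.Icc (0:ℝ) T) {A : Set (PathPair T)}
    (hA : MeasurableSet[FbarRaw T s] A) (p : PathPair T) : stopPair p ⟨s, hs⟩ ∈ A ↔ p ∈ A := by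
  have key : FbarRaw T s ≤
    { MeasurableSet' := fun A => ∀ p : PathPair T, stopPair p ⟨s, hs⟩ ∈ A ↔ p ∈ A
      measurableSet_empty := by simp
      measurableSet_compl := fun A h p => not_congr (h p)
      measurableSet_iUnion := fun f h p => by simp [h] } := by
    unfold FbarRaw
    refine iSup_le fun u => iSup_le fun hu => ?_
    rintro _ ⟨B, hB, rfl⟩ p
    have : (⟨min s u.1, le_min hs.1 u.2.1, (min_le_left _ _).trans hs.2⟩ : Set.Icc (0:ℝ) T) = u :=
      Subtype.ext (min_eq_right hu)
    simp only [stopPair, stopPath, ContinuousMap.coe_mk, mem_preimage, this]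
  exact key A hA p

lemma stopPath_stopPath_le (ω : Path T) (t : Set.Icc (0:ℝ) T) {r : ℝ} (h : r ≤ t) :
    ev T hT (stopPath T ω t) r = ev T hT ω r := by
  rw [ev_stop, min_eq_right h]

end P1
end PathwiseSuperhedging

namespace PathwiseSuperhedging
section P2
variable {T : ℝ} (hT : 0 ≤ T)

/-- mesh size -/
def eps (m : ℕ) : ℝ := (2:ℝ) ^ (-(m:ℤ))
lemma eps_pos (m : ℕ) : 0 < eps m := by unfold eps; positivity

/-- the set of hitting candidates -/
def hset (m k : ℕ) (ω : Path T) : Set ℝ :=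
  {t : ℝ | sig T hT m k ω ≤ t ∧ t ≤ T ∧
        eps m ≤ |ev T hT ω t - ev T hT ω (sig T hT m k ω)|}

lemma sig_zero (m : ℕ) (ω : Path T) : sig T hT m 0 ω = 0 := rfl
lemma sig_succ (m k : ℕ) (ω : Path T) :
    sig T hT m (k+1) ω = sInf (hset hT m k ω ∪ {T+1}) := rfl

lemma sig_le (m k : ℕ) (ω : Path T) : sig T hT m k ω ≤ T + 1 ∧ 0 ≤ sig T hT m k ω := by
  induction k with
  | zero => rw [sig_zero]; constructor <;> linarith
  | succ k ih =>
    rw [sig_succ]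
    have hlb : ∀ x ∈ hset hT m k ω ∪ {T+1}, sig T hT m k ω ≤ x := by
      rintro x (hx | hx)
      · exact hx.1
      · rw [mem_singleton_iff.1 hx]; exact ih.1
    refine ⟨csInf_le ⟨_, hlb⟩ (Or.inr rfl), ih.2.trans (le_csInf ⟨T+1, Or.inr rfl⟩ hlb)⟩

lemma hset_lb (m k : ℕ) (ω : Path T) : ∀ x ∈ hset hT m k ω ∪ {T+1}, sig T hT m k ω ≤ x := by
  rintro x (hx | hx)
  · exact hx.1
  · rw [mem_singleton_iff.1 hx]; exact (sig_le hT m k ω).1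

lemma sig_mono_succ (m k : ℕ) (ω : Path T) : sig T hT m k ω ≤ sig T hT m (k+1) ω := by
  rw [sig_succ]
  exact le_csInf ⟨T+1, Or.inr rfl⟩ (hset_lb hT m k ω)

lemma sig_mono (m : ℕ) (ω : Path T) : Monotone (fun k => sig T hT m k ω) :=
  monotone_nat_of_le_succ fun k => sig_mono_succ hT m k ω

lemma hset_closed (m k : ℕ) (ω : Path T) : IsClosed (hset hT m k ω) := by
  unfold hset
  simp only [ofPred_and]
  refine (isClosed_le continuous_const continuous_id).inter
    ((isClosed_le continuous_id continuous_const).inter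
    (isClosed_le continuous_const ?_))
  exact ((ev_cont hT ω).sub continuous_const).abs

lemma sig_mem (m k : ℕ) (ω : Path T) :
    sig T hT m (k+1) ω ∈ hset hT m k ω ∨ sig T hT m (k+1) ω = T + 1 := by
  have := IsClosed.csInf_mem (s := hset hT m k ω ∪ {T+1}) 
    ((hset_closed hT m k ω).union isClosed_singleton) ⟨T+1, Or.inr rfl⟩ ⟨_, hset_lb hT m k ω⟩
  rw [← sig_succ] at this
  exact this

lemma sig_succ_le {m k : ℕ} {ω : Path T} {u : ℝ} (hu : u ∈ hset hT m k ω) :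
    sig T hT m (k+1) ω ≤ u := by
  rw [sig_succ]
  exact csInf_le ⟨_, hset_lb hT m k ω⟩ (Or.inl hu)

lemma sig_lt {m k : ℕ} {ω : Path T} {u : ℝ} (h1 : sig T hT m k ω ≤ u)
    (h2 : u < sig T hT m (k+1) ω) (h3 : u ≤ T) :
    |ev T hT ω u - ev T hT ω (sig T hT m k ω)| < eps m := by
  by_contra hc
  exact absurd (sig_succ_le hT (u := u) ⟨h1, h3, not_lt.1 hc⟩) (not_le.2 h2)

lemma sig_fin (m : ℕ) (ω : Path T) : ∃ K, ∀ k ≥ K, sig T hT m k ω = T + 1 := by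
  by_contra hc
  push Not at hc
  have hne : ∀ k, sig T hT m k ω ≠ T + 1 := by
    intro k hk
    obtain ⟨j, hj, hj'⟩ := hc k
    exact hj' (le_antisymm (sig_le hT m j ω).1 (hk ▸ sig_mono hT m ω hj))
  have hlim := tendsto_atTop_ciSup (sig_mono hT m ω)
    ⟨T+1, by rintro _ ⟨k, rfl⟩; exact (sig_le hT m k ω).1⟩
  set L := ⨆ k, sig T hT m k ω
  have h1 : Tendsto (fun k => ev T hT ω (sig T hT m k ω)) atTop (𝓝 (ev T hT ω L)) :=
    ((ev_cont hT ω).tendsto L).comp hlim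
  have h2 := (tendsto_add_atTop_iff_nat 1).2 h1
  have h3 := (h2.sub h1).abs
  rw [sub_self, abs_zero] at h3
  have h4 := ge_of_tendsto' h3 (b := eps m) (fun k => by
    rcases sig_mem hT m k ω with h | h
    · exact h.2.2
    · exact absurd h (hne _))
  exact absurd h4 (not_le.2 (eps_pos m))

lemma sig_stop (m k : ℕ) (ω : Path T) (t : Set.Icc (0:ℝ) T) :
    (sig T hT m k ω ≤ t → sig T hT m k (stopPath T ω t) = sig T hT m k ω) ∧
    (t < sig T hT m k ω → t < sig T hT m k (stopPath T ω t)) := by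
  induction k with
  | zero => 
    simp only [sig_zero]
    exact ⟨fun _ => trivial, fun h => h⟩
  | succ k ih =>
    have htT : (t:ℝ) ≤ T := t.2.2
    constructor
    · intro h
      have hk := (sig_mono_succ hT m k ω).trans h
      have e := ih.1 hk
      have hm : sig T hT m (k+1) ω ∈ hset hT m k ω := by
        rcases sig_mem hT m k ω with h' | h'
        · exact h'
        · linarith
      have hle : sig T hT m (k+1) (stopPath T ω t) ≤ sig T hT m (k+1) ω := by
        apply sig_succ_le
        refine ⟨by rw [e]; exact hm.1, hm.2.1, ?_⟩
        rw [e, ev_stop, ev_stop, min_eq_right h, min_eq_right hk]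
        exact hm.2.2
      refine le_antisymm hle ?_
      have hm' : sig T hT m (k+1) (stopPath T ω t) ∈ hset hT m k (stopPath T ω t) := by
        rcases sig_mem hT m k (stopPath T ω t) with h' | h'
        · exact h'
        · linarith
      apply sig_succ_le
      have := hm'.2.2
      rw [e, ev_stop, ev_stop, min_eq_right (hle.trans h), min_eq_right hk] at this
      exact ⟨e ▸ hm'.1, hm'.2.1, this⟩
    · intro h
      by_contra hc
      push Not at hc
      have hk' := (sig_mono_succ hT m k (stopPath T ω t)).trans hc
      have hk : sig T hT m k ω ≤ t := by
        by_contra h'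
        exact absurd (ih.2 (not_le.1 h')) (not_lt.2 hk')
      have e := ih.1 hk
      have hm' : sig T hT m (k+1) (stopPath T ω t) ∈ hset hT m k (stopPath T ω t) := by
        rcases sig_mem hT m k (stopPath T ω t) with h' | h'
        · exact h'
        · linarith
      have := hm'.2.2
      rw [e, ev_stop, ev_stop, min_eq_right hc, min_eq_right hk] at this
      have := sig_succ_le hT (m := m) (k := k) (ω := ω) ⟨e ▸ hm'.1, hm'.2.1, this⟩
      linarith

lemma sig_stop_le (m k : ℕ) (ω : Path T) (t : Set.Icc (0:ℝ) T) :
    sig T hT m k (stopPath T ω t) ≤ t ↔ sig T hT m k ω ≤ t := by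
  constructor
  · intro h; by_contra h'; exact absurd ((sig_stop hT m k ω t).2 (not_le.1 h')) (not_lt.2 h)
  · intro h; rw [(sig_stop hT m k ω t).1 h]; exact h

lemma sig_stop_min (m k : ℕ) (ω : Path T) (t : Set.Icc (0:ℝ) T) :
    min (t:ℝ) (sig T hT m k (stopPath T ω t)) = min (t:ℝ) (sig T hT m k ω) := by
  rcases le_or_gt (sig T hT m k ω) t with h | h
  · rw [(sig_stop hT m k ω t).1 h]
  · rw [min_eq_left h.le, min_eq_left ((sig_stop hT m k ω t).2 h).le]

lemma sig_meas (m k : ℕ) : Measurable (sig T hT m k) := by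
  induction k with
  | zero => exact measurable_const
  | succ k ih =>
    refine measurable_of_Iic fun c => ?_
    rcases le_or_gt (T+1) c with hc | hc
    · convert MeasurableSet.univ using 1
      ext ω; simp only [mem_preimage, mem_Iic, mem_univ, iff_true]
      exact (sig_le hT m (k+1) ω).1.trans hc
    · let C : Set ((Path T × ℝ) × Set.Icc (0:ℝ) T) :=
        {q | q.1.2 ≤ q.2 ∧ (q.2:ℝ) ≤ c ∧ eps m ≤ |ev T hT q.1.1 q.2 - ev T hT q.1.1 q.1.2|}
      have hC : IsClosed C := by
        simp only [C, ofPred_and]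
        refine (isClosed_le (by fun_prop) (by fun_prop)).inter
          ((isClosed_le (by fun_prop) (by fun_prop)).inter
          (isClosed_le continuous_const ?_))
        refine Continuous.abs (Continuous.sub ?_ ?_)
        · exact (ev_cont2 hT).comp (by fun_prop : Continuous fun q : (Path T × ℝ) × Set.Icc (0:ℝ) T => (q.1.1, (q.2:ℝ)))
        · exact (ev_cont2 hT).comp (by fun_prop : Continuous fun q : (Path T × ℝ) × Set.Icc (0:ℝ) T => (q.1.1, q.1.2))
      have hC' : IsClosed (Prod.fst '' C) := isClosed_map_fst_aux hC
      have : (sig T hT m (k+1)) ⁻¹' Iic c = (fun ω => (ω, sig T hT m k ω)) ⁻¹' (Prod.fst '' C) := by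
        ext ω
        simp only [mem_preimage, mem_Iic, mem_image]
        constructor
        · intro h
          rcases sig_mem hT m k ω with h' | h'
          · exact ⟨((ω, sig T hT m k ω), ⟨_, (sig_le hT m (k+1) ω).2, h'.2.1⟩),
              ⟨h'.1, h, h'.2.2⟩, rfl⟩
          · linarith
        · rintro ⟨⟨⟨ω', r⟩, u⟩, ⟨h1, h2, h3⟩, h4⟩
          simp only [Prod.mk.injEq] at h4
          obtain ⟨rfl, rfl⟩ := h4
          exact (sig_succ_le hT ⟨h1, u.2.2, h3⟩).trans h2
      rw [this]
      exact (measurable_id.prodMk ih) hC'.measurableSet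
where
  isClosed_map_fst_aux {X Y : Type} [TopologicalSpace X] [TopologicalSpace Y] [CompactSpace Y]
    {C : Set (X × Y)} (hC : IsClosed C) : IsClosed (Prod.fst '' C) :=
    isClosedMap_fst_of_compactSpace _ hC

lemma ev_meas {α : Type*} [MeasurableSpace α] {g : α → Path T} {r : α → ℝ} (hg : Measurable g)
    (hr : Measurable r) : Measurable (fun a => ev T hT (g a) (r a)) :=
  (ev_cont2 hT).measurable.comp (hg.prodMk hr)

/-- terms of the discretised integral -/
def smt (m : ℕ) (t : ℝ) (ω : Path T) (k : ℕ) : ℝ := ev T hT ω (sig T hT m k ω) *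
    (ev T hT ω (min (sig T hT m (k + 1) ω) t) - ev T hT ω (min (sig T hT m k ω) t))

lemma Sm_eq (m : ℕ) (ω : Path T) : ∃ K, ∀ K' ≥ K, ∀ t,
    Sm T hT m t ω = ∑ k ∈ Finset.range K', smt hT m t ω k := by
  obtain ⟨K, hK⟩ := sig_fin hT m ω
  refine ⟨K, fun K' hK' t => ?_⟩
  unfold Sm
  refine tsum_eq_sum fun k hk => ?_
  have hk' : K ≤ k := hK'.trans (by simpa using hk)
  rw [hK k hk', hK (k+1) (by omega), sub_self, mul_zero]

lemma Sm_cont (m : ℕ) (ω : Path T) : Continuous (fun t => Sm T hT m t ω) := by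
  obtain ⟨K, hK⟩ := Sm_eq hT m ω
  simp_rw [hK K le_rfl]
  refine continuous_finsetSum _ fun k _ => ?_
  unfold smt
  have := ev_cont hT ω
  fun_prop

lemma Sm_zero (m : ℕ) (ω : Path T) : Sm T hT m 0 ω = 0 := by
  obtain ⟨K, hK⟩ := Sm_eq hT m ω
  rw [hK K le_rfl]
  refine Finset.sum_eq_zero fun k _ => ?_
  unfold smt
  rw [min_eq_right (sig_le hT m k ω).2, min_eq_right (sig_le hT m (k+1) ω).2, sub_self, mul_zero]

lemma Sm_max (m : ℕ) (ω : Path T) (r : ℝ) : Sm T hT m (max 0 r) ω = Sm T hT m r ω := by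
  unfold Sm
  congr 1; funext k
  have : ∀ k, ev T hT ω (min (sig T hT m k ω) (max 0 r)) = ev T hT ω (min (sig T hT m k ω) r) := by
    intro k
    rw [← ev_max hT ω (min (sig T hT m k ω) r), max_min_distrib_left, max_eq_right (sig_le hT m k ω).2]
  rw [this, this]

lemma Sm_stop (m : ℕ) (ω : Path T) (t : Set.Icc (0:ℝ) T) (r : ℝ) :
    Sm T hT m r (stopPath T ω t) = Sm T hT m (min t r) ω := by
  unfold Sm
  congr 1; funext k
  have h : ∀ k, ev T hT (stopPath T ω t) (min (sig T hT m k (stopPath T ω t)) r) =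
      ev T hT ω (min (sig T hT m k ω) (min t r)) := by
    intro k
    rw [ev_stop, ← min_assoc, sig_stop_min, min_comm (t:ℝ) (sig T hT m k ω), min_assoc]
  rw [h, h]
  rcases le_or_gt (sig T hT m k ω) t with h' | h'
  · rw [(sig_stop hT m k ω t).1 h', ev_stop, min_eq_right h']
  · have h'' := h'.le.trans (sig_mono_succ hT m k ω)
    rw [min_eq_right ((min_le_left _ _).trans h''), min_eq_right ((min_le_left _ _).trans h'.le),
      sub_self, mul_zero, mul_zero]

lemma tsum_meas {α : Type*} [MeasurableSpace α] {f : ℕ → α → ℝ} (hf : ∀ k, Measurable (f k))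
    (h : ∀ a, ∃ K, ∀ k ≥ K, f k a = 0) : Measurable (fun a => ∑' k, f k a) := by
  refine measurable_of_tendsto_metrizable (f := fun n a => ∑ k ∈ Finset.range n, f k a)
    (fun n => Finset.measurable_sum _ fun k _ => hf k) ?_
  rw [tendsto_pi_nhds]
  intro a
  obtain ⟨K, hK⟩ := h a
  have : Summable (fun k => f k a) := summable_of_ne_finset_zero (s := Finset.range K)
    fun k hk => hK k (by simpa using hk)
  exact this.hasSum.tendsto_sum_nat

lemma Sm_meas (m : ℕ) {α : Type*} [MeasurableSpace α] {g : α → Path T} {r : α → ℝ}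
    (hg : Measurable g) (hr : Measurable r) : Measurable (fun a => Sm T hT m (r a) (g a)) := by
  refine tsum_meas (f := fun k a => smt hT m (r a) (g a) k) (fun k => ?_) (fun a => ?_)
  · have h1 := (sig_meas hT m k).comp hg
    have h2 := (sig_meas hT m (k+1)).comp hg
    exact (ev_meas hT hg h1).mul ((ev_meas hT hg (h2.min hr)).sub (ev_meas hT hg (h1.min hr)))
  · obtain ⟨K, hK⟩ := sig_fin hT m (g a)
    refine ⟨K, fun k hk => ?_⟩
    unfold smt
    rw [hK k hk, hK (k+1) (by omega), sub_self, mul_zero]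

/-- value of the path at the last `σ` before `t`. -/
def lastS (m : ℕ) (t : ℝ) (ω : Path T) : ℝ :=
  ∑' k, if sig T hT m k ω ≤ t ∧ t < sig T hT m (k+1) ω then ev T hT ω (sig T hT m k ω) else 0

lemma lastS_eq_sum (m : ℕ) (ω : Path T) : ∃ K, ∀ K' ≥ K, ∀ t ≤ T, lastS hT m t ω =
    ∑ k ∈ Finset.range K',
     if sig T hT m k ω ≤ t ∧ t < sig T hT m (k+1) ω then ev T hT ω (sig T hT m k ω) else 0 := by
  obtain ⟨K, hK⟩ := sig_fin hT m ω
  refine ⟨K, fun K' hK' t ht => ?_⟩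
  unfold lastS
  refine tsum_eq_sum fun k hk => ?_
  have hk' : K ≤ k := hK'.trans (by simpa using hk)
  rw [if_neg]
  rw [hK k hk']
  rintro ⟨h, _⟩; linarith

lemma lastS_spec (m : ℕ) (ω : Path T) {t : ℝ} (ht0 : 0 ≤ t) (ht : t ≤ T) :
    ∃ k, sig T hT m k ω ≤ t ∧ t < sig T hT m (k+1) ω ∧
      lastS hT m t ω = ev T hT ω (sig T hT m k ω) := by
  have hex : ∃ k, t < sig T hT m k ω := by
    obtain ⟨K, hK⟩ := sig_fin hT m ω
    exact ⟨K, by rw [hK K le_rfl]; linarith⟩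
  have h1 := Nat.find_spec hex
  have h0 : Nat.find hex ≠ 0 := by
    intro h; rw [h, sig_zero] at h1; linarith
  obtain ⟨k, hk⟩ := Nat.exists_eq_succ_of_ne_zero h0
  have h2 : sig T hT m k ω ≤ t := not_lt.1 (Nat.find_min hex (m := k) (by omega))
  rw [hk] at h1
  refine ⟨k, h2, h1, ?_⟩
  unfold lastS
  rw [tsum_eq_single k, if_pos ⟨h2, h1⟩]
  intro j hj
  rw [if_neg]
  rintro ⟨h3, h4⟩
  rcases lt_or_gt_of_ne hj with h | h
  · have := sig_mono hT m ω (show j + 1 ≤ k by omega)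
    simp only at this; linarith
  · have := sig_mono hT m ω (show k + 1 ≤ j by omega)
    simp only [Nat.succ_eq_add_one] at *; linarith

lemma lastS_close (m : ℕ) (ω : Path T) {t : ℝ} (ht0 : 0 ≤ t) (ht : t ≤ T) :
    |ev T hT ω t - lastS hT m t ω| ≤ eps m := by
  obtain ⟨k, h1, h2, h3⟩ := lastS_spec hT m ω ht0 ht
  rw [h3]
  exact (sig_lt hT h1 h2 ht).le

lemma lastS_meas (m : ℕ) {t : ℝ} (ht : t ≤ T) : Measurable (lastS hT m t) := by
  refine tsum_meas (fun k => ?_) (fun ω => ?_)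
  · refine Measurable.ite ?_ (ev_meas hT measurable_id (sig_meas hT m k)) measurable_const
    exact (measurableSet_le (sig_meas hT m k) measurable_const).inter
      (measurableSet_lt measurable_const (sig_meas hT m (k+1)))
  · obtain ⟨K, hK⟩ := sig_fin hT m ω
    refine ⟨K, fun k hk => if_neg ?_⟩
    rw [hK k hk]
    rintro ⟨h, _⟩; linarith

lemma lastS_stop (m : ℕ) (ω : Path T) (t : Set.Icc (0:ℝ) T) :
    lastS hT m t (stopPath T ω t) = lastS hT m t ω := by
  unfold lastS
  congr 1; funext k
  have : (sig T hT m k (stopPath T ω t) ≤ t ∧ t < sig T hT m (k+1) (stopPath T ω t)) ↔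
    (sig T hT m k ω ≤ t ∧ t < sig T hT m (k+1) ω) := by
    rw [sig_stop_le, ← not_le, ← not_le, sig_stop_le]
  by_cases h : sig T hT m k ω ≤ t ∧ t < sig T hT m (k+1) ω
  · rw [if_pos h, if_pos (this.2 h), (sig_stop hT m k ω t).1 h.1, ev_stop, min_eq_right h.1]
  · rw [if_neg h, if_neg (fun h' => h (this.1 h'))]

end P2
end PathwiseSuperhedging

namespace PathwiseSuperhedging
section P3
variable {T : ℝ} (hT : 0 ≤ T)

/-- grid points -/
def gr (s h : ℝ) (N : ℕ) (i : ℕ) : ℝ := s + i * (h / 2 ^ N)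

lemma gr_mono (s : ℝ) {h : ℝ} (hh : 0 ≤ h) (N : ℕ) : Monotone (gr s h N) := by
  intro i j hij
  unfold gr
  have : (i:ℝ) ≤ j := by exact_mod_cast hij
  have h2 : 0 ≤ h / 2 ^ N := by positivity
  nlinarith

lemma gr_zero (s h : ℝ) (N : ℕ) : gr s h N 0 = s := by simp [gr]
lemma gr_last (s h : ℝ) (N J : ℕ) : gr s h N (J * 2 ^ N) = s + J * h := by
  unfold gr; push_cast; field_simp

lemma sum_tele (f : ℕ → ℝ) (i0 J : ℕ) :
    ∑ i ∈ Finset.range J, (if i0 ≤ i then f (i+1) - f i else 0) = f J - f (min i0 J) := by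
  induction J with
  | zero => simp
  | succ J ih =>
    rw [Finset.sum_range_succ, ih]
    by_cases h : i0 ≤ J
    · rw [if_pos h, min_eq_left h, min_eq_left (by omega)]; ring
    · rw [if_neg h, min_eq_right (by omega), min_eq_right (by omega)]; ring

lemma grid_single {X : ℝ → ℝ} (hX : Continuous X) (s σ : ℝ) {h : ℝ} (hh : 0 ≤ h) (J : ℕ) :
    Tendsto (fun N => ∑ i ∈ Finset.range (J * 2 ^ N),
      (if σ ≤ gr s h N i then X (gr s h N (i+1)) - X (gr s h N i) else 0)) atTop
      (𝓝 (X (s + J * h) - X (max s (min σ (s + J * h))))) := by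
  rcases hh.eq_or_lt with rfl | hh
  · have : ∀ N i, gr s 0 N i = s := by intro N i; simp [gr]
    simp only [this, sub_self, ite_self, Finset.sum_const_zero, mul_zero, add_zero]
    rw [max_eq_left (min_le_right _ _), sub_self]
    exact tendsto_const_nhds
  · let i0 : ℕ → ℕ := fun N => ⌈(σ - s) / (h / 2 ^ N)⌉₊
    have hp : ∀ N : ℕ, 0 < h / 2 ^ N := fun N => by positivity
    have hiff : ∀ N i, σ ≤ gr s h N i ↔ i0 N ≤ i := by
      intro N i
      simp only [i0]
      rw [Nat.ceil_le, div_le_iff₀ (hp N)]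
      unfold gr
      constructor <;> intro h <;> linarith
    have hs : ∀ N, ∑ i ∈ Finset.range (J * 2 ^ N),
      (if σ ≤ gr s h N i then X (gr s h N (i+1)) - X (gr s h N i) else 0) =
        X (s + J * h) - X (gr s h N (min (i0 N) (J * 2 ^ N))) := by
      intro N
      simp only [hiff]
      rw [sum_tele (fun i => X (gr s h N i)), gr_last]
    simp only [hs]
    refine tendsto_const_nhds.sub ((hX.tendsto _).comp ?_)
    rw [tendsto_iff_dist_tendsto_zero]
    have hz : Tendsto (fun N : ℕ => h / 2 ^ N) atTop (𝓝 0) := by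
      have := (tendsto_pow_atTop_nhds_zero_of_lt_one (r := (1/2:ℝ)) (by norm_num) (by norm_num)).const_mul h
      simp only [mul_zero] at this
      refine this.congr fun N => ?_
      rw [one_div, inv_pow]; rfl
    refine squeeze_zero (fun _ => dist_nonneg) (fun N => ?_) hz
    rw [Real.dist_eq, (gr_mono s hh.le N).map_min, gr_last]
    -- round up error
    have h1 : max s σ ≤ gr s h N (i0 N) := by
      refine max_le ?_ ((hiff N _).2 le_rfl)
      exact (gr_zero s h N).symm.le.trans (gr_mono s hh.le N (Nat.zero_le _))
    have h2 : gr s h N (i0 N) ≤ max s σ + h / 2 ^ N := by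
      rcases le_or_gt σ s with hσ | hσ
      · have : i0 N = 0 := Nat.le_zero.1 ((hiff N 0).1 (by rw [gr_zero]; exact hσ))
        rw [this, gr_zero, max_eq_left hσ]; linarith [hp N]
      · have := Nat.ceil_lt_add_one (show 0 ≤ (σ - s) / (h / 2 ^ N) from
          div_nonneg (by linarith) (hp N).le)
        have h3 : ((i0 N : ℕ):ℝ) * (h / 2 ^ N) ≤ (σ - s) + h / 2 ^ N := by
          have := mul_le_mul_of_nonneg_right this.le (hp N).le
          rwa [add_mul, div_mul_cancel₀ _ (hp N).ne', one_mul] at this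
        rw [max_eq_right hσ.le]
        unfold gr; linarith
    have hmm : max s (min σ (s + J * h)) = min (max s σ) (s + J * h) := by
      rw [max_min_distrib_left, max_eq_right (show s ≤ s + J * h by
        have : (0:ℝ) ≤ J * h := by positivity
        linarith)]
    rw [hmm]
    refine (abs_min_sub_min_le_max _ _ _ _).trans ?_
    rw [sub_self, abs_zero, max_eq_left (abs_nonneg _), abs_of_nonneg (by linarith)]
    linarith

/-- Riemann sums of the step process converge to the discretised integral. -/
lemma grid_lim (m : ℕ) (ω : Path T) (ρ : ℝ) {s h : ℝ} (hh : 0 ≤ h) (J : ℕ)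
    (hT' : s + J * h ≤ T) :
    Tendsto (fun N => ∑ i ∈ Finset.range (J * 2 ^ N), lastS hT m (gr s h N i) ω *
      (ev T hT ω (min ρ (gr s h N (i+1))) - ev T hT ω (min ρ (gr s h N i)))) atTop
      (𝓝 (Sm T hT m (min ρ (s + J * h)) ω - Sm T hT m (min ρ s) ω)) := by
  obtain ⟨K1, hK1⟩ := Sm_eq hT m ω
  obtain ⟨K2, hK2⟩ := lastS_eq_sum hT m ω
  set K := max K1 K2
  set t := s + J * h with ht
  have hst : s ≤ t := by
    have : (0:ℝ) ≤ J * h := by positivity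
    linarith
  let X : ℝ → ℝ := fun u => ev T hT ω (min ρ u)
  have hX : Continuous X := (ev_cont hT ω).comp (by fun_prop)
  have hgle : ∀ N i, i ∈ Finset.range (J * 2 ^ N) → gr s h N i ≤ T := by
    intro N i hi
    refine (gr_mono s hh N (Finset.mem_range.1 hi).le).trans ?_
    rw [gr_last]; exact hT'
  have e1 : ∀ N, ∑ i ∈ Finset.range (J * 2 ^ N), lastS hT m (gr s h N i) ω *
      (ev T hT ω (min ρ (gr s h N (i+1))) - ev T hT ω (min ρ (gr s h N i))) =
      ∑ k ∈ Finset.range K, ev T hT ω (sig T hT m k ω) *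
        (∑ i ∈ Finset.range (J * 2 ^ N), (if sig T hT m k ω ≤ gr s h N i then X (gr s h N (i+1)) - X (gr s h N i) else 0)
        - ∑ i ∈ Finset.range (J * 2 ^ N), (if sig T hT m (k+1) ω ≤ gr s h N i then X (gr s h N (i+1)) - X (gr s h N i) else 0)) := by
    intro N
    have : ∀ i ∈ Finset.range (J * 2 ^ N), lastS hT m (gr s h N i) ω *
      (ev T hT ω (min ρ (gr s h N (i+1))) - ev T hT ω (min ρ (gr s h N i))) =
      ∑ k ∈ Finset.range K, ev T hT ω (sig T hT m k ω) * 
        ((if sig T hT m k ω ≤ gr s h N i then X (gr s h N (i+1)) - X (gr s h N i) else 0) -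
        (if sig T hT m (k+1) ω ≤ gr s h N i then X (gr s h N (i+1)) - X (gr s h N i) else 0)) := by
      intro i hi
      rw [hK2 K (le_max_right _ _) _ (hgle N i hi), Finset.sum_mul]
      refine Finset.sum_congr rfl fun k _ => ?_
      have hm := sig_mono_succ hT m k ω
      by_cases c1 : sig T hT m k ω ≤ gr s h N i
      · by_cases c2 : sig T hT m (k+1) ω ≤ gr s h N i
        · rw [if_neg (fun h => absurd h.2 (not_lt.2 c2)), if_pos c1, if_pos c2]; ring
        · rw [if_pos ⟨c1, not_le.1 c2⟩, if_pos c1, if_neg c2, sub_zero]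
      · rw [if_neg (fun h => c1 h.1), if_neg c1, if_neg (fun h => c1 (hm.trans h))]; ring
    rw [Finset.sum_congr rfl this, Finset.sum_comm]
    refine Finset.sum_congr rfl fun k _ => ?_
    rw [← Finset.mul_sum, Finset.sum_sub_distrib]
  simp only [e1]
  rw [hK1 K (le_max_left _ _), hK1 K (le_max_left _ _), ← Finset.sum_sub_distrib]
  refine tendsto_finsetSum _ fun k _ => ?_
  have h1 := grid_single hX s (sig T hT m k ω) hh J
  have h2 := grid_single hX s (sig T hT m (k+1) ω) hh J
  have h3 := (h1.sub h2).const_mul (ev T hT ω (sig T hT m k ω))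
  convert h3 using 2
  have hx : ∀ σ, X (max s (min σ t)) = X (min σ t) - X (min σ s) + X s := by
    intro σ
    rcases le_total σ s with c | c
    · rw [min_eq_left c, min_eq_left (c.trans hst), max_eq_left c]; ring
    · rw [min_eq_right c, max_eq_right (le_min c hst)]; ring
  rw [hx, hx]
  simp only [smt, X]
  have hy : ∀ σ u : ℝ, min σ (min ρ u) = min ρ (min σ u) := fun σ u => by
    rw [← min_assoc, min_comm σ ρ, min_assoc]
  simp only [hy]
  ring

end P3
end PathwiseSuperhedging

namespace PathwiseSuperhedging
section P4
variable {T : ℝ} (hT : 0 ≤ T)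

def SmP (m : ℕ) (ω : Path T) : Path T :=
  ⟨fun t => Sm T hT m t ω, (Sm_cont hT m ω).comp continuous_subtype_val⟩

def SbP (p : PathPair T) : Path T :=
  ⟨fun t => SSbarProc T hT t p, by
    unfold SSbarProc
    have h1 := (ev_cont hT p.1).comp (continuous_subtype_val (p := fun x => x ∈ Set.Icc (0:ℝ) T))
    have h2 := (ev_cont hT p.2).comp (continuous_subtype_val (p := fun x => x ∈ Set.Icc (0:ℝ) T))
    exact (((h1.pow 2).sub continuous_const).sub h2).div_const 2⟩

lemma SmP_apply (m : ℕ) (ω : Path T) (t : Set.Icc (0:ℝ) T) : SmP hT m ω t = Sm T hT m t ω := rfl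
lemma SbP_apply (p : PathPair T) (t : Set.Icc (0:ℝ) T) : SbP hT p t = SSbarProc T hT t p := rfl

lemma SmP_meas (m : ℕ) : Measurable (SmP hT m) :=
  measurable_path fun _ => Sm_meas hT m measurable_id measurable_const

lemma SSbar_meas {α : Type*} [MeasurableSpace α] {g : α → PathPair T} {r : α → ℝ}
    (hg : Measurable g) (hr : Measurable r) : Measurable (fun a => SSbarProc T hT (r a) (g a)) := by
  unfold SSbarProc
  have h1 := ev_meas hT (measurable_fst.comp hg) hr
  have h2 := ev_meas hT (measurable_snd.comp hg) hr
  have h3 := ev_meas hT (measurable_fst.comp hg) (measurable_const (a := (0:ℝ)))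
  exact (((h1.pow_const 2).sub (h3.pow_const 2)).sub h2).div_const 2

lemma SbP_meas : Measurable (SbP hT) :=
  measurable_path fun _ => SSbar_meas hT measurable_id measurable_const

def Gam : Set (PathPair T) :=
  {p | Monotone p.2} ∩ {p | Tendsto (fun m => ‖SmP hT m p.1 - SbP hT p‖) atTop (𝓝 0)}

lemma isClosed_mono : IsClosed {p : PathPair T | Monotone p.2} := by
  have : {p : PathPair T | Monotone p.2} = ⋂ (s : Set.Icc (0:ℝ) T) (t : Set.Icc (0:ℝ) T) (_ : s ≤ t),
      {p : PathPair T | p.2 s ≤ p.2 t} := by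
    ext p; simp only [mem_iInter]; exact ⟨fun h s t hst => h hst, fun h s t hst => h s t hst⟩
  rw [this]
  refine isClosed_iInter fun s => isClosed_iInter fun t => isClosed_iInter fun _ => ?_
  exact isClosed_le ((continuous_eval_const (F := Path T) s).comp continuous_snd)
    ((continuous_eval_const (F := Path T) t).comp continuous_snd)

lemma Gam_meas : MeasurableSet (Gam hT) := by
  refine isClosed_mono.measurableSet.inter ?_
  refine measurableSet_tendsto (𝓝 (0:ℝ)) fun m => ?_
  exact (((SmP_meas hT m).comp measurable_fst).sub (SbP_meas hT)).norm

lemma tendsto_path_iff (ω : Path T) (f : Path T) :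
    Tendsto (fun m => ‖SmP hT m ω - f‖) atTop (𝓝 0) ↔
    TendstoUniformly (fun m (t : Set.Icc (0:ℝ) T) => Sm T hT m (t : ℝ) ω) (fun t => f t) atTop := by
  rw [← tendsto_iff_norm_sub_tendsto_zero, ContinuousMap.tendsto_iff_tendstoUniformly]
  rfl

lemma qvRaw_cont {ω : Path T} (h : ω ∈ BigOmega T hT) :
    Continuous fun t : Set.Icc (0:ℝ) T => qvRaw T hT ω (t : ℝ) := by
  have h1 : Continuous fun t : Set.Icc (0:ℝ) T => SS T hT (t:ℝ) ω :=
    h.1.continuous (Eventually.frequently (Eventually.of_forall fun m =>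
      (Sm_cont hT m ω).comp continuous_subtype_val))
  unfold qvRaw
  have h2 := (ev_cont hT ω).comp (continuous_subtype_val (p := fun x => x ∈ Set.Icc (0:ℝ) T))
  exact ((h2.pow 2).sub continuous_const).sub (continuous_const.mul h1)

lemma qv_apply {ω : Path T} (h : ω ∈ BigOmega T hT) (t : Set.Icc (0:ℝ) T) :
    qv T hT ω t = qvRaw T hT ω t := by
  unfold qv
  rw [dif_pos ⟨h, qvRaw_cont hT h⟩]; rfl

lemma qv_off {ω : Path T} (h : ω ∉ BigOmega T hT) : qv T hT ω = 0 := by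
  unfold qv
  rw [dif_neg (fun h' => h h'.1)]

lemma psi_mem_Gam {ω : Path T} (h : ω ∈ BigOmega T hT) : psiMap T hT ω ∈ Gam hT := by
  refine ⟨?_, ?_⟩
  · intro s t hst
    change qv T hT ω s ≤ qv T hT ω t
    rw [qv_apply hT h, qv_apply hT h]
    exact h.2 s.2 t.2 hst
  · change Tendsto (fun m => ‖SmP hT m ω - SbP hT (psiMap T hT ω)‖) atTop (𝓝 0)
    rw [tendsto_path_iff]
    convert h.1 using 2
    rename_i t
    rw [SbP_apply]; unfold SSbarProc psiMap
    simp only [ev_coe, qv_apply hT h]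
    unfold qvRaw; rw [ev_coe]; ring

lemma Gam_unif {p : PathPair T} (h : p ∈ Gam hT) (t : Set.Icc (0:ℝ) T) :
    SS T hT t p.1 = SSbarProc T hT t p := by
  have h1 := (tendsto_path_iff hT _ _).1 h.2
  exact (h1.tendsto_at t).liminf_eq

lemma Gam_iff {p : PathPair T} (h : p ∈ Gam hT) :
    p.1 ∈ BigOmega T hT ∧ psiMap T hT p.1 = p := by
  have h1 := (tendsto_path_iff hT _ _).1 h.2
  have hq : ∀ t : Set.Icc (0:ℝ) T, qvRaw T hT p.1 t = p.2 t := by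
    intro t
    unfold qvRaw
    rw [Gam_unif hT h]; unfold SSbarProc; rw [ev_coe hT p.2]; ring
  have hb : p.1 ∈ BigOmega T hT := by
    refine ⟨?_, ?_⟩
    · convert h1 using 2
      exact Gam_unif hT h _
    · intro s hs t ht hst
      rw [hq ⟨s, hs⟩, hq ⟨t, ht⟩]
      exact h.1 hst
  refine ⟨hb, ?_⟩
  refine Prod.ext rfl ?_
  ext t
  change qv T hT p.1 t = _
  rw [qv_apply hT hb, hq]

lemma fst_inj : InjOn Prod.fst (Gam hT) := by
  intro p hp q hq h
  rw [← (Gam_iff hT hp).2, ← (Gam_iff hT hq).2, h]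

lemma img_Gam (B : Set (PathPair T)) :
    Prod.fst '' (Gam hT ∩ B) = BigOmega T hT ∩ psiMap T hT ⁻¹' B := by
  ext ω; constructor
  · rintro ⟨p, ⟨hp, hB⟩, rfl⟩
    have := Gam_iff hT hp
    exact ⟨this.1, by rw [mem_preimage, this.2]; exact hB⟩
  · rintro ⟨h, hB⟩
    exact ⟨_, ⟨psi_mem_Gam hT h, hB⟩, rfl⟩

lemma BigOmega_meas : MeasurableSet (BigOmega T hT) := by
  have h := img_Gam hT univ
  simp only [inter_univ, preimage_univ] at h
  rw [← h]
  exact (Gam_meas hT).image_of_measurable_injOn measurable_fst (fst_inj hT)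

lemma psi_meas : Measurable (psiMap T hT) := by
  intro B hB
  have : psiMap T hT ⁻¹' B = (BigOmega T hT ∩ psiMap T hT ⁻¹' B) ∪
      ((BigOmega T hT)ᶜ ∩ (fun ω => ((ω, 0) : PathPair T)) ⁻¹' B) := by
    ext ω
    by_cases h : ω ∈ BigOmega T hT
    · simp [h]
    · simp [h, psiMap, qv_off hT h]
  rw [this]
  refine MeasurableSet.union ?_ ((BigOmega_meas hT).compl.inter
    ((measurable_id.prodMk measurable_const) hB))
  rw [← img_Gam]
  exact ((Gam_meas hT).inter hB).image_of_measurable_injOn measurable_fst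
    ((fst_inj hT).mono inter_subset_left)

lemma psi_emb : MeasurableEmbedding (psiMap T hT) :=
  (psi_meas hT).measurableEmbedding fun a b h => congrArg Prod.fst h

lemma stop_apply (ω : Path T) (s t : Set.Icc (0:ℝ) T) :
    stopPath T ω s t = ω (min s t) := by
  unfold stopPath; simp only [ContinuousMap.coe_mk]
  congr 1

lemma coe_min' (s t : Set.Icc (0:ℝ) T) : ((min s t : Set.Icc (0:ℝ) T) : ℝ) = min (s:ℝ) t := rfl

lemma SSbar_stop (p : PathPair T) (s : Set.Icc (0:ℝ) T) (r : ℝ) :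
    SSbarProc T hT r (stopPair p s) = SSbarProc T hT (min s r) p := by
  unfold SSbarProc stopPair
  simp only [ev_stop, min_eq_right s.2.1]

lemma Gam_stop {p : PathPair T} (h : p ∈ Gam hT) (s : Set.Icc (0:ℝ) T) : stopPair p s ∈ Gam hT := by
  refine ⟨?_, ?_⟩
  · intro u v huv
    change stopPath T p.2 s u ≤ stopPath T p.2 s v
    rw [stop_apply, stop_apply]
    exact h.1 (min_le_min_left _ huv)
  · refine squeeze_zero (fun _ => norm_nonneg _) (fun m => ?_) h.2
    rw [ContinuousMap.norm_le _ (norm_nonneg _)]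
    intro t
    have := (SmP hT m p.1 - SbP hT p).norm_coe_le_norm (min s t)
    refine le_trans (le_of_eq ?_) this
    simp only [ContinuousMap.sub_apply, SmP_apply, SbP_apply, SSbar_stop, coe_min']
    congr 2
    exact Sm_stop hT m p.1 s t

lemma psi_stop {ω : Path T} (h : ω ∈ BigOmega T hT) (s : Set.Icc (0:ℝ) T) :
    psiMap T hT (stopPath T ω s) = stopPair (psiMap T hT ω) s :=
  (Gam_iff hT (Gam_stop hT (psi_mem_Gam hT h) s)).2

lemma psi_zero {ω : Path T} (h : ω ∈ BigOmega T hT) : SSbarProc T hT 0 (psiMap T hT ω) = 0 := by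
  have h0 : (0:ℝ) ∈ Set.Icc (0:ℝ) T := ⟨le_rfl, hT⟩
  have h1 := Gam_unif hT (psi_mem_Gam hT h) ⟨0, h0⟩
  simp only [] at h1
  rw [← h1]
  unfold SS
  simp [psiMap, Sm_zero]

/-- transfer of raw sigma-fields -/
lemma psi_transfer {s : ℝ} (hs : s ∈ Set.Icc (0:ℝ) T) {A : Set (PathPair T)}
    (hA : MeasurableSet[FbarRaw T s] A) : ∃ A' : Set (Path T), MeasurableSet[Fraw T s] A' ∧
      ∀ ω ∈ BigOmega T hT, (ω ∈ A' ↔ psiMap T hT ω ∈ A) := by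
  refine ⟨{ω | psiMap T hT (stopPath T ω ⟨s, hs⟩) ∈ A}, ?_, fun ω hω => ?_⟩
  · exact ((psi_meas hT).comp (meas_stopPath ⟨s, hs⟩)) (FbarRaw_le s A hA)
  · rw [mem_ofPred_eq, psi_stop hT hω, mem_stopPair_iff hs hA]

/-! hitting times -/

def hit (n : ℕ) (ω : Path T) : ℝ :=
  sInf ({t | 0 ≤ t ∧ t ≤ T ∧ (n:ℝ) + 1 ≤ |ev T hT ω t|} ∪ {T + 1 + n})

lemma hit_bdd (n : ℕ) (ω : Path T) :
    BddBelow ({t | 0 ≤ t ∧ t ≤ T ∧ (n:ℝ) + 1 ≤ |ev T hT ω t|} ∪ {T + 1 + n}) := by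
  refine ⟨0, ?_⟩
  rintro x (h | rfl)
  · exact h.1
  · positivity

lemma hit_le_of {n : ℕ} {ω : Path T} {t : ℝ} (h0 : 0 ≤ t) (h1 : t ≤ T)
    (h : (n:ℝ) + 1 ≤ |ev T hT ω t|) : hit hT n ω ≤ t :=
  csInf_le (hit_bdd hT n ω) (Or.inl ⟨h0, h1, h⟩)

lemma hit_nonneg (n : ℕ) (ω : Path T) : 0 ≤ hit hT n ω := by
  refine le_csInf ⟨T+1+n, Or.inr rfl⟩ ?_
  rintro x (h | rfl)
  · exact h.1
  · positivity

lemma hit_cases (n : ℕ) (ω : Path T) :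
    (0 ≤ hit hT n ω ∧ hit hT n ω ≤ T ∧ (n:ℝ) + 1 ≤ |ev T hT ω (hit hT n ω)|) ∨
      hit hT n ω = T + 1 + n := by
  have hc : IsClosed ({t | 0 ≤ t ∧ t ≤ T ∧ (n:ℝ) + 1 ≤ |ev T hT ω t|} ∪ {T + 1 + (n:ℝ)}) := by
    refine IsClosed.union ?_ isClosed_singleton
    exact (isClosed_le continuous_const continuous_id).inter
      ((isClosed_le continuous_id continuous_const).inter
        (isClosed_le continuous_const (ev_cont hT ω).abs))
  exact hc.csInf_mem ⟨_, Or.inr rfl⟩ (hit_bdd hT n ω)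

lemma hit_le_iff (n : ℕ) (ω : Path T) (t : Set.Icc (0:ℝ) T) :
    hit hT n ω ≤ t ↔ (n:ℝ) + 1 ≤ ‖stopPath T ω t‖ := by
  constructor
  · intro h
    rcases hit_cases hT n ω with h' | h'
    · refine h'.2.2.trans ?_
      have := (stopPath T ω t).norm_coe_le_norm ⟨hit hT n ω, h'.1, h'.2.1⟩
      refine le_trans (le_of_eq ?_) this
      rw [stop_apply, min_eq_right (show (⟨hit hT n ω, h'.1, h'.2.1⟩ : Set.Icc (0:ℝ) T) ≤ t from h),
        Real.norm_eq_abs, ← ev_coe hT]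
    · have := t.2.2
      have : (0:ℝ) ≤ n := Nat.cast_nonneg n
      linarith
  · intro h
    by_contra! hlt
    refine absurd h (not_le.2 ?_)
    rw [ContinuousMap.norm_lt_iff _ (by positivity)]
    intro s
    rw [stop_apply]
    by_contra! h'
    have := hit_le_of hT (min s t).2.1 (min s t).2.2 (n := n) (ω := ω) (by
      rw [ev_coe, min_comm]; exact h')
    have h2 : ((min s t : Set.Icc (0:ℝ) T) : ℝ) ≤ t := min_le_right (s:ℝ) t
    linarith

lemma hit_stop (n : ℕ) : IsStopRaw T (hit hT n) := by
  intro t ht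
  have : {ω | hit hT n ω ≤ t} = (fun ω => stopPath T ω ⟨t, ht⟩) ⁻¹' {ω | (n:ℝ) + 1 ≤ ‖ω‖} := by
    ext ω; exact hit_le_iff hT n ω ⟨t, ht⟩
  rw [this]
  exact meas_stopPath ⟨t, ht⟩ (isClosed_le continuous_const continuous_norm).measurableSet

lemma hit_mono (ω : Path T) : Monotone (fun n => hit hT n ω) := by
  intro a b hab
  have hab' : (a:ℝ) ≤ b := by exact_mod_cast hab
  refine le_csInf ⟨_, Or.inr rfl⟩ ?_
  rintro x (h | rfl)
  · exact hit_le_of hT h.1 h.2.1 (by linarith [h.2.2])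
  · exact (csInf_le (hit_bdd hT a ω) (Or.inr rfl)).trans (by linarith)

lemma hit_tendsto (ω : Path T) : Tendsto (fun n => hit hT n ω) atTop atTop := by
  have : ∀ᶠ n : ℕ in atTop, T + 1 + (n:ℝ) = hit hT n ω := by
    filter_upwards [eventually_ge_atTop ⌈‖ω‖⌉₊] with n hn
    rcases hit_cases hT n ω with h | h
    · have h1 : |ev T hT ω (hit hT n ω)| ≤ ‖ω‖ := ω.norm_coe_le_norm _
      have h2 := Nat.ceil_le.1 hn
      linarith [h.2.2]
    · exact h.symm
  exact (tendsto_atTop_add_const_left _ _ tendsto_natCast_atTop_atTop).congr' this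

lemma hit_bound (n : ℕ) (ω : Path T) (h0 : |ev T hT ω 0| < n + 1) {r : ℝ} (hr : r ≤ hit hT n ω) :
    |ev T hT ω r| ≤ n + 1 := by
  have key : ∀ r, 0 ≤ r → r ≤ T → r < hit hT n ω → |ev T hT ω r| < n + 1 := by
    intro r h0 h1 h2
    by_contra! h
    exact absurd (hit_le_of hT h0 h1 h) (not_le.2 h2)
  rcases le_or_gt r 0 with h | h
  · rw [ev_neg hT ω h]; exact h0.le
  · wlog hrT : r ≤ T
    · rcases lt_or_eq_of_le hT with hT0 | hT0
      · rw [ev_ge hT ω (not_le.1 hrT).le]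
        exact this hT n ω h0 ((not_le.1 hrT).le.trans hr) key hT0 le_rfl
      · rw [ev_ge hT ω (not_le.1 hrT).le, ev_neg hT ω hT0.symm.le]; exact h0.le
    have hc : r ∈ closure (Set.Ico 0 r) := by
      rw [closure_Ico h.ne]; exact ⟨h.le, le_rfl⟩
    have hcl : IsClosed {u | |ev T hT ω u| ≤ n + 1} := isClosed_le (ev_cont hT ω).abs continuous_const
    refine (hcl.closure_subset_iff.2 ?_) hc
    intro u hu
    exact (key u hu.1 (hu.2.le.trans hrT) (hu.2.trans_le hr)).le

lemma hit_zero (n : ℕ) (ω : Path T) (h0 : (n:ℝ) + 1 ≤ |ev T hT ω 0|) : hit hT n ω ≤ 0 :=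
  hit_le_of hT le_rfl hT h0

end P4
end PathwiseSuperhedging

namespace PathwiseSuperhedging
section P5
variable {Ω : Type*} {m0 : MeasurableSpace Ω} {P : Measure Ω} [IsProbabilityMeasure P]

lemma int_bdd {f : Ω → ℝ} (hf : Measurable f) {C : ℝ} (hb : ∀ x, |f x| ≤ C) : Integrable f P :=
  Integrable.of_bound hf.aestronglyMeasurable C (Eventually.of_forall hb)

lemma zero_mul_int {m : MeasurableSpace Ω} (hm : m ≤ m0) {D Y : Ω → ℝ} (hD : Integrable D P)
    (h0 : ∀ A, MeasurableSet[m] A → ∫ x in A, D x ∂P = 0) (hY : Measurable[m] Y) {C : ℝ}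
    (hb : ∀ x, |Y x| ≤ C) : ∫ x, Y x * D x ∂P = 0 := by
  have h1 : (0 : Ω → ℝ) =ᵐ[P] P[D | m] := by
    refine ae_eq_condExp_of_forall_setIntegral_eq hm hD (fun s _ _ => integrableOn_zero) ?_
      aestronglyMeasurable_zero
    intro s hs _
    simp [h0 s hs]
  have hint : Integrable (Y * D) P :=
    hD.bdd_mul (hY.mono hm le_rfl).aestronglyMeasurable (c := C) (Eventually.of_forall hb)
  have h2 := condExp_mul_of_stronglyMeasurable_left (m := m) (μ := P) hY.stronglyMeasurable hint hD
  have h3 := integral_condExp hm (f := Y * D) (μ := P)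
  have h4 : ∫ x, (Y * D) x ∂P = 0 := by
    rw [← h3, integral_congr_ae (g := 0)]
    · simp
    · filter_upwards [h1, h2] with x hx1 hx2
      rw [hx2, Pi.mul_apply, ← hx1]; simp
  exact h4

lemma zero_mul_set {m : MeasurableSpace Ω} (hm : m ≤ m0) {D Y : Ω → ℝ} (hD : Integrable D P)
    (h0 : ∀ A, MeasurableSet[m] A → ∫ x in A, D x ∂P = 0) (hY : Measurable[m] Y) {C : ℝ}
    (hb : ∀ x, |Y x| ≤ C) : ∀ A, MeasurableSet[m] A → ∫ x in A, Y x * D x ∂P = 0 := by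
  intro A hA
  have := zero_mul_int hm hD h0 (Y := A.indicator Y) (hY.indicator hA) (C := C) (by
    intro x
    by_cases h : x ∈ A
    · rw [indicator_of_mem h]; exact hb x
    · rw [indicator_of_notMem h, abs_zero]; exact (abs_nonneg _).trans (hb x))
  rw [← integral_indicator (hm _ hA), ← this]
  congr 1; funext x
  by_cases h : x ∈ A <;> simp [h]

section disc
variable {𝒢 : ℕ → MeasurableSpace Ω}

lemma sum_meas {d : ℕ → Ω → ℝ} {n : ℕ} (hmono : Monotone 𝒢)
    (hd : ∀ i < n, Measurable[𝒢 (i+1)] (d i)) :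
    Measurable[𝒢 n] (fun x => ∑ i ∈ Finset.range n, d i x) := by
  refine @Finset.measurable_fun_sum _ _ _ _ _ _ (𝒢 n) _ (Finset.range n) fun i hi => ?_
  have hi := Finset.mem_range.1 hi
  exact (hd i hi).mono (hmono hi) le_rfl

lemma sum_bdd {d : ℕ → Ω → ℝ} {n : ℕ} {C : ℝ} (hb : ∀ i < n, ∀ x, |d i x| ≤ C) (x : Ω) :
    |∑ i ∈ Finset.range n, d i x| ≤ n * C := by
  refine (Finset.abs_sum_le_sum_abs _ _).trans ?_
  refine (Finset.sum_le_sum (g := fun _ => C) fun i hi => hb i (Finset.mem_range.1 hi) x).trans ?_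
  simp

lemma l2_sum (hmono : Monotone 𝒢) (hle : ∀ i, 𝒢 i ≤ m0) {d : ℕ → Ω → ℝ} {C : ℝ} (n : ℕ)
    (hb : ∀ i < n, ∀ x, |d i x| ≤ C) (hd : ∀ i < n, Measurable[𝒢 (i+1)] (d i))
    (h0 : ∀ i < n, ∀ A, MeasurableSet[𝒢 i] A → ∫ x in A, d i x ∂P = 0) :
    ∫ x, (∑ i ∈ Finset.range n, d i x) ^ 2 ∂P = ∑ i ∈ Finset.range n, ∫ x, (d i x) ^ 2 ∂P := by
  induction n with
  | zero => simp
  | succ n ih =>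
    have ih := ih (fun i hi => hb i (by omega)) (fun i hi => hd i (by omega))
      (fun i hi => h0 i (by omega))
    rw [Finset.sum_range_succ, ← ih]
    set s := fun x => ∑ i ∈ Finset.range n, d i x with hs
    have hsm : Measurable[𝒢 n] s := sum_meas hmono (fun i hi => hd i (by omega))
    have hsb : ∀ x, |s x| ≤ n * C := sum_bdd (fun i hi => hb i (by omega))
    have hdn := (hd n (by omega)).mono (hle _) le_rfl
    have hdi : Integrable (d n) P := int_bdd hdn (hb n (by omega))
    have hz := zero_mul_int (hle n) hdi (h0 n (by omega)) hsm hsb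
    have hsm' := hsm.mono (hle _) le_rfl
    have i1 : Integrable (fun x => s x ^ 2) P := int_bdd (hsm'.pow_const 2) (C := (n*C)^2) (fun x => by
      rw [abs_pow]; exact pow_le_pow_left₀ (abs_nonneg _) (hsb x) 2)
    have i2 : Integrable (fun x => d n x ^ 2) P := int_bdd (hdn.pow_const 2) (C := C^2) (fun x => by
      rw [abs_pow]; exact pow_le_pow_left₀ (abs_nonneg _) (hb n (by omega) x) 2)
    have i3 : Integrable (fun x => s x * d n x) P := hdi.bdd_mul hsm'.aestronglyMeasurable
      (c := n*C) (Eventually.of_forall hsb)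
    have : ∀ x, (∑ i ∈ Finset.range (n+1), d i x) ^ 2 = s x ^ 2 + 2 * (s x * d n x) + d n x ^ 2 := by
      intro x; rw [Finset.sum_range_succ]; simp only [hs]; ring
    simp only [this]
    have i12 : Integrable (fun x => s x ^ 2 + 2 * (s x * d n x)) P := i1.add (i3.const_mul 2)
    rw [integral_add i12 i2, integral_add i1 (i3.const_mul 2),
      integral_const_mul, hz]
    ring

lemma kolm (hmono : Monotone 𝒢) (hle : ∀ i, 𝒢 i ≤ m0) {d : ℕ → Ω → ℝ} {C : ℝ} (n : ℕ)
    (hb : ∀ i < n, ∀ x, |d i x| ≤ C) (hd : ∀ i < n, Measurable[𝒢 (i+1)] (d i))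
    (h0 : ∀ i < n, ∀ A, MeasurableSet[𝒢 i] A → ∫ x in A, d i x ∂P = 0) {l : ℝ} (hl : 0 < l) :
    P {x | ∃ i ≤ n, l < |∑ j ∈ Finset.range i, d j x|} ≤
      ENNReal.ofReal ((∑ i ∈ Finset.range n, ∫ x, (d i x) ^ 2 ∂P) / l ^ 2) := by
  let θ : ℕ → Set Ω := fun i => {x | ∀ k ≤ i, |∑ j ∈ Finset.range k, d j x| ≤ l}
  have hθ : ∀ i < n, MeasurableSet[𝒢 i] (θ i) := by
    intro i hi
    have : θ i = ⋂ k ∈ Finset.range (i+1), {x | |∑ j ∈ Finset.range k, d j x| ≤ l} := by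
      ext x; simp [θ, Nat.lt_succ_iff]
    rw [this]
    refine @Finset.measurableSet_biInter _ _ (𝒢 i) _ _ fun k hk => ?_
    have hk := Finset.mem_range.1 hk
    have hm : Measurable[𝒢 i] (fun x => ∑ j ∈ Finset.range k, d j x) :=
      (sum_meas hmono (fun i hi => hd i (by omega))).mono (hmono (by omega)) le_rfl
    exact hm ((isClosed_le continuous_abs continuous_const).measurableSet : MeasurableSet {y : ℝ | |y| ≤ l})
  let e : ℕ → Ω → ℝ := fun i => (θ i).indicator (d i)
  have heb : ∀ i < n, ∀ x, |e i x| ≤ |d i x| := by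
    intro i hi x
    by_cases h : x ∈ θ i <;> simp [e, h]
  have heb' : ∀ i < n, ∀ x, |e i x| ≤ C := fun i hi x => (heb i hi x).trans (hb i hi x)
  have hem : ∀ i < n, Measurable[𝒢 (i+1)] (e i) := fun i hi =>
    (hd i hi).indicator (hmono (Nat.le_succ i) _ (hθ i hi))
  have hl2 := l2_sum (P := P) hmono hle n heb' hem (by
    intro i hi A hA
    simp only [e]
    rw [setIntegral_indicator (hle _ _ (hθ i hi))]
    exact h0 i hi _ (@MeasurableSet.inter _ (𝒢 i) _ _ hA (hθ i hi)))
  have hm : Measurable (fun x => ∑ i ∈ Finset.range n, e i x) :=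
    (sum_meas hmono hem).mono (hle _) le_rfl
  have hbd := sum_bdd heb'
  have hle2 : ∫ x, (∑ i ∈ Finset.range n, e i x) ^ 2 ∂P ≤ ∑ i ∈ Finset.range n, ∫ x, (d i x) ^ 2 ∂P := by
    rw [hl2]
    refine Finset.sum_le_sum fun i hi => ?_
    have hi := Finset.mem_range.1 hi
    refine integral_mono_of_nonneg (Eventually.of_forall fun x => sq_nonneg _) ?_
      (Eventually.of_forall fun x => sq_le_sq.2 (heb i hi x))
    exact int_bdd (((hd i hi).mono (hle _) le_rfl).pow_const 2) (C := C^2) (fun x => by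
      rw [abs_pow]; exact pow_le_pow_left₀ (abs_nonneg _) (hb i hi x) 2)
  have hsub : {x | ∃ i ≤ n, l < |∑ j ∈ Finset.range i, d j x|} ⊆
      {x | l ^ 2 ≤ (∑ i ∈ Finset.range n, e i x) ^ 2} := by
    rintro x ⟨i, hi, hix⟩
    have hex : ∃ i, l < |∑ j ∈ Finset.range i, d j x| := ⟨i, hix⟩
    set k := Nat.find hex with hk
    have hkn : k ≤ n := (Nat.find_min' hex hix).trans hi
    have hkl : l < |∑ j ∈ Finset.range k, d j x| := Nat.find_spec hex
    have hbefore : ∀ j < k, x ∈ θ j := by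
      intro j hj r hr
      by_contra! h
      exact absurd (Nat.find_min' hex h) (by omega)
    have hafter : ∀ j ≥ k, x ∉ θ j := by
      intro j hj h
      exact absurd (h k hj) (not_le.2 hkl)
    have : ∑ i ∈ Finset.range n, e i x = ∑ j ∈ Finset.range k, d j x := by
      rw [← Finset.sum_subset (Finset.range_subset_range.2 hkn)]
      · refine Finset.sum_congr rfl fun j hj => ?_
        exact indicator_of_mem (hbefore j (Finset.mem_range.1 hj)) _
      · intro j _ hj
        exact indicator_of_notMem (hafter j (by simpa using hj)) _
    rw [mem_ofPred_eq, this]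
    exact (sq_le_sq.2 (by rw [abs_of_pos hl]; exact hkl.le))
  have hint : Integrable (fun x => (∑ i ∈ Finset.range n, e i x) ^ 2) P :=
    int_bdd (hm.pow_const 2) (C := (n*C)^2) (fun x => by
      rw [abs_pow]; exact pow_le_pow_left₀ (abs_nonneg _) (hbd x) 2)
  have hmk := mul_meas_ge_le_integral_of_nonneg (μ := P)
    (Eventually.of_forall fun x => sq_nonneg (∑ i ∈ Finset.range n, e i x)) hint (l ^ 2)
  refine (measure_mono hsub).trans ?_
  rw [← ENNReal.ofReal_toReal (measure_ne_top P _)]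
  refine ENNReal.ofReal_le_ofReal ?_
  rw [le_div_iff₀ (by positivity), mul_comm]
  exact hmk.trans hle2

lemma fourth (hmono : Monotone 𝒢) (hle : ∀ i, 𝒢 i ≤ m0) {x v : ℕ → Ω → ℝ} {B A0 : ℝ} (n : ℕ)
    (hx : ∀ i ≤ n, Measurable[𝒢 i] (x i)) (hv : ∀ i ≤ n, Measurable[𝒢 i] (v i))
    (hxB : ∀ i ω, |x i ω| ≤ B) (hvB : ∀ i ω, |v i ω| ≤ B)
    {a : Ω → ℝ} (ham : Measurable a) (ha0 : ∀ ω, 0 ≤ a ω) (haA : ∀ ω, a ω ≤ A0)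
    (hxa : ∀ i < n, ∀ ω, (x (i+1) ω - x i ω) ^ 2 ≤ a ω)
    (hva : ∀ i < n, ∀ ω, |v (i+1) ω - v i ω| ≤ a ω)
    (hvm : ∀ᵐ ω ∂P, ∀ i < n, v i ω ≤ v (i+1) ω)
    (h0 : ∀ i < n, ∀ A, MeasurableSet[𝒢 i] A →
      ∫ ω in A, ((x (i+1) ω - x i ω) ^ 2 - (v (i+1) ω - v i ω)) ∂P = 0) {δ : ℝ} (hδ : 0 < δ) :
    ∑ i ∈ Finset.range n, ∫ ω, ((x (i+1) ω - x i ω) ^ 2 - (v (i+1) ω - v i ω)) ^ 2 ∂P ≤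
      (∫ ω, (a ω) ^ 2 ∂P) / δ + δ * (32 * B ^ 2 + 16 * A0 * B) := by
  set q : ℕ → Ω → ℝ := fun i ω => (x (i+1) ω - x i ω) ^ 2 - (v (i+1) ω - v i ω) with hq
  have hqm : ∀ i < n, Measurable[𝒢 (i+1)] (q i) := by
    intro i hi
    have h1 := hx (i+1) hi
    have h2 := (hx i hi.le).mono (hmono (Nat.le_succ i)) le_rfl
    have h3 := hv (i+1) hi
    have h4 := (hv i hi.le).mono (hmono (Nat.le_succ i)) le_rfl
    exact ((h1.sub h2).pow_const 2).sub (h3.sub h4)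
  have hqb : ∀ i < n, ∀ ω, |q i ω| ≤ 2 * A0 := by
    intro i hi ω
    have h1 := hxa i hi ω; have h2 := abs_le.1 (hva i hi ω); have h3 := haA ω
    rw [abs_le]; simp only [hq]
    constructor <;> nlinarith [sq_nonneg (x (i+1) ω - x i ω)]
  have hl2 := l2_sum (P := P) hmono hle n hqb hqm h0
  obtain ⟨ω0⟩ : Nonempty Ω := by
    by_contra h
    rw [not_nonempty_iff] at h
    have := measure_univ (μ := P)
    simp [Set.eq_empty_of_isEmpty] at this
  have hB : 0 ≤ B := (abs_nonneg _).trans (hxB 0 ω0)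
  have hA0 : 0 ≤ A0 := (ha0 ω0).trans (haA ω0)
  set R : Ω → ℝ := fun ω => v n ω - v 0 ω with hR
  have hRm : Measurable R := ((hv n le_rfl).mono (hle _) le_rfl).sub ((hv 0 (Nat.zero_le _)).mono (hle _) le_rfl)
  have hRb : ∀ ω, |R ω| ≤ 2 * B := by
    intro ω
    have h1 := abs_le.1 (hvB n ω); have h2 := abs_le.1 (hvB 0 ω)
    rw [abs_le]; simp only [hR]; constructor <;> linarith
  set s : Ω → ℝ := fun ω => ∑ i ∈ Finset.range n, q i ω with hs
  have hsm : Measurable s := (sum_meas hmono hqm).mono (hle _) le_rfl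
  have hsb : ∀ ω, |s ω| ≤ n * (2 * A0) := sum_bdd hqb
  set A : Ω → ℝ := fun ω => 2 * R ω + s ω with hA
  have hAeq : ∀ ω, A ω = ∑ i ∈ Finset.range n, ((x (i+1) ω - x i ω) ^ 2 + (v (i+1) ω - v i ω)) := by
    intro ω
    have : R ω = ∑ i ∈ Finset.range n, (v (i+1) ω - v i ω) := by
      rw [Finset.sum_range_sub (fun i => v i ω)]
    simp only [hA, hs, hq]
    rw [this, Finset.mul_sum, ← Finset.sum_add_distrib]
    exact Finset.sum_congr rfl fun i _ => by ring
  have hAm : Measurable A := (hRm.const_mul 2).add hsm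
  have hAb : ∀ ω, |A ω| ≤ 4 * B + n * (2 * A0) := by
    intro ω
    have h1 := abs_le.1 (hRb ω); have h2 := abs_le.1 (hsb ω)
    rw [abs_le]; simp only [hA]; constructor <;> linarith
  have hAi : Integrable A P := int_bdd hAm hAb
  have sqi : ∀ {f : Ω → ℝ} {C : ℝ}, Measurable f → (∀ ω, |f ω| ≤ C) → Integrable (fun ω => f ω ^ 2) P := by
    intro f C hf hb
    exact int_bdd (hf.pow_const 2) (C := C^2) (fun x => by
      rw [abs_pow]; exact pow_le_pow_left₀ (abs_nonneg _) (hb x) 2)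
  have hqi : ∀ i ∈ Finset.range n, Integrable (fun ω => q i ω ^ 2) P := fun i hi =>
    sqi ((hqm i (Finset.mem_range.1 hi)).mono (hle _) le_rfl) (hqb i (Finset.mem_range.1 hi))
  -- pointwise
  have hpt : ∀ᵐ ω ∂P, 0 ≤ A ω ∧ ∑ i ∈ Finset.range n, q i ω ^ 2 ≤ 2 * a ω * A ω := by
    filter_upwards [hvm] with ω hω
    rw [hAeq]
    refine ⟨Finset.sum_nonneg fun i hi => ?_, ?_⟩
    · have := hω i (Finset.mem_range.1 hi); nlinarith [sq_nonneg (x (i+1) ω - x i ω)]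
    · rw [Finset.mul_sum]
      refine Finset.sum_le_sum fun i hi => ?_
      have hi := Finset.mem_range.1 hi
      have h1 := hω i hi
      have h2 := hxa i hi ω
      have h3 := (abs_le.1 (hva i hi ω)).2
      simp only [hq]
      set X := (x (i+1) ω - x i ω) ^ 2 with hX
      have hX0 : 0 ≤ X := sq_nonneg _
      set V := v (i+1) ω - v i ω with hV
      have hV0 : 0 ≤ V := by simp only [hV]; linarith
      nlinarith [mul_nonneg hX0 (sub_nonneg.2 h2), mul_nonneg hV0 (sub_nonneg.2 h3), sq_nonneg (X + V)]
  have hEs : ∫ ω, s ω ∂P = 0 := by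
    simp only [hs]
    rw [integral_finsetSum _ (fun i hi => int_bdd ((hqm i (Finset.mem_range.1 hi)).mono (hle _) le_rfl)
      (hqb i (Finset.mem_range.1 hi)))]
    refine Finset.sum_eq_zero fun i hi => ?_
    have := h0 i (Finset.mem_range.1 hi) univ (@MeasurableSet.univ _ (𝒢 i))
    simpa using this
  have hRi : Integrable R P := int_bdd hRm hRb
  have hsi : Integrable s P := int_bdd hsm hsb
  have hEA : ∫ ω, A ω ∂P ≤ 4 * B := by
    simp only [hA]
    rw [integral_add (hRi.const_mul 2) hsi, hEs, integral_const_mul, add_zero]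
    have : ∫ ω, R ω ∂P ≤ ∫ ω, 2 * B ∂P := integral_mono hRi (integrable_const _)
      (fun ω => (abs_le.1 (hRb ω)).2)
    simp at this
    linarith
  have hsum : ∑ i ∈ Finset.range n, ∫ ω, q i ω ^ 2 ∂P = ∫ ω, ∑ i ∈ Finset.range n, q i ω ^ 2 ∂P :=
    (integral_finsetSum _ hqi).symm
  have hcrude : ∑ i ∈ Finset.range n, ∫ ω, q i ω ^ 2 ∂P ≤ 8 * A0 * B := by
    rw [hsum]
    calc _ ≤ ∫ ω, 2 * A0 * A ω ∂P := by
          refine integral_mono_ae (integrable_finsetSum _ hqi) (hAi.const_mul _) ?_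
          filter_upwards [hpt] with ω hω
          refine hω.2.trans ?_
          have := mul_le_mul_of_nonneg_right (haA ω) hω.1
          linarith
      _ ≤ _ := by rw [integral_const_mul]; nlinarith
  have hEA2 : ∫ ω, A ω ^ 2 ∂P ≤ 32 * B ^ 2 + 16 * A0 * B := by
    calc _ ≤ ∫ ω, (8 * (R ω) ^ 2 + 2 * (s ω) ^ 2) ∂P := by
          refine integral_mono (sqi hAm hAb) (((sqi hRm hRb).const_mul 8).add ((sqi hsm hsb).const_mul 2)) ?_
          intro ω
          simp only [hA]
          nlinarith [sq_nonneg (2 * R ω - s ω)]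
      _ = 8 * ∫ ω, R ω ^ 2 ∂P + 2 * ∫ ω, s ω ^ 2 ∂P := by
          rw [integral_add ((sqi hRm hRb).const_mul 8) ((sqi hsm hsb).const_mul 2),
            integral_const_mul, integral_const_mul]
      _ ≤ 8 * (2 * B) ^ 2 + 2 * (8 * A0 * B) := by
          have h1 : ∫ ω, R ω ^ 2 ∂P ≤ ∫ ω, (2 * B) ^ 2 ∂P := integral_mono (sqi hRm hRb) (integrable_const _)
            (fun ω => by dsimp only; exact sq_le_sq' (abs_le.1 (hRb ω)).1 (abs_le.1 (hRb ω)).2)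
          simp at h1
          have h2 : ∫ ω, s ω ^ 2 ∂P ≤ 8 * A0 * B := by rw [hl2]; exact hcrude
          linarith
      _ = _ := by ring
  have hab : ∀ ω, |a ω| ≤ A0 := fun ω => by rw [abs_of_nonneg (ha0 ω)]; exact haA ω
  rw [hsum]
  calc _ ≤ ∫ ω, ((a ω) ^ 2 / δ + δ * (A ω) ^ 2) ∂P := by
        refine integral_mono_ae (integrable_finsetSum _ hqi)
          (((sqi ham hab).div_const δ).add ((sqi hAm hAb).const_mul δ)) ?_
        filter_upwards [hpt] with ω hω
        refine hω.2.trans ?_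
        have h := sq_nonneg (a ω - δ * A ω)
        have h2 : (a ω) ^ 2 / δ + δ * (A ω) ^ 2 - 2 * a ω * A ω = (a ω - δ * A ω) ^ 2 / δ := by
          field_simp; ring
        have := div_nonneg h hδ.le
        linarith
    _ ≤ _ := by
        rw [integral_add ((sqi ham hab).div_const δ) ((sqi hAm hAb).const_mul δ),
          integral_const_mul, integral_div]
        have := mul_le_mul_of_nonneg_left hEA2 hδ.le
        linarith

end disc

lemma l2_conv {f : ℕ → Ω → ℝ} {g : Ω → ℝ} {C : ℝ} (hf : ∀ j, AEStronglyMeasurable (f j) P)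
    (hC : ∀ j, ∫⁻ x, ‖f j x‖ₑ ^ 2 ∂P ≤ ENNReal.ofReal C)
    (hlim : ∀ᵐ x ∂P, Tendsto (fun j => f j x) atTop (𝓝 (g x))) :
    AEStronglyMeasurable g P ∧ ∫⁻ x, ‖g x‖ₑ ^ 2 ∂P ≤ ENNReal.ofReal C ∧ Integrable g P ∧
      ∀ A, Tendsto (fun j => ∫ x in A, f j x ∂P) atTop (𝓝 (∫ x in A, g x ∂P)) := by
  have hg : AEStronglyMeasurable g P := aestronglyMeasurable_of_tendsto_ae atTop hf hlim
  have hui : UniformIntegrable f 1 P := by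
    refine uniformIntegrable_of le_rfl ENNReal.one_ne_top hf fun ε hε => ?_
    set K : ℝ := |C| / ε + 1 with hK
    have hK0 : 0 < K := by positivity
    refine ⟨⟨K, hK0.le⟩, fun i => ?_⟩
    rw [eLpNorm_one_eq_lintegral_enorm]
    have h1 : ENNReal.ofReal K * ∫⁻ x, ‖({x | (⟨K, hK0.le⟩ : NNReal) ≤ ‖f i x‖₊}.indicator (f i)) x‖ₑ ∂P
        ≤ ENNReal.ofReal K * ENNReal.ofReal ε := by
      rw [← lintegral_const_mul' _ _ ENNReal.ofReal_ne_top]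
      refine (lintegral_mono (g := fun x => ‖f i x‖ₑ ^ 2) fun x => ?_).trans ((hC i).trans ?_)
      · by_cases h : x ∈ {x | (⟨K, hK0.le⟩ : NNReal) ≤ ‖f i x‖₊}
        · rw [indicator_of_mem h]; dsimp only; rw [sq]
          gcongr
          have h' : K ≤ ‖f i x‖ := h
          rw [← ofReal_norm]
          exact ENNReal.ofReal_le_ofReal h'
        · rw [indicator_of_notMem h]; simp
      · rw [← ENNReal.ofReal_mul hK0.le]
        refine ENNReal.ofReal_le_ofReal ?_
        rw [hK, add_mul, div_mul_cancel₀ _ hε.ne']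
        linarith [le_abs_self C]
    exact (ENNReal.mul_le_mul_iff_right (by simpa using hK0) ENNReal.ofReal_ne_top).1 h1
  have hgi : Integrable g P := hui.integrable_of_ae_tendsto hlim
  refine ⟨hg, ?_, hgi, ?_⟩
  · calc ∫⁻ x, ‖g x‖ₑ ^ 2 ∂P = ∫⁻ x, liminf (fun j => ‖f j x‖ₑ ^ 2) atTop ∂P := by
          refine lintegral_congr_ae ?_
          filter_upwards [hlim] with x hx
          exact (((ENNReal.continuous_pow 2).tendsto _).comp hx.enorm).liminf_eq.symm
      _ ≤ liminf (fun j => ∫⁻ x, ‖f j x‖ₑ ^ 2 ∂P) atTop :=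
          lintegral_liminf_le' fun j => (hf j).enorm.pow_const 2
      _ ≤ _ := by
          refine liminf_le_of_frequently_le (Eventually.frequently (Eventually.of_forall hC))
  · intro A
    exact tendsto_setIntegral_of_L1' g hg
      (Eventually.of_forall fun j => memLp_one_iff_integrable.1 (hui.memLp j))
      (tendsto_Lp_finite_of_tendsto_ae le_rfl ENNReal.one_ne_top hf
        (memLp_one_iff_integrable.2 hgi) hui.2.1 hlim) A

end P5
end PathwiseSuperhedging

namespace PathwiseSuperhedging
section P6
variable {T : ℝ} (hT : 0 ≤ T)

structure Good (X : ℝ → PathPair T → ℝ) : Prop where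
  meas : Measurable (fun z : PathPair T × ℝ => X z.2 z.1)
  cont : ∀ p, Continuous (fun u => X u p)
  stopt : ∀ p (s : Set.Icc (0:ℝ) T) r, X r (stopPair p s) = X (min s r) p
  pos : ∀ p r, X (max 0 r) p = X r p

lemma good_S : Good (SbarProc T hT) where
  meas := ev_meas hT (measurable_fst.comp measurable_fst) measurable_snd
  cont p := ev_cont hT p.1
  stopt p s r := ev_stop hT p.1 s r
  pos p r := ev_max hT p.1 r

lemma good_SS : Good (SSbarProc T hT) where
  meas := SSbar_meas hT measurable_fst measurable_snd
  cont p := by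
    unfold SSbarProc
    exact ((((ev_cont hT p.1).pow 2).sub continuous_const).sub (ev_cont hT p.2)).div_const 2
  stopt p s r := SSbar_stop hT p s r
  pos p r := by unfold SSbarProc; rw [ev_max, ev_max]

lemma good_V : Good (VbarProc T hT) where
  meas := ev_meas hT (measurable_snd.comp measurable_fst) measurable_snd
  cont p := ev_cont hT p.2
  stopt p s r := ev_stop hT p.2 s r
  pos p r := ev_max hT p.2 r

lemma stop_min_meas {τ : PathPair T → ℝ} (hτ : IsStopBarRaw T τ) {u : ℝ} (hu : u ∈ Set.Icc (0:ℝ) T) :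
    Measurable[FbarRaw T u] (fun p => max 0 (min (τ p) u)) := by
  refine @measurable_of_Iic ℝ (PathPair T) _ _ _ (FbarRaw T u) _ _ _ _ fun c => ?_
  rcases lt_or_ge c 0 with hc | hc
  · convert @MeasurableSet.empty _ (FbarRaw T u)
    ext p
    simp only [mem_preimage, mem_Iic, mem_empty_iff_false, iff_false, not_le]
    exact hc.trans_le (le_max_left _ _)
  · rcases lt_or_ge c u with hcu | hcu
    · have := FbarRaw_mono hcu.le _ (hτ c ⟨hc, hcu.le.trans hu.2⟩)
      convert this using 1
      ext p
      simp only [mem_preimage, mem_Iic, mem_ofPred_eq, max_le_iff, min_le_iff]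
      constructor
      · rintro ⟨_, h | h⟩
        · exact h
        · linarith
      · intro h; exact ⟨hc, Or.inl h⟩
    · convert @MeasurableSet.univ _ (FbarRaw T u)
      ext p
      simp only [mem_preimage, mem_Iic, mem_univ, iff_true]
      exact max_le hc ((min_le_right _ _).trans hcu)

lemma adapted {X : ℝ → PathPair T → ℝ} (hX : Good X) {τ : PathPair T → ℝ} (hτ : IsStopBarRaw T τ)
    {u : ℝ} (hu : u ∈ Set.Icc (0:ℝ) T) : Measurable[FbarRaw T u] (fun p => X (min (τ p) u) p) := by
  have h1 := stop_min_meas hτ hu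
  have h2 := meas_stopPair (T := T) ⟨u, hu⟩
  have h3 := hX.meas.comp (@Measurable.prodMk _ (FbarRaw T u) _ _ _ _ _ _ h2 h1)
  convert h3 using 1
  funext p
  simp only [Function.comp]
  rw [hX.stopt]
  have e : min u (max 0 (min (τ p) u)) = max 0 (min (τ p) u) :=
    min_eq_right (max_le hu.1 (min_le_right _ _))
  simp only [e]
  exact (hX.pos p _).symm

lemma adapted0 {X : ℝ → PathPair T → ℝ} (hX : Good X)
    {u : ℝ} (hu : u ∈ Set.Icc (0:ℝ) T) : Measurable[FbarRaw T u] (fun p => X u p) := by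
  have h2 := meas_stopPair (T := T) ⟨u, hu⟩
  have h3 := hX.meas.comp (@Measurable.prodMk _ (FbarRaw T u) _ _ _ _ _ _ h2 
    (@measurable_const _ _ _ (FbarRaw T u) u))
  convert h3 using 1
  funext p
  simp only [Function.comp]
  rw [hX.stopt, min_self]

lemma gr_mem {s h : ℝ} (hs : 0 ≤ s) (hh : 0 ≤ h) {J N : ℕ} (hT' : s + J * h ≤ T) {i : ℕ}
    (hi : i ≤ J * 2 ^ N) : gr s h N i ∈ Set.Icc (0:ℝ) T := by
  refine ⟨?_, ?_⟩
  · exact hs.trans ((gr_zero s h N).symm.le.trans (gr_mono s hh N (Nat.zero_le _)))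
  · exact (gr_mono s hh N hi).trans ((gr_last s h N J).le.trans hT')

def kap (s h : ℝ) (ρ : PathPair T → ℝ) (N : ℕ) (p : PathPair T) : ℕ :=
  min (2 ^ N) ⌈(ρ p - s) / (h / 2 ^ N)⌉₊

lemma kap_le_iff {s h : ℝ} (hh : 0 < h) (ρ : PathPair T → ℝ) (N : ℕ) (p : PathPair T) {i : ℕ}
    (hi : i < 2 ^ N) : kap s h ρ N p ≤ i ↔ ρ p ≤ gr s h N i := by
  unfold kap gr
  have : (0:ℝ) < h / 2 ^ N := by positivity
  rw [min_le_iff, Nat.ceil_le, div_le_iff₀ this]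
  constructor
  · rintro (h | h)
    · omega
    · linarith
  · intro h; right; linarith

lemma kap_tendsto {s h : ℝ} (hh : 0 < h) (ρ : PathPair T → ℝ) (p : PathPair T) :
    Tendsto (fun N => gr s h N (kap s h ρ N p)) atTop (𝓝 (max s (min (ρ p) (s + h)))) := by
  have hz : Tendsto (fun N : ℕ => h / 2 ^ N) atTop (𝓝 0) := by
    have := (tendsto_pow_atTop_nhds_zero_of_lt_one (r := (1/2:ℝ)) (by norm_num) (by norm_num)).const_mul h
    simp only [mul_zero] at this
    refine this.congr fun N => ?_
    rw [one_div, inv_pow]; rfl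
  rw [tendsto_iff_dist_tendsto_zero]
  refine squeeze_zero (fun _ => dist_nonneg) (fun N => ?_) hz
  have hp : (0:ℝ) < h / 2 ^ N := by positivity
  have hl : gr s h N (2 ^ N) = s + h := by
    have := gr_last s h N 1; simpa using this
  unfold kap
  rw [Real.dist_eq, (gr_mono s hh.le N).map_min, hl]
  set c := ⌈(ρ p - s) / (h / 2 ^ N)⌉₊
  have h0 : s ≤ gr s h N c := (gr_zero s h N).symm.le.trans (gr_mono s hh.le N (Nat.zero_le _))
  have h1 : ρ p ≤ gr s h N c := by
    have : ρ p - s ≤ (c:ℝ) * (h / 2 ^ N) := (div_le_iff₀ hp).1 (Nat.le_ceil _)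
    unfold gr; linarith
  have h2 : gr s h N c ≤ max s (ρ p) + h / 2 ^ N := by
    rcases le_or_gt (ρ p) s with hσ | hσ
    · have : c = 0 := Nat.ceil_eq_zero.2 (div_nonpos_of_nonpos_of_nonneg (by linarith) hp.le)
      rw [this, gr_zero, max_eq_left hσ]; linarith
    · have := Nat.ceil_lt_add_one (show 0 ≤ (ρ p - s) / (h / 2 ^ N) from
        div_nonneg (by linarith) hp.le)
      have h3 : (c:ℝ) * (h / 2 ^ N) ≤ (ρ p - s) + h / 2 ^ N := by
        have := mul_le_mul_of_nonneg_right this.le hp.le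
        rwa [add_mul, div_mul_cancel₀ _ hp.ne', one_mul] at this
      rw [max_eq_right hσ.le]
      unfold gr; linarith
  rw [abs_le]
  constructor <;>
  rcases le_total (s+h) (gr s h N c) with a | a <;> rcases le_total (ρ p) (s+h) with b | b <;>
  rcases le_total s (ρ p) with d | d <;>
  simp only [min_eq_left a, min_eq_right a, min_eq_left b, min_eq_right b, max_eq_left d, max_eq_right d,
    max_eq_right (show s ≤ s + h by linarith)] at * <;> linarith

lemma os_grid {X : ℝ → PathPair T → ℝ} (hX : Good X) {Q : Measure (PathPair T)}
    [IsProbabilityMeasure Q] {τ ρ : PathPair T → ℝ} (hτ : IsStopBarRaw T τ) (hρ : IsStopBarRaw T ρ)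
    (hM : IsMartBar T Q (fun t p => X (min (τ p) t) p)) {s h : ℝ} (hs : 0 ≤ s) (hh : 0 < h)
    (hT' : s + h ≤ T) (N : ℕ) : ∃ mN : MeasurableSpace (PathPair T), mN ≤ (Prod.instMeasurableSpace : MeasurableSpace (PathPair T)) ∧
      FbarRaw T s ≤ mN ∧
      (fun p => X (min (τ p) (gr s h N (kap s h ρ N p))) p) =ᵐ[Q]
        Q[fun p => X (min (τ p) (s + h)) p | mN] := by
  have hl : gr s h N (2 ^ N) = s + h := by
    have := gr_last s h N 1; simpa using this
  have hmem : ∀ i ≤ 2 ^ N, gr s h N i ∈ Set.Icc (0:ℝ) T := fun i hi =>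
    gr_mem hs hh.le (J := 1) (by simpa using hT') (by simpa using hi)
  have hmem' : ∀ i, gr s h N (min i (2 ^ N)) ∈ Set.Icc (0:ℝ) T := fun i => hmem _ (min_le_right _ _)
  let 𝒢 : Filtration ℕ (inferInstance : MeasurableSpace (PathPair T)) :=
    ⟨fun i => FbarRaw T (gr s h N (min i (2 ^ N))),
     fun i j hij => FbarRaw_mono (gr_mono s hh.le N (min_le_min_right _ hij)), fun i => FbarRaw_le _⟩
  let f : ℕ → PathPair T → ℝ := fun i p => X (min (τ p) (gr s h N (min i (2 ^ N)))) p
  have hf : Martingale f 𝒢 Q := by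
    refine martingale_of_setIntegral_eq_succ (fun i => ?_) (fun i => hM.1 _ (hmem' i)) ?_
    · exact (adapted hX hτ (hmem' i)).stronglyMeasurable
    · intro i A hA
      exact (hM.2 _ _ (hmem' i) (hmem' (i+1)) (gr_mono s hh.le N (min_le_min_right _ (Nat.le_succ i))) A hA).symm
  have hk : IsStoppingTime 𝒢 (fun p => ((kap s h ρ N p : ℕ) : WithTop ℕ)) := by
    intro i
    have e0 : {p | ((kap s h ρ N p : ℕ) : WithTop ℕ) ≤ (i : WithTop ℕ)} = {p | kap s h ρ N p ≤ i} := by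
      ext p; exact WithTop.coe_le_coe
    change MeasurableSet[𝒢 i] {p | ((kap s h ρ N p : ℕ) : WithTop ℕ) ≤ (i : WithTop ℕ)}
    rw [e0]
    rcases lt_or_ge i (2 ^ N) with hi | hi
    · have : {p | kap s h ρ N p ≤ i} = {p | ρ p ≤ gr s h N i} := by
        ext p; exact kap_le_iff hh ρ N p hi
      change MeasurableSet[FbarRaw T (gr s h N (min i (2 ^ N)))] {p | kap s h ρ N p ≤ i}
      rw [this, min_eq_left hi.le]
      exact hρ _ (hmem i hi.le)
    · have : {p | kap s h ρ N p ≤ i} = univ := by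
        ext p; simp only [mem_ofPred_eq, mem_univ, iff_true]; exact (min_le_left _ _).trans hi
      rw [this]; exact @MeasurableSet.univ _ (𝒢 i)
  have hkle : ∀ p, ((kap s h ρ N p : ℕ) : WithTop ℕ) ≤ ((2 ^ N : ℕ) : WithTop ℕ) := fun p =>
    WithTop.coe_le_coe.2 (min_le_left _ _)
  refine ⟨hk.measurableSpace, hk.measurableSpace_le, ?_, ?_⟩
  · have := hk.le_measurableSpace_of_const_le (i := 0) (fun _ => bot_le)
    refine le_trans ?_ this
    change _ ≤ FbarRaw T (gr s h N (min 0 (2 ^ N)))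
    rw [Nat.zero_min, gr_zero]
  · have := hf.stoppedValue_ae_eq_condExp_of_le_const hk hkle
    have e1 : stoppedValue f (fun p => ((kap s h ρ N p : ℕ) : WithTop ℕ)) =
        (fun p => X (min (τ p) (gr s h N (kap s h ρ N p))) p) := by
      funext p
      change f (kap s h ρ N p) p = _
      simp only [f]
      rw [min_eq_left (show kap s h ρ N p ≤ 2 ^ N from min_le_left _ _)]
    have e2 : f (2 ^ N) = fun p => X (min (τ p) (s + h)) p := by
      funext p; simp only [f]; rw [min_self, hl]
    rw [e1] at this
    have e3 : f ((2 ^ N : ℕ) : ℕ) = fun p => X (min (τ p) (s + h)) p := e2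
    rw [← e2]
    exact this

lemma os1 {X : ℝ → PathPair T → ℝ} (hX : Good X) {Q : Measure (PathPair T)}
    [IsProbabilityMeasure Q] {τ ρ : PathPair T → ℝ} (hτ : IsStopBarRaw T τ) (hρ : IsStopBarRaw T ρ)
    (hM : IsMartBar T Q (fun t p => X (min (τ p) t) p)) {s h : ℝ} (hs : 0 ≤ s) (hh : 0 < h)
    (hT' : s + h ≤ T) {A : Set (PathPair T)} (hA : MeasurableSet[FbarRaw T s] A) :
    ∫ p in A, X (min (τ p) (max s (min (ρ p) (s + h)))) p ∂Q =
      ∫ p in A, X (min (τ p) s) p ∂Q := by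
  choose mN hle hsle hae using os_grid hX hτ hρ hM hs hh hT'
  have hmem : s + h ∈ Set.Icc (0:ℝ) T := ⟨by linarith, hT'⟩
  have hint := hM.1 _ hmem
  have hui := hint.uniformIntegrable_condExp hle
  have hae' := ae_all_iff.2 hae
  have hlim : ∀ᵐ p ∂Q, Tendsto (fun N => (Q[fun p => X (min (τ p) (s + h)) p | mN N]) p) atTop
      (𝓝 (X (min (τ p) (max s (min (ρ p) (s + h)))) p)) := by
    filter_upwards [hae'] with p hp
    simp only [← hp]
    exact ((hX.cont p).tendsto _).comp (tendsto_const_nhds.min (kap_tendsto hh ρ p))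
  have hmeas : ∀ N, AEStronglyMeasurable (Q[fun p => X (min (τ p) (s + h)) p | mN N]) Q :=
    fun N => integrable_condExp.aestronglyMeasurable
  have hgi := hui.integrable_of_ae_tendsto hlim
  have ht := tendsto_setIntegral_of_L1' _ hgi.aestronglyMeasurable
      (Eventually.of_forall fun j => integrable_condExp)
      (tendsto_Lp_finite_of_tendsto_ae le_rfl ENNReal.one_ne_top hmeas
        (memLp_one_iff_integrable.2 hgi) hui.2.1 hlim) A
  refine tendsto_nhds_unique ht (tendsto_const_nhds.congr fun N => ?_)
  rw [setIntegral_condExp (hle N) hint (hsle N _ hA)]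
  exact (hM.2 s (s+h) ⟨hs, by linarith⟩ hmem (by linarith) A hA).symm

lemma os {X : ℝ → PathPair T → ℝ} (hX : Good X) {Q : Measure (PathPair T)}
    [IsProbabilityMeasure Q] (hl : IsLocalMartBar T Q X) {ρ : PathPair T → ℝ}
    (hρ : IsStopBarRaw T ρ) {Y : PathPair T → ℝ} (hY : Integrable Y Q)
    (hdom : ∀ᵐ p ∂Q, ∀ u, |X (min (ρ p) u) p| ≤ Y p) :
    IsMartBar T Q (fun t p => X (min (ρ p) t) p) := by
  obtain ⟨τ, hτ, hτl, hM⟩ := hl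
  have hmeas : ∀ t ∈ Set.Icc (0:ℝ) T, Measurable (fun p => X (min (ρ p) t) p) := fun t ht =>
    (adapted hX hρ ht).mono (FbarRaw_le t) le_rfl
  refine ⟨fun t ht => ?_, ?_⟩
  · refine hY.mono' (hmeas t ht).aestronglyMeasurable ?_
    filter_upwards [hdom] with p hp
    exact hp t
  intro s t hs ht hst A hA
  rcases hst.eq_or_lt with rfl | hlt
  · rfl
  have hmin : ∀ m, IsStopBarRaw T (fun p => min (ρ p) (τ m p)) := by
    intro m u hu
    have : {p | min (ρ p) (τ m p) ≤ u} = {p | ρ p ≤ u} ∪ {p | τ m p ≤ u} := by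
      ext p; simp [min_le_iff]
    rw [this]
    exact @MeasurableSet.union _ (FbarRaw T u) _ _ (hρ u hu) (hτ m u hu)
  -- equality for each m
  have hm : ∀ m, ∫ p in A, X (min (min (ρ p) (τ m p)) t) p ∂Q =
      ∫ p in A, X (min (min (ρ p) (τ m p)) s) p ∂Q := by
    intro m
    set B := {p | ρ p ≤ s} with hB
    have hBm : MeasurableSet[FbarRaw T s] B := hρ s hs
    have hB' : MeasurableSet B := FbarRaw_le s _ hBm
    have hAm : MeasurableSet A := FbarRaw_le s _ hA
    have hint : ∀ u ∈ Set.Icc (0:ℝ) T, Integrable (fun p => X (min (min (ρ p) (τ m p)) u) p) Q := by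
      intro u hu
      refine hY.mono' ((adapted hX (hmin m) hu).mono (FbarRaw_le u) le_rfl).aestronglyMeasurable ?_
      filter_upwards [hdom] with p hp
      have := hp (min (τ m p) u)
      rwa [← min_assoc] at this
    rw [← integral_inter_add_sdiff hB' (hint t ht).integrableOn,
      ← integral_inter_add_sdiff hB' (hint s hs).integrableOn]
    congr 1
    · refine setIntegral_congr_fun (hAm.inter hB') fun p hp => ?_
      have h1 : ρ p ≤ s := hp.2
      congr 1
      rw [min_right_comm, min_right_comm _ _ s, min_eq_left (h1.trans hst), min_eq_left h1]
    · have hAB : MeasurableSet[FbarRaw T s] (A \ B) := @MeasurableSet.diff _ (FbarRaw T s) _ _ hA hBm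
      have h1 := os1 hX (hτ m) hρ (hM m) hs.1 (h := t - s) (by linarith) (by linarith [ht.2]) hAB
      rw [show s + (t - s) = t by ring] at h1
      convert h1 using 1
      · refine setIntegral_congr_fun (hAm.diff hB') fun p hp => ?_
        have h1 : s < ρ p := not_le.1 hp.2
        congr 1
        rw [max_eq_right (le_min h1.le hst), min_comm (ρ p), min_assoc]
      · refine setIntegral_congr_fun (hAm.diff hB') fun p hp => ?_
        have h1 : s < ρ p := not_le.1 hp.2
        congr 1
        rw [min_comm (ρ p), min_assoc, min_eq_right h1.le]
  have hlimt : ∀ u ∈ Set.Icc (0:ℝ) T, Tendsto (fun m => ∫ p in A, X (min (min (ρ p) (τ m p)) u) p ∂Q) atTop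
      (𝓝 (∫ p in A, X (min (ρ p) u) p ∂Q)) := by
    intro u hu
    refine tendsto_integral_of_dominated_convergence Y
      (fun m => ((adapted hX (hmin m) hu).mono (FbarRaw_le u) le_rfl).aestronglyMeasurable)
      hY.integrableOn ?_ ?_
    · intro m
      refine ae_restrict_of_ae ?_
      filter_upwards [hdom] with p hp
      have := hp (min (τ m p) u)
      rwa [← min_assoc] at this
    · refine ae_restrict_of_ae ?_
      filter_upwards [hτl] with p hp
      refine tendsto_const_nhds.congr' ?_
      filter_upwards [hp.2.eventually_ge_atTop u] with m hm
      rw [min_assoc, min_eq_right hm]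
  refine tendsto_nhds_unique (hlimt t ht) ?_
  simp only [hm]
  exact hlimt s hs

end P6
end PathwiseSuperhedging

namespace PathwiseSuperhedging
section P7
variable {T : ℝ} (hT : 0 ≤ T)

lemma msub {α : Type*} {m : MeasurableSpace α} {f g : α → ℝ} (hf : Measurable[m] f) (hg : Measurable[m] g) :
    Measurable[m] (fun p => f p - g p) := hf.sub hg

lemma mmul {α : Type*} {m : MeasurableSpace α} {f g : α → ℝ} (hf : Measurable[m] f) (hg : Measurable[m] g) :
    Measurable[m] (fun p => f p * g p) := hf.mul hg

lemma mite {α : Type*} {m : MeasurableSpace α} {f g : α → ℝ} {P : α → Prop}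
    (hP : MeasurableSet[m] {x | P x}) (hf : Measurable[m] f) (hg : Measurable[m] g) :
    Measurable[m] (fun p => if P p then f p else g p) := Measurable.ite hP hf hg

def rho (n : ℕ) (p : PathPair T) : ℝ := min (hit hT n p.1) (hit hT n p.2)
def xx (n : ℕ) (u : ℝ) (p : PathPair T) : ℝ := ev T hT p.1 (min (rho hT n p) u) - ev T hT p.1 0
def vv (n : ℕ) (u : ℝ) (p : PathPair T) : ℝ := ev T hT p.2 (min (rho hT n p) u) - ev T hT p.2 0
def cc (n m : ℕ) (u : ℝ) (p : PathPair T) : ℝ := if rho hT n p ≤ u then 0 else lastS hT m u p.1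

lemma rho_nonneg (n : ℕ) (p : PathPair T) : 0 ≤ rho hT n p :=
  le_min (hit_nonneg hT n _) (hit_nonneg hT n _)

lemma hit_fst_stop (n : ℕ) : IsStopBarRaw T (fun p => hit hT n p.1) := by
  intro t ht
  have : Measurable[FbarRaw T t] (fun p : PathPair T => stopPath T p.1 ⟨t, ht⟩) :=
    measurable_fst.comp (meas_stopPair (T := T) ⟨t, ht⟩)
  have e : {p : PathPair T | hit hT n p.1 ≤ t} =
      (fun p : PathPair T => stopPath T p.1 ⟨t, ht⟩) ⁻¹' {ω | (n:ℝ) + 1 ≤ ‖ω‖} := by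
    ext p; exact hit_le_iff hT n p.1 ⟨t, ht⟩
  rw [e]
  exact this (measurableSet_le measurable_const continuous_norm.measurable)

lemma hit_snd_stop (n : ℕ) : IsStopBarRaw T (fun p => hit hT n p.2) := by
  intro t ht
  have : Measurable[FbarRaw T t] (fun p : PathPair T => stopPath T p.2 ⟨t, ht⟩) :=
    measurable_snd.comp (meas_stopPair (T := T) ⟨t, ht⟩)
  have e : {p : PathPair T | hit hT n p.2 ≤ t} =
      (fun p : PathPair T => stopPath T p.2 ⟨t, ht⟩) ⁻¹' {ω | (n:ℝ) + 1 ≤ ‖ω‖} := by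
    ext p; exact hit_le_iff hT n p.2 ⟨t, ht⟩
  rw [e]
  exact this (measurableSet_le measurable_const continuous_norm.measurable)

lemma rho_stop (n : ℕ) : IsStopBarRaw T (rho hT n) := by
  intro t ht
  have : {p | rho hT n p ≤ t} = {p | hit hT n p.1 ≤ t} ∪ {p | hit hT n p.2 ≤ t} := by
    ext p; simp [rho]
  rw [this]
  exact @MeasurableSet.union _ (FbarRaw T t) _ _ (hit_fst_stop hT n t ht) (hit_snd_stop hT n t ht)

lemma rho_mono (p : PathPair T) : Monotone (fun n => rho hT n p) := fun _ _ h =>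
  min_le_min (hit_mono hT p.1 h) (hit_mono hT p.2 h)

lemma rho_tendsto (p : PathPair T) : Tendsto (fun n => rho hT n p) atTop atTop := by
  rw [tendsto_atTop]
  intro b
  filter_upwards [(hit_tendsto hT p.1).eventually_ge_atTop b,
    (hit_tendsto hT p.2).eventually_ge_atTop b] with n h1 h2
  exact le_min h1 h2

lemma bd_aux (n : ℕ) (ω : Path T) {r : ℝ} (hr : r ≤ hit hT n ω) :
    (|ev T hT ω r| ≤ n + 1 ∧ |ev T hT ω 0| ≤ n + 1) ∨ ev T hT ω r = ev T hT ω 0 := by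
  rcases lt_or_ge |ev T hT ω 0| ((n:ℝ) + 1) with h | h
  · exact Or.inl ⟨hit_bound hT n ω h hr, h.le⟩
  · exact Or.inr (ev_neg hT ω (hr.trans (hit_zero hT n ω h)))

lemma bd_aux2 (n : ℕ) (ω : Path T) {r : ℝ} (hr : r ≤ hit hT n ω) :
    |ev T hT ω r - ev T hT ω 0| ≤ 2 * (n + 1) ∧
    |ev T hT ω r ^ 2 - ev T hT ω 0 ^ 2| ≤ (n + 1) ^ 2 := by
  rcases bd_aux hT n ω hr with ⟨h1, h2⟩ | h
  · rw [abs_le] at *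
    refine ⟨by constructor <;> linarith, ?_⟩
    rw [abs_le]
    constructor <;> nlinarith [sq_nonneg (ev T hT ω r), sq_nonneg (ev T hT ω 0)]
  · rw [h, sub_self, sub_self, abs_zero]; constructor <;> positivity

lemma xx_bd (n : ℕ) (u : ℝ) (p : PathPair T) : |xx hT n u p| ≤ 2 * (n + 1) :=
  (bd_aux2 hT n p.1 ((min_le_left _ _).trans (min_le_left _ _))).1

lemma sq_bd (n : ℕ) (u : ℝ) (p : PathPair T) :
    |ev T hT p.1 (min (rho hT n p) u) ^ 2 - ev T hT p.1 0 ^ 2| ≤ (n + 1) ^ 2 :=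
  (bd_aux2 hT n p.1 ((min_le_left _ _).trans (min_le_left _ _))).2

lemma vv_bd (n : ℕ) (u : ℝ) (p : PathPair T) : |vv hT n u p| ≤ 2 * (n + 1) :=
  (bd_aux2 hT n p.2 ((min_le_left _ _).trans (min_le_right _ _))).1

lemma S_bd (n : ℕ) {u : ℝ} (hu : 0 ≤ u) (p : PathPair T) (h : u < rho hT n p) {r : ℝ} (hr : r ≤ u) :
    |ev T hT p.1 r| ≤ n + 1 := by
  have h1 : u < hit hT n p.1 := h.trans_le (min_le_left _ _)
  rcases lt_or_ge |ev T hT p.1 0| ((n:ℝ) + 1) with h2 | h2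
  · exact hit_bound hT n p.1 h2 (hr.trans h1.le)
  · linarith [hit_zero hT n p.1 h2]

lemma cc_bd (n m : ℕ) {u : ℝ} (hu : u ∈ Set.Icc (0:ℝ) T) (p : PathPair T) :
    |cc hT n m u p| ≤ n + 1 := by
  unfold cc
  split_ifs with h
  · rw [abs_zero]; positivity
  · obtain ⟨k, h1, -, h3⟩ := lastS_spec hT m p.1 hu.1 hu.2
    rw [h3]
    exact S_bd hT n hu.1 p (not_le.1 h) h1

lemma xx_meas (n : ℕ) {u : ℝ} (hu : u ∈ Set.Icc (0:ℝ) T) : Measurable[FbarRaw T u] (xx hT n u) := by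
  have h1 := adapted (good_S hT) (rho_stop hT n) hu
  have h2 : Measurable[FbarRaw T u] (fun p => SbarProc T hT 0 p) :=
    (adapted0 (good_S hT) (u := 0) ⟨le_rfl, hT⟩).mono (FbarRaw_mono hu.1) le_rfl
  exact msub h1 h2

lemma vv_meas (n : ℕ) {u : ℝ} (hu : u ∈ Set.Icc (0:ℝ) T) : Measurable[FbarRaw T u] (vv hT n u) := by
  have h1 := adapted (good_V hT) (rho_stop hT n) hu
  have h2 : Measurable[FbarRaw T u] (fun p => VbarProc T hT 0 p) :=
    (adapted0 (good_V hT) (u := 0) ⟨le_rfl, hT⟩).mono (FbarRaw_mono hu.1) le_rfl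
  exact msub h1 h2

lemma cc_meas (n m : ℕ) {u : ℝ} (hu : u ∈ Set.Icc (0:ℝ) T) :
    Measurable[FbarRaw T u] (cc hT n m u) := by
  have h1 : Measurable[Fraw T u] (lastS hT m u) :=
    gal_path (lastS_meas hT m hu.2) ⟨u, hu⟩ (fun ω => lastS_stop hT m ω ⟨u, hu⟩)
  exact mite (rho_stop hT n u hu)
    (@measurable_const _ _ _ (FbarRaw T u) 0) (gal_fst u h1)

lemma cc_mul (n m : ℕ) {u u' : ℝ} (h : u ≤ u') (p : PathPair T) :
    cc hT n m u p * (xx hT n u' p - xx hT n u p) = lastS hT m u p.1 *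
      (ev T hT p.1 (min (rho hT n p) u') - ev T hT p.1 (min (rho hT n p) u)) := by
  unfold cc xx
  split_ifs with h1
  · rw [min_eq_left h1, min_eq_left (h1.trans h)]; ring
  · ring

variable {Q : Measure (PathPair T)} [IsProbabilityMeasure Q]

lemma S0_int (hl : IsLocalMartBar T Q (SbarProc T hT)) : Integrable (fun p => ev T hT p.1 0) Q := by
  obtain ⟨τ, -, -, hM⟩ := hl
  have := (hM 0).1 0 ⟨le_rfl, hT⟩
  convert this using 1
  funext p
  exact (ev_neg hT p.1 (min_le_right _ _)).symm

lemma xx_int (n : ℕ) {u : ℝ} (hu : u ∈ Set.Icc (0:ℝ) T) : Integrable (fun p => xx hT n u p) Q :=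
  int_bdd ((xx_meas hT n hu).mono (FbarRaw_le u) le_rfl) (xx_bd hT n u)

lemma vv_int (n : ℕ) {u : ℝ} (hu : u ∈ Set.Icc (0:ℝ) T) : Integrable (fun p => vv hT n u p) Q :=
  int_bdd ((vv_meas hT n hu).mono (FbarRaw_le u) le_rfl) (vv_bd hT n u)

lemma xx_mart (hl : IsLocalMartBar T Q (SbarProc T hT)) (n : ℕ) {s t : ℝ} (hs : s ∈ Set.Icc (0:ℝ) T)
    (ht : t ∈ Set.Icc (0:ℝ) T) (hst : s ≤ t) (A : Set (PathPair T)) (hA : MeasurableSet[FbarRaw T s] A) :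
    ∫ p in A, (xx hT n t p - xx hT n s p) ∂Q = 0 := by
  have h0 := S0_int hT hl
  have := os (good_S hT) hl (rho_stop hT n) (Y := fun p => |ev T hT p.1 0| + 2 * (n + 1))
    (h0.abs.add (integrable_const _)) (ae_of_all _ fun p u => by
      have h1 := xx_bd hT n u p
      unfold xx at h1
      unfold SbarProc
      have h2 := abs_add_le (ev T hT p.1 0) (ev T hT p.1 (min (rho hT n p) u) - ev T hT p.1 0)
      rw [add_sub_cancel] at h2
      linarith)
  have h2 := this.2 s t hs ht hst A hA
  have e : ∀ p, xx hT n t p - xx hT n s p = SbarProc T hT (min (rho hT n p) t) p -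
    SbarProc T hT (min (rho hT n p) s) p := fun p => by unfold xx SbarProc; ring
  simp only [e]
  rw [integral_sub (this.1 t ht).integrableOn (this.1 s hs).integrableOn, h2, sub_self]

lemma lint_sq {f : PathPair T → ℝ} (hf : Measurable f) {C : ℝ} (hb : ∀ p, |f p| ≤ C) :
    ∫⁻ p, ‖f p‖ₑ ^ 2 ∂Q = ENNReal.ofReal (∫ p, f p ^ 2 ∂Q) := by
  rw [ofReal_integral_eq_lintegral_ofReal]
  · refine lintegral_congr fun p => ?_
    rw [← ofReal_norm, ← ENNReal.ofReal_pow (norm_nonneg _), Real.norm_eq_abs, sq_abs]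
  · refine int_bdd (hf.pow_const 2) (C := C ^ 2) fun p => ?_
    rw [abs_pow]; exact pow_le_pow_left₀ (abs_nonneg _) (hb p) 2
  · exact ae_of_all _ fun p => sq_nonneg _

/-- sum of squared increments -/
lemma sum_dx2 (hl : IsLocalMartBar T Q (SbarProc T hT)) (n : ℕ) {s h : ℝ} (hs : 0 ≤ s) (hh : 0 ≤ h)
    (J N : ℕ) (hT' : s + J * h ≤ T) :
    ∑ i ∈ Finset.range (J * 2 ^ N), ∫ p, (xx hT n (gr s h N (i+1)) p - xx hT n (gr s h N i) p) ^ 2 ∂Q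
      ≤ (4 * (n + 1)) ^ 2 := by
  have hm : ∀ i ≤ J * 2 ^ N, gr s h N i ∈ Set.Icc (0:ℝ) T := fun i hi => gr_mem hs hh hT' hi
  have hmono : Monotone (fun i => FbarRaw T (gr s h N i)) := fun i j hij =>
    FbarRaw_mono (gr_mono s hh N hij)
  have hb : ∀ u u' p, |xx hT n u p - xx hT n u' p| ≤ 4 * (n + 1) := fun u u' p => by
    have h1 := xx_bd hT n u p
    have h2 := xx_bd hT n u' p
    rw [abs_le] at *; constructor <;> linarith
  have hd : ∀ i < J * 2 ^ N, Measurable[FbarRaw T (gr s h N (i+1))]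
      (fun p => xx hT n (gr s h N (i+1)) p - xx hT n (gr s h N i) p) := fun i hi =>
    msub (xx_meas hT n (hm (i+1) hi))
      ((xx_meas hT n (hm i hi.le)).mono (hmono (Nat.le_succ i)) le_rfl)
  have := l2_sum (P := Q) (𝒢 := fun i => FbarRaw T (gr s h N i)) hmono (fun i => FbarRaw_le _)
    (d := fun i p => xx hT n (gr s h N (i+1)) p - xx hT n (gr s h N i) p) (J * 2 ^ N)
    (fun i _ p => hb _ _ p) hd (fun i hi A hA => xx_mart hT hl n (hm i hi.le) (hm (i+1) hi)
      (gr_mono s hh N (Nat.le_succ i)) A hA)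
  rw [← this]
  have e : ∀ p, ∑ i ∈ Finset.range (J * 2 ^ N), (xx hT n (gr s h N (i+1)) p - xx hT n (gr s h N i) p) =
      xx hT n (gr s h N (J * 2 ^ N)) p - xx hT n (gr s h N 0) p := fun p =>
    Finset.sum_range_sub (fun i => xx hT n (gr s h N i) p) _
  simp only [e]
  have h1 : ∀ p, (xx hT n (gr s h N (J * 2 ^ N)) p - xx hT n (gr s h N 0) p) ^ 2 ≤ (4 * (n + 1)) ^ 2 :=
    fun p => by rw [← sq_abs]; exact pow_le_pow_left₀ (abs_nonneg _) (hb _ _ p) 2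
  have h2 := integral_mono_of_nonneg (μ := Q) (ae_of_all _ fun p => sq_nonneg
    (xx hT n (gr s h N (J * 2 ^ N)) p - xx hT n (gr s h N 0) p)) (integrable_const ((4 * ((n:ℝ) + 1)) ^ 2))
    (ae_of_all _ h1)
  simpa using h2

lemma sm_L2 (hl : IsLocalMartBar T Q (SbarProc T hT)) (n m : ℕ) {s t : ℝ} (hs : s ∈ Set.Icc (0:ℝ) T)
    (ht : t ∈ Set.Icc (0:ℝ) T) (hst : s ≤ t) :
    AEStronglyMeasurable (fun p => Sm T hT m (min (rho hT n p) t) p.1 -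
        Sm T hT m (min (rho hT n p) s) p.1) Q ∧
    ∫⁻ p, ‖Sm T hT m (min (rho hT n p) t) p.1 - Sm T hT m (min (rho hT n p) s) p.1‖ₑ ^ 2 ∂Q ≤
      ENNReal.ofReal ((n+1) ^ 2 * (4 * (n + 1)) ^ 2) ∧
    ∀ A, MeasurableSet[FbarRaw T s] A →
      ∫ p in A, (Sm T hT m (min (rho hT n p) t) p.1 - Sm T hT m (min (rho hT n p) s) p.1) ∂Q = 0 := by
  set h := t - s with hh'
  have hh : 0 ≤ h := by linarith
  have hT' : s + (1:ℕ) * h ≤ T := by rw [hh']; push_cast; linarith [ht.2]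
  have hm : ∀ N, ∀ i ≤ 1 * 2 ^ N, gr s h N i ∈ Set.Icc (0:ℝ) T := fun N i hi => gr_mem hs.1 hh hT' hi
  have hmono : ∀ N, Monotone (fun i => FbarRaw T (gr s h N i)) := fun N i j hij =>
    FbarRaw_mono (gr_mono s hh N hij)
  let d : ℕ → ℕ → PathPair T → ℝ := fun N i p => cc hT n m (gr s h N i) p *
    (xx hT n (gr s h N (i+1)) p - xx hT n (gr s h N i) p)
  have hbx : ∀ u u' p, |xx hT n u p - xx hT n u' p| ≤ 4 * (n + 1) := fun u u' p => by
    have h1 := xx_bd hT n u p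
    have h2 := xx_bd hT n u' p
    rw [abs_le] at *; constructor <;> linarith
  have hb : ∀ N, ∀ i < 1 * 2 ^ N, ∀ p, |d N i p| ≤ (n+1) * (4 * (n + 1)) := fun N i hi p => by
    simp only [d]; rw [abs_mul]
    exact mul_le_mul (cc_bd hT n m (hm N i hi.le) p) (hbx _ _ p) (abs_nonneg _) (by positivity)
  have hdx : ∀ N, ∀ i < 1 * 2 ^ N, Measurable[FbarRaw T (gr s h N (i+1))]
      (fun p => xx hT n (gr s h N (i+1)) p - xx hT n (gr s h N i) p) := fun N i hi =>
    msub (xx_meas hT n (hm N (i+1) hi))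
      ((xx_meas hT n (hm N i hi.le)).mono (hmono N (Nat.le_succ i)) le_rfl)
  have hd : ∀ N, ∀ i < 1 * 2 ^ N, Measurable[FbarRaw T (gr s h N (i+1))] (d N i) := fun N i hi =>
    mmul
      ((cc_meas hT n m (hm N i hi.le)).mono (hmono N (Nat.le_succ i)) le_rfl) (hdx N i hi)
  have hdi : ∀ N, ∀ i < 1 * 2 ^ N, Measurable (d N i) := fun N i hi => (hd N i hi).mono (FbarRaw_le _) le_rfl
  have h0 : ∀ N, ∀ i < 1 * 2 ^ N, ∀ A, MeasurableSet[FbarRaw T (gr s h N i)] A →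
      ∫ p in A, d N i p ∂Q = 0 := fun N i hi =>
    zero_mul_set (FbarRaw_le _) (int_bdd ((hdx N i hi).mono (FbarRaw_le _) le_rfl) (hbx _ _))
      (fun A hA => xx_mart hT hl n (hm N i hi.le) (hm N (i+1) hi)
      (gr_mono s hh N (Nat.le_succ i)) A hA) (cc_meas hT n m (hm N i hi.le)) (cc_bd hT n m (hm N i hi.le))
  let f : ℕ → PathPair T → ℝ := fun N p => ∑ i ∈ Finset.range (1 * 2 ^ N), d N i p
  have hfm : ∀ N, Measurable (f N) := fun N =>
    Finset.measurable_fun_sum _ fun i hi => hdi N i (Finset.mem_range.1 hi)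
  have hL2 : ∀ N, ∫ p, f N p ^ 2 ∂Q ≤ (n+1) ^ 2 * (4 * (n + 1)) ^ 2 := by
    intro N
    simp only [f]
    rw [l2_sum (P := Q) (𝒢 := fun i => FbarRaw T (gr s h N i)) (hmono N) (fun i => FbarRaw_le _)
      (d := d N) (1 * 2 ^ N) (hb N) (hd N) (h0 N)]
    refine le_trans ?_ (mul_le_mul_of_nonneg_left (sum_dx2 hT hl n hs.1 hh 1 N hT')
      (by positivity : (0:ℝ) ≤ (n+1)^2))
    rw [Finset.mul_sum]
    refine Finset.sum_le_sum fun i hi => ?_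
    have hi' := Finset.mem_range.1 hi
    rw [← integral_const_mul]
    refine integral_mono_of_nonneg (ae_of_all _ fun p => sq_nonneg _) ?_ (ae_of_all _ fun p => ?_)
    · refine (int_bdd (((hdx N i hi').mono (FbarRaw_le _) le_rfl).pow_const 2) (C := (4 * (n+1))^2) fun p => ?_).const_mul _
      rw [abs_pow]; exact pow_le_pow_left₀ (abs_nonneg _) (hbx _ _ p) 2
    · simp only [d]; rw [mul_pow]
      refine mul_le_mul_of_nonneg_right ?_ (sq_nonneg _)
      rw [← sq_abs]; exact pow_le_pow_left₀ (abs_nonneg _) (cc_bd hT n m (hm N i hi'.le) p) 2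
  have hlim : ∀ p, Tendsto (fun N => f N p) atTop (𝓝 (Sm T hT m (min (rho hT n p) t) p.1 -
      Sm T hT m (min (rho hT n p) s) p.1)) := by
    intro p
    have := grid_lim hT m p.1 (rho hT n p) hh 1 hT'
    rw [show s + ((1:ℕ):ℝ) * h = t by rw [hh']; push_cast; ring] at this
    refine this.congr fun N => Finset.sum_congr rfl fun i _ => ?_
    exact (cc_mul hT n m (gr_mono s hh N (Nat.le_succ i)) p).symm
  have hc := l2_conv (P := Q) (f := f) (C := (n+1) ^ 2 * (4 * (n + 1)) ^ 2)
    (fun N => (hfm N).aestronglyMeasurable)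
    (fun N => by
      rw [lint_sq (hfm N) (C := ((1 * 2 ^ N : ℕ):ℝ) * ((n+1) * (4 * (n + 1)))) (sum_bdd (hb N))]
      exact ENNReal.ofReal_le_ofReal (hL2 N))
    (ae_of_all _ hlim)
  refine ⟨hc.1, hc.2.1, fun A hA => ?_⟩
  refine tendsto_nhds_unique (hc.2.2.2 A) (tendsto_const_nhds.congr fun N => ?_)
  simp only [f]
  rw [integral_finsetSum]
  · refine (Finset.sum_eq_zero fun i hi => h0 N i (Finset.mem_range.1 hi) A ?_).symm
    have := hmono N (Nat.zero_le i)
    simp only [gr_zero] at this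
    exact this A hA
  · intro i hi
    exact (int_bdd (hdi N i (Finset.mem_range.1 hi)) (hb N i (Finset.mem_range.1 hi))).integrableOn

lemma SS_bd (n : ℕ) (p : PathPair T) (h0 : ev T hT p.2 0 = 0) (u : ℝ) :
    |SSbarProc T hT (min (rho hT n p) u) p| ≤ (n + 1) ^ 2 + 2 * (n + 1) := by
  have h1 := sq_bd hT n u p
  have h2 := vv_bd hT n u p
  unfold vv at h2
  rw [h0, sub_zero] at h2
  unfold SSbarProc
  rw [abs_le] at *
  constructor <;> linarith

lemma dirA_SS (hl : IsLocalMartBar T Q (SbarProc T hT)) (hG : ∀ᵐ p ∂Q, p ∈ Gam hT)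
    (hV : ∀ᵐ p ∂Q, ev T hT p.2 0 = 0) : IsLocalMartBar T Q (SSbarProc T hT) := by
  refine ⟨rho hT, rho_stop hT, ae_of_all _ fun p => ⟨rho_mono hT p, rho_tendsto hT p⟩, fun n => ?_⟩
  have hint : ∀ t ∈ Set.Icc (0:ℝ) T, Integrable (fun p => SSbarProc T hT (min (rho hT n p) t) p) Q := by
    intro t ht
    refine (integrable_const (((n:ℝ) + 1) ^ 2 + 2 * (n + 1))).mono'
      ((adapted (good_SS hT) (rho_stop hT n) ht).mono (FbarRaw_le t) le_rfl).aestronglyMeasurable ?_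
    filter_upwards [hV] with p hp
    exact SS_bd hT n p hp t
  refine ⟨hint, fun s t hs ht hst A hA => ?_⟩
  have hlim : ∀ᵐ p ∂Q, Tendsto (fun m => Sm T hT m (min (rho hT n p) t) p.1 -
      Sm T hT m (min (rho hT n p) s) p.1) atTop (𝓝 (SSbarProc T hT (min (rho hT n p) t) p -
        SSbarProc T hT (min (rho hT n p) s) p)) := by
    filter_upwards [hG] with p hp
    have key : ∀ u ∈ Set.Icc (0:ℝ) T, Tendsto (fun m => Sm T hT m (min (rho hT n p) u) p.1) atTop
        (𝓝 (SSbarProc T hT (min (rho hT n p) u) p)) := fun u hu =>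
      ((tendsto_path_iff hT _ _).1 hp.2).tendsto_at ⟨min (rho hT n p) u, le_min (rho_nonneg hT n p) hu.1, (min_le_right _ _).trans hu.2⟩
    exact (key t ht).sub (key s hs)
  have hc := l2_conv (P := Q) (fun m => (sm_L2 hT hl n m hs ht hst).1)
    (fun m => (sm_L2 hT hl n m hs ht hst).2.1) hlim
  have h1 : ∫ p in A, (SSbarProc T hT (min (rho hT n p) t) p -
        SSbarProc T hT (min (rho hT n p) s) p) ∂Q = 0 := by
    refine tendsto_nhds_unique (hc.2.2.2 A) (tendsto_const_nhds.congr fun m => ?_)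
    exact ((sm_L2 hT hl n m hs ht hst).2.2 A hA).symm
  rw [integral_sub (hint t ht).integrableOn (hint s hs).integrableOn] at h1
  exact sub_eq_zero.1 h1

end P7
end PathwiseSuperhedging

namespace PathwiseSuperhedging
section P8
variable {T : ℝ} (hT : 0 ≤ T)

def amax {α : Type*} (f : ℕ → α → ℝ) : ℕ → α → ℝ
  | 0 => fun _ => 0
  | k + 1 => fun x => max (amax f k x) (f k x)

lemma amax_nonneg {α : Type*} (f : ℕ → α → ℝ) (k : ℕ) (x : α) : 0 ≤ amax f k x := by
  induction k with
  | zero => exact le_rfl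
  | succ k ih => exact ih.trans (le_max_left _ _)

lemma le_amax {α : Type*} (f : ℕ → α → ℝ) {k i : ℕ} (hi : i < k) (x : α) : f i x ≤ amax f k x := by
  induction k with
  | zero => omega
  | succ k ih =>
    rcases Nat.lt_succ_iff_lt_or_eq.1 hi with h | h
    · exact (ih h).trans (le_max_left _ _)
    · rw [h]; exact le_max_right _ _

lemma amax_le {α : Type*} (f : ℕ → α → ℝ) {C : ℝ} (hC : 0 ≤ C) {k : ℕ} {x : α}
    (h : ∀ i < k, f i x ≤ C) : amax f k x ≤ C := by
  induction k with
  | zero => exact hC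
  | succ k ih => exact max_le (ih fun i hi => h i (by omega)) (h k (by omega))

lemma amax_meas {α : Type*} [MeasurableSpace α] (f : ℕ → α → ℝ) {k : ℕ}
    (h : ∀ i < k, Measurable (f i)) : Measurable (amax f k) := by
  induction k with
  | zero => exact measurable_const
  | succ k ih => exact (ih fun i hi => h i (by omega)).max (h k (by omega))

lemma ev_unif (ω : Path T) : UniformContinuous (ev T hT ω) :=
  (CompactSpace.uniformContinuous_of_continuous ω.continuous).comp
    (LipschitzWith.projIcc hT).uniformContinuous

/-- increments -/
def qq (n : ℕ) (u u' : ℝ) (p : PathPair T) : ℝ :=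
  (xx hT n u' p - xx hT n u p) ^ 2 - (vv hT n u' p - vv hT n u p)

def aa (n : ℕ) (h : ℝ) (J N : ℕ) : PathPair T → ℝ :=
  amax (fun i p => (xx hT n (gr 0 h N (i+1)) p - xx hT n (gr 0 h N i) p) ^ 2 +
    |vv hT n (gr 0 h N (i+1)) p - vv hT n (gr 0 h N i) p|) (J * 2 ^ N)

def A0 (n : ℕ) : ℝ := (4 * (n + 1)) ^ 2 + 4 * (n + 1)

lemma A0_nonneg (n : ℕ) : 0 ≤ A0 n := by unfold A0; positivity

lemma xx_db (n : ℕ) (u u' : ℝ) (p : PathPair T) : |xx hT n u p - xx hT n u' p| ≤ 4 * (n + 1) := by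
  have h1 := xx_bd hT n u p
  have h2 := xx_bd hT n u' p
  rw [abs_le] at *; constructor <;> linarith

lemma vv_db (n : ℕ) (u u' : ℝ) (p : PathPair T) : |vv hT n u p - vv hT n u' p| ≤ 4 * (n + 1) := by
  have h1 := vv_bd hT n u p
  have h2 := vv_bd hT n u' p
  rw [abs_le] at *; constructor <;> linarith

lemma aa_le (n : ℕ) (h : ℝ) (J N : ℕ) (p : PathPair T) : aa hT n h J N p ≤ A0 n := by
  refine amax_le _ (A0_nonneg n) fun i _ => ?_
  refine add_le_add ?_ (vv_db hT n _ _ p)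
  rw [← sq_abs]; exact pow_le_pow_left₀ (abs_nonneg _) (xx_db hT n _ _ p) 2

lemma aa_meas (n : ℕ) {h : ℝ} (hh : 0 ≤ h) {J : ℕ} (N : ℕ) (hT' : 0 + J * h ≤ T) :
    Measurable (aa hT n h J N) := by
  refine amax_meas _ fun i hi => ?_
  have m1 : gr 0 h N i ∈ Set.Icc (0:ℝ) T := gr_mem le_rfl hh hT' hi.le
  have m2 : gr 0 h N (i+1) ∈ Set.Icc (0:ℝ) T := gr_mem le_rfl hh hT' hi
  have x1 := (xx_meas hT n m1).mono (FbarRaw_le _) le_rfl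
  have x2 := (xx_meas hT n m2).mono (FbarRaw_le _) le_rfl
  have v1 := (vv_meas hT n m1).mono (FbarRaw_le _) le_rfl
  have v2 := (vv_meas hT n m2).mono (FbarRaw_le _) le_rfl
  exact ((x2.sub x1).pow_const 2).add (v2.sub v1).abs

lemma aa_nonneg (n : ℕ) (h : ℝ) (J N : ℕ) (p : PathPair T) : 0 ≤ aa hT n h J N p := amax_nonneg _ _ _

lemma aa_ge (n : ℕ) (h : ℝ) (J N : ℕ) (p : PathPair T) {i : ℕ} (hi : i < J * 2 ^ N) :
    (xx hT n (gr 0 h N (i+1)) p - xx hT n (gr 0 h N i) p) ^ 2 +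
    |vv hT n (gr 0 h N (i+1)) p - vv hT n (gr 0 h N i) p| ≤ aa hT n h J N p :=
  le_amax (fun i p => (xx hT n (gr 0 h N (i+1)) p - xx hT n (gr 0 h N i) p) ^ 2 +
    |vv hT n (gr 0 h N (i+1)) p - vv hT n (gr 0 h N i) p|) hi p

lemma half_lim (h : ℝ) : Tendsto (fun N : ℕ => h / 2 ^ N) atTop (𝓝 0) := by
  have := (tendsto_pow_atTop_nhds_zero_of_lt_one (r := (1/2:ℝ)) (by norm_num) (by norm_num)).const_mul h
  simp only [mul_zero] at this
  refine this.congr fun N => ?_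
  rw [one_div, inv_pow]; rfl

lemma aa_lim (n : ℕ) {h : ℝ} (hh : 0 ≤ h) (J : ℕ) (p : PathPair T) :
    Tendsto (fun N => aa hT n h J N p) atTop (𝓝 0) := by
  rw [Metric.tendsto_atTop]
  intro e he
  set c := min 1 (e / 4) with hc
  have hc0 : 0 < c := lt_min one_pos (by linarith)
  obtain ⟨δ1, hδ1, h1⟩ := Metric.uniformContinuous_iff.1 (ev_unif hT p.1) c hc0
  obtain ⟨δ2, hδ2, h2⟩ := Metric.uniformContinuous_iff.1 (ev_unif hT p.2) c hc0
  obtain ⟨N0, hN0⟩ := eventually_atTop.1 ((half_lim h).eventually (gt_mem_nhds (lt_min hδ1 hδ2)))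
  refine ⟨N0, fun N hN => ?_⟩
  have hst : ∀ i, dist (min (rho hT n p) (gr 0 h N (i+1))) (min (rho hT n p) (gr 0 h N i)) < min δ1 δ2 := by
    intro i
    refine lt_of_le_of_lt ?_ (hN0 N hN)
    rw [Real.dist_eq]
    refine (abs_min_sub_min_le_max _ _ _ _).trans ?_
    rw [sub_self, abs_zero, max_eq_right (abs_nonneg _)]
    unfold gr; push_cast
    rw [show (0 + ((i:ℝ) + 1) * (h / 2 ^ N) - (0 + i * (h / 2 ^ N))) = h / 2 ^ N by ring]
    exact (abs_of_nonneg (by positivity)).le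
  rw [Real.dist_eq, sub_zero, abs_of_nonneg (aa_nonneg hT n h J N p)]
  refine lt_of_le_of_lt (amax_le _ (C := e / 2) (by linarith) fun i _ => ?_) (by linarith)
  have k1 := h1 ((hst i).trans_le (min_le_left _ _))
  have k2 := h2 ((hst i).trans_le (min_le_right _ _))
  rw [Real.dist_eq] at k1 k2
  have e1 : xx hT n (gr 0 h N (i+1)) p - xx hT n (gr 0 h N i) p =
    ev T hT p.1 (min (rho hT n p) (gr 0 h N (i+1))) - ev T hT p.1 (min (rho hT n p) (gr 0 h N i)) := by
    unfold xx; ring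
  have e2 : vv hT n (gr 0 h N (i+1)) p - vv hT n (gr 0 h N i) p =
    ev T hT p.2 (min (rho hT n p) (gr 0 h N (i+1))) - ev T hT p.2 (min (rho hT n p) (gr 0 h N i)) := by
    unfold vv; ring
  rw [e1, e2, ← sq_abs]
  have hc1 : c ≤ 1 := min_le_left _ _
  have hc2 : c ≤ e / 4 := min_le_right _ _
  have := abs_nonneg (ev T hT p.1 (min (rho hT n p) (gr 0 h N (i+1))) - ev T hT p.1 (min (rho hT n p) (gr 0 h N i)))
  nlinarith

def yy (n : ℕ) (u : ℝ) (p : PathPair T) : ℝ :=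
  (ev T hT p.1 (min (rho hT n p) u) ^ 2 - ev T hT p.1 0 ^ 2 - vv hT n u p) / 2

lemma yy_eq (n : ℕ) (u : ℝ) (p : PathPair T) :
    yy hT n u p = SSbarProc T hT (min (rho hT n p) u) p + ev T hT p.2 0 / 2 := by
  unfold yy SSbarProc vv; ring

lemma yy_bd (n : ℕ) (u : ℝ) (p : PathPair T) : |yy hT n u p| ≤ (n + 1) ^ 2 + 2 * (n + 1) := by
  have h1 := sq_bd hT n u p
  have h2 := vv_bd hT n u p
  unfold yy
  rw [abs_le] at *
  constructor <;> linarith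

lemma yy_meas (n : ℕ) {u : ℝ} (hu : u ∈ Set.Icc (0:ℝ) T) : Measurable[FbarRaw T u] (yy hT n u) := by
  have h1 := adapted (good_SS hT) (rho_stop hT n) hu
  have h2 : Measurable[FbarRaw T u] (fun p => VbarProc T hT 0 p) :=
    (adapted0 (good_V hT) (u := 0) ⟨le_rfl, hT⟩).mono (FbarRaw_mono hu.1) le_rfl
  have h3 : Measurable[FbarRaw T u] (fun p => VbarProc T hT 0 p * (-1/2)) :=
    mmul h2 (@measurable_const _ _ _ (FbarRaw T u) _)
  have h4 := msub h1 h3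
  convert h4 using 1
  funext p; rw [yy_eq]; unfold VbarProc; ring

def ss (n : ℕ) (u : ℝ) (p : PathPair T) : ℝ := if rho hT n p ≤ u then 0 else ev T hT p.1 u

lemma ss_bd (n : ℕ) {u : ℝ} (hu : u ∈ Set.Icc (0:ℝ) T) (p : PathPair T) :
    |ss hT n u p| ≤ n + 1 := by
  unfold ss
  split_ifs with h
  · rw [abs_zero]; positivity
  · exact S_bd hT n hu.1 p (not_le.1 h) le_rfl

lemma ss_meas (n : ℕ) {u : ℝ} (hu : u ∈ Set.Icc (0:ℝ) T) : Measurable[FbarRaw T u] (ss hT n u) :=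
  mite (rho_stop hT n u hu) (@measurable_const _ _ _ (FbarRaw T u) 0) (adapted0 (good_S hT) hu)

lemma ss_cc (n m : ℕ) {u : ℝ} (hu : u ∈ Set.Icc (0:ℝ) T) (p : PathPair T) :
    |ss hT n u p - cc hT n m u p| ≤ eps m := by
  unfold ss cc
  split_ifs with h
  · rw [sub_zero, abs_zero]; exact (eps_pos m).le
  · exact lastS_close hT m p.1 hu.1 hu.2

lemma qq_eq (n : ℕ) {u u' : ℝ} (h : u ≤ u') (p : PathPair T) :
    qq hT n u u' p = 2 * (yy hT n u' p - yy hT n u p) - 2 * (ss hT n u p * (xx hT n u' p - xx hT n u p)) := by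
  unfold qq yy ss
  split_ifs with h1
  · unfold xx; rw [min_eq_left h1, min_eq_left (h1.trans h)]; ring
  · unfold xx; rw [min_eq_right (not_le.1 h1).le]; ring

variable {Q : Measure (PathPair T)} [IsProbabilityMeasure Q]

lemma yy_mart (hl : IsLocalMartBar T Q (SSbarProc T hT)) (hV : ∀ᵐ p ∂Q, ev T hT p.2 0 = 0)
    (n : ℕ) {s t : ℝ} (hs : s ∈ Set.Icc (0:ℝ) T)
    (ht : t ∈ Set.Icc (0:ℝ) T) (hst : s ≤ t) (A : Set (PathPair T)) (hA : MeasurableSet[FbarRaw T s] A) :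
    ∫ p in A, (yy hT n t p - yy hT n s p) ∂Q = 0 := by
  have := os (good_SS hT) hl (rho_stop hT n) (Y := fun p => (n + 1) ^ 2 + 2 * (n + 1))
    (integrable_const _) (by filter_upwards [hV] with p hp u using SS_bd hT n p hp u)
  have h2 := this.2 s t hs ht hst A hA
  have e : ∀ p, yy hT n t p - yy hT n s p = SSbarProc T hT (min (rho hT n p) t) p -
    SSbarProc T hT (min (rho hT n p) s) p := fun p => by rw [yy_eq, yy_eq]; ring
  simp only [e]
  rw [integral_sub (this.1 t ht).integrableOn (this.1 s hs).integrableOn, h2, sub_self]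

lemma cx_mart (hl : IsLocalMartBar T Q (SbarProc T hT)) (n : ℕ) {c : PathPair T → ℝ}
    {s t : ℝ} (hs : s ∈ Set.Icc (0:ℝ) T)
    (ht : t ∈ Set.Icc (0:ℝ) T) (hst : s ≤ t) (hc : Measurable[FbarRaw T s] c) {C : ℝ} (hb : ∀ p, |c p| ≤ C)
    (A : Set (PathPair T)) (hA : MeasurableSet[FbarRaw T s] A) :
    ∫ p in A, c p * (xx hT n t p - xx hT n s p) ∂Q = 0 :=
  zero_mul_set (FbarRaw_le _) ((xx_int hT n ht).sub (xx_int hT n hs))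
    (fun A hA => xx_mart hT hl n hs ht hst A hA) hc hb A hA

lemma yy_int (n : ℕ) {u : ℝ} (hu : u ∈ Set.Icc (0:ℝ) T) : Integrable (fun p => yy hT n u p) Q :=
  int_bdd ((yy_meas hT n hu).mono (FbarRaw_le u) le_rfl) (yy_bd hT n u)

lemma cx_int (n : ℕ) {c : PathPair T → ℝ}
    {s t : ℝ} (hs : s ∈ Set.Icc (0:ℝ) T)
    (ht : t ∈ Set.Icc (0:ℝ) T) (hc : Measurable[FbarRaw T s] c) {C : ℝ} (hb : ∀ p, |c p| ≤ C) :
    Integrable (fun p => c p * (xx hT n t p - xx hT n s p)) Q := by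
  refine int_bdd (C := C * (4 * (n+1))) (mmul (hc.mono (FbarRaw_le s) le_rfl) 
    (msub ((xx_meas hT n ht).mono (FbarRaw_le t) le_rfl) ((xx_meas hT n hs).mono (FbarRaw_le s) le_rfl))) fun p => ?_
  rw [abs_mul]
  exact mul_le_mul (hb p) (xx_db hT n _ _ p) (abs_nonneg _) ((abs_nonneg _).trans (hb p))

lemma qq_mart (hl : IsLocalMartBar T Q (SbarProc T hT)) (hl2 : IsLocalMartBar T Q (SSbarProc T hT))
    (hV : ∀ᵐ p ∂Q, ev T hT p.2 0 = 0) (n : ℕ) {s t : ℝ} (hs : s ∈ Set.Icc (0:ℝ) T)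
    (ht : t ∈ Set.Icc (0:ℝ) T) (hst : s ≤ t) (A : Set (PathPair T)) (hA : MeasurableSet[FbarRaw T s] A) :
    ∫ p in A, qq hT n s t p ∂Q = 0 := by
  simp only [qq_eq hT n hst]
  have i1 : Integrable (fun p => yy hT n t p - yy hT n s p) Q := (yy_int hT n ht).sub (yy_int hT n hs)
  have i2 := cx_int hT (Q := Q) n hs ht (ss_meas hT n hs) (ss_bd hT n hs)
  rw [integral_sub (i1.const_mul 2).integrableOn (i2.const_mul 2).integrableOn,
    integral_const_mul, integral_const_mul, yy_mart hT hl2 hV n hs ht hst A hA,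
    cx_mart hT hl n hs ht hst (ss_meas hT n hs) (ss_bd hT n hs) A hA]
  ring

lemma vv_mono (n : ℕ) (p : PathPair T) (hp : Monotone p.2) : Monotone (fun u => vv hT n u p) := by
  intro u u' h
  unfold vv ev
  have := hp (monotone_projIcc hT (min_le_min_left (rho hT n p) h))
  simpa [clamp] using this

lemma qq_lim (hl : IsLocalMartBar T Q (SbarProc T hT)) (hl2 : IsLocalMartBar T Q (SSbarProc T hT))
    (hV : ∀ᵐ p ∂Q, ev T hT p.2 0 = 0) (hVm : ∀ᵐ p ∂Q, Monotone p.2) (n : ℕ) {h : ℝ} (hh : 0 ≤ h)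
    (J : ℕ) (hT' : 0 + J * h ≤ T) :
    Tendsto (fun N => ∑ i ∈ Finset.range (J * 2 ^ N), ∫ p, (qq hT n (gr 0 h N i) (gr 0 h N (i+1)) p) ^ 2 ∂Q)
      atTop (𝓝 0) := by
  have hm : ∀ N, ∀ i ≤ J * 2 ^ N, gr 0 h N i ∈ Set.Icc (0:ℝ) T := fun N i hi => gr_mem le_rfl hh hT' hi
  have hmono : ∀ N, Monotone (fun i => FbarRaw T (gr 0 h N i)) := fun N i j hij =>
    FbarRaw_mono (gr_mono 0 hh N hij)
  have key : ∀ N (δ : ℝ), 0 < δ →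
      ∑ i ∈ Finset.range (J * 2 ^ N), ∫ p, (qq hT n (gr 0 h N i) (gr 0 h N (i+1)) p) ^ 2 ∂Q ≤
      (∫ p, (aa hT n h J N p) ^ 2 ∂Q) / δ + δ * (32 * (2 * ((n:ℝ) + 1)) ^ 2 + 16 * A0 n * (2 * (n + 1))) := by
    intro N δ hδ
    refine fourth (P := Q) (𝒢 := fun i => FbarRaw T (gr 0 h N i)) (hmono N) (fun i => FbarRaw_le _)
      (x := fun i => xx hT n (gr 0 h N i)) (v := fun i => vv hT n (gr 0 h N i)) (J * 2 ^ N)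
      (fun i hi => xx_meas hT n (hm N i hi)) (fun i hi => vv_meas hT n (hm N i hi))
      (fun i p => xx_bd hT n _ p) (fun i p => vv_bd hT n _ p) (aa_meas hT n hh N hT')
      (fun p => amax_nonneg _ _ _) (aa_le hT n h J N) ?_ ?_ ?_ ?_ hδ
    · intro i hi p
      exact le_trans (le_add_of_nonneg_right (abs_nonneg _)) (aa_ge hT n h J N p hi)
    · intro i hi p
      exact le_trans (le_add_of_nonneg_left (sq_nonneg _)) (aa_ge hT n h J N p hi)
    · filter_upwards [hVm] with p hp i _
      exact vv_mono hT n p hp (gr_mono 0 hh N (Nat.le_succ i))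
    · intro i hi A hA
      exact qq_mart hT hl hl2 hV n (hm N i hi.le) (hm N (i+1) hi) (gr_mono 0 hh N (Nat.le_succ i)) A hA
  have hI : Tendsto (fun N => ∫ p, (aa hT n h J N p) ^ 2 ∂Q) atTop (𝓝 0) := by
    have := tendsto_integral_of_dominated_convergence (μ := Q) (F := fun N p => (aa hT n h J N p) ^ 2)
      (f := fun _ => 0) (fun _ => A0 n ^ 2)
      (fun N => ((aa_meas hT n hh N hT').pow_const 2).aestronglyMeasurable) (integrable_const _)
      (fun N => ae_of_all _ fun p => ?_) (ae_of_all _ fun p => ?_)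
    · simpa using this
    · rw [Real.norm_eq_abs, abs_of_nonneg (sq_nonneg _)]
      exact pow_le_pow_left₀ (amax_nonneg _ _ _) (aa_le hT n h J N p) 2
    · have := (aa_lim hT n hh J p).pow 2
      simpa using this
  set K := 32 * (2 * ((n:ℝ) + 1)) ^ 2 + 16 * A0 n * (2 * (n + 1)) with hK
  have hK0 : 0 < K := by have := A0_nonneg n; positivity
  rw [Metric.tendsto_atTop]
  intro e he
  have hδ : 0 < e / (4 * K) := by positivity
  obtain ⟨N0, hN0⟩ := eventually_atTop.1 (hI.eventually (gt_mem_nhds (show 0 < e / 4 * (e / (4 * K)) by positivity)))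
  refine ⟨N0, fun N hN => ?_⟩
  rw [Real.dist_eq, sub_zero, abs_of_nonneg (Finset.sum_nonneg fun i _ => integral_nonneg fun p => sq_nonneg _)]
  refine lt_of_le_of_lt (key N _ hδ) ?_
  have h1 := (div_lt_iff₀ hδ).2 (hN0 N hN)
  have h2 : e / (4 * K) * K = e / 4 := by field_simp
  linarith

end P8
end PathwiseSuperhedging

namespace PathwiseSuperhedging
section P9
variable {T : ℝ} (hT : 0 ≤ T)

lemma liminf_meas {α : Type*} [MeasurableSpace α] {μ : Measure α} {E : Set α} {F : ℕ → Set α}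
    {b : ℕ → ℝ≥0∞} {b0 : ℝ≥0∞} (hE : ∀ p ∈ E, ∀ᶠ k in atTop, p ∈ F k) (hF : ∀ k, μ (F k) ≤ b k)
    (hb : Tendsto b atTop (𝓝 b0)) : μ E ≤ b0 := by
  let G : ℕ → Set α := fun M => ⋂ k ≥ M, F k
  have hG : Monotone G := by
    intro M M' h x hx
    simp only [G, mem_iInter] at hx ⊢
    exact fun k hk => hx k (h.trans hk)
  have hsub : E ⊆ ⋃ M, G M := by
    intro p hp
    obtain ⟨M, hM⟩ := eventually_atTop.1 (hE p hp)
    exact mem_iUnion.2 ⟨M, mem_iInter₂.2 hM⟩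
  refine (measure_mono hsub).trans ?_
  rw [hG.measure_iUnion]
  refine iSup_le fun M => ?_
  refine ge_of_tendsto hb (eventually_atTop.2 ⟨M, fun k hk => ?_⟩)
  exact (measure_mono (fun x hx => mem_iInter₂.1 hx k hk)).trans (hF k)

variable {Q : Measure (PathPair T)} [IsProbabilityMeasure Q]

def K1 (n : ℕ) : ℝ := 2 * (4 * (n + 1)) ^ 2

lemma dev (hl : IsLocalMartBar T Q (SbarProc T hT)) (hl2 : IsLocalMartBar T Q (SSbarProc T hT))
    (hV : ∀ᵐ p ∂Q, ev T hT p.2 0 = 0) (hVm : ∀ᵐ p ∂Q, Monotone p.2) (n m : ℕ) {h : ℝ} (hh : 0 ≤ h)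
    (J : ℕ) (hT' : 0 + J * h ≤ T) {l : ℝ} (hlp : 0 < l) :
    Q {p | ∃ j ≤ J, l < |yy hT n (j * h) p - Sm T hT m (min (rho hT n p) (j * h)) p.1|} ≤
      ENNReal.ofReal (eps m ^ 2 * K1 n / l ^ 2) := by
  have hm : ∀ N, ∀ i ≤ J * 2 ^ N, gr 0 h N i ∈ Set.Icc (0:ℝ) T := fun N i hi => gr_mem le_rfl hh hT' hi
  have hmono : ∀ N, Monotone (fun i => FbarRaw T (gr 0 h N i)) := fun N i j hij =>
    FbarRaw_mono (gr_mono 0 hh N hij)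
  let d : ℕ → ℕ → PathPair T → ℝ := fun N i p => (yy hT n (gr 0 h N (i+1)) p - yy hT n (gr 0 h N i) p) -
    cc hT n m (gr 0 h N i) p * (xx hT n (gr 0 h N (i+1)) p - xx hT n (gr 0 h N i) p)
  have hstep : ∀ N i, gr 0 h N i ≤ gr 0 h N (i+1) := fun N i => gr_mono 0 hh N (Nat.le_succ i)
  have hcx : ∀ N, ∀ i < J * 2 ^ N, ∀ p, |cc hT n m (gr 0 h N i) p *
      (xx hT n (gr 0 h N (i+1)) p - xx hT n (gr 0 h N i) p)| ≤ (n+1) * (4 * (n+1)) := fun N i hi p => by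
    rw [abs_mul]
    exact mul_le_mul (cc_bd hT n m (hm N i hi.le) p) (xx_db hT n _ _ p) (abs_nonneg _) (by positivity)
  have hb : ∀ N, ∀ i < J * 2 ^ N, ∀ p, |d N i p| ≤
      2 * (((n:ℝ) + 1) ^ 2 + 2 * (n + 1)) + (n+1) * (4 * (n+1)) := fun N i hi p => by
    have h1 := yy_bd hT n (gr 0 h N (i+1)) p
    have h2 := yy_bd hT n (gr 0 h N i) p
    have h3 := hcx N i hi p
    simp only [d]
    rw [abs_le] at *
    constructor <;> linarith
  have hd : ∀ N, ∀ i < J * 2 ^ N, Measurable[FbarRaw T (gr 0 h N (i+1))] (d N i) := fun N i hi =>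
    msub (msub (yy_meas hT n (hm N (i+1) hi)) ((yy_meas hT n (hm N i hi.le)).mono (hmono N (Nat.le_succ i)) le_rfl))
     (mmul ((cc_meas hT n m (hm N i hi.le)).mono (hmono N (Nat.le_succ i)) le_rfl)
      (msub (xx_meas hT n (hm N (i+1) hi)) ((xx_meas hT n (hm N i hi.le)).mono (hmono N (Nat.le_succ i)) le_rfl)))
  have h0 : ∀ N, ∀ i < J * 2 ^ N, ∀ A, MeasurableSet[FbarRaw T (gr 0 h N i)] A →
      ∫ p in A, d N i p ∂Q = 0 := by
    intro N i hi A hA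
    simp only [d]
    have i1 : Integrable (fun p => yy hT n (gr 0 h N (i+1)) p - yy hT n (gr 0 h N i) p) Q :=
      (yy_int hT n (hm N (i+1) hi)).sub (yy_int hT n (hm N i hi.le))
    have i2 := cx_int hT (Q := Q) n (hm N i hi.le) (hm N (i+1) hi) (cc_meas hT n m (hm N i hi.le))
      (cc_bd hT n m (hm N i hi.le))
    rw [integral_sub i1.integrableOn i2.integrableOn,
      yy_mart hT hl2 hV n (hm N i hi.le) (hm N (i+1) hi) (hstep N i) A hA,
      cx_mart hT hl n (hm N i hi.le) (hm N (i+1) hi) (hstep N i) (cc_meas hT n m (hm N i hi.le))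
      (cc_bd hT n m (hm N i hi.le)) A hA, sub_self]
  -- second moment bound
  have hq := qq_lim hT hl hl2 hV hVm n hh J hT'
  set q : ℕ → ℝ := fun N => ∑ i ∈ Finset.range (J * 2 ^ N),
    ∫ p, (qq hT n (gr 0 h N i) (gr 0 h N (i+1)) p) ^ 2 ∂Q with hqdef
  have hL2 : ∀ N, ∑ i ∈ Finset.range (J * 2 ^ N), ∫ p, d N i p ^ 2 ∂Q ≤ q N + eps m ^ 2 * K1 n := by
    intro N
    have hx2 := sum_dx2 hT hl n le_rfl hh J N hT'
    have h1 : ∑ i ∈ Finset.range (J * 2 ^ N), ∫ p, d N i p ^ 2 ∂Q ≤ q N + 2 * eps m ^ 2 *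
        ∑ i ∈ Finset.range (J * 2 ^ N), ∫ p, (xx hT n (gr 0 h N (i+1)) p - xx hT n (gr 0 h N i) p) ^ 2 ∂Q := by
      rw [hqdef, Finset.mul_sum, ← Finset.sum_add_distrib]
      refine Finset.sum_le_sum fun i hi => ?_
      have hi' := Finset.mem_range.1 hi
      have mx : Measurable (fun p => xx hT n (gr 0 h N (i+1)) p - xx hT n (gr 0 h N i) p) :=
        msub ((xx_meas hT n (hm N (i+1) hi')).mono (FbarRaw_le _) le_rfl)
          ((xx_meas hT n (hm N i hi'.le)).mono (FbarRaw_le _) le_rfl)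
      have mv : Measurable (fun p => vv hT n (gr 0 h N (i+1)) p - vv hT n (gr 0 h N i) p) :=
        msub ((vv_meas hT n (hm N (i+1) hi')).mono (FbarRaw_le _) le_rfl)
          ((vv_meas hT n (hm N i hi'.le)).mono (FbarRaw_le _) le_rfl)
      have mq : Measurable (qq hT n (gr 0 h N i) (gr 0 h N (i+1))) := (mx.pow_const 2).sub mv
      have bq : ∀ p, |qq hT n (gr 0 h N i) (gr 0 h N (i+1)) p| ≤ A0 n := fun p => by
        unfold qq A0
        refine (abs_sub _ _).trans (add_le_add ?_ (vv_db hT n _ _ p))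
        rw [abs_pow]; exact pow_le_pow_left₀ (abs_nonneg _) (xx_db hT n _ _ p) 2
      have iq : Integrable (fun p => qq hT n (gr 0 h N i) (gr 0 h N (i+1)) p ^ 2) Q :=
        int_bdd (mq.pow_const 2) (C := A0 n ^ 2) fun p => by
          rw [abs_pow]; exact pow_le_pow_left₀ (abs_nonneg _) (bq p) 2
      have ix : Integrable (fun p => (xx hT n (gr 0 h N (i+1)) p - xx hT n (gr 0 h N i) p) ^ 2) Q :=
        int_bdd (mx.pow_const 2) (C := (4 * (n+1)) ^ 2) fun p => by
          rw [abs_pow]; exact pow_le_pow_left₀ (abs_nonneg _) (xx_db hT n _ _ p) 2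
      rw [← integral_const_mul, ← integral_add iq (ix.const_mul _)]
      refine integral_mono_of_nonneg (ae_of_all _ fun p => sq_nonneg _) (iq.add (ix.const_mul _))
        (ae_of_all _ fun p => ?_)
      have e1 := qq_eq hT n (hstep N i) p
      have e2 := ss_cc hT n m (hm N i hi'.le) p
      set Δx := xx hT n (gr 0 h N (i+1)) p - xx hT n (gr 0 h N i) p with hΔ
      set qv' := qq hT n (gr 0 h N i) (gr 0 h N (i+1)) p with hqv'
      have e3 : d N i p = qv' / 2 + (ss hT n (gr 0 h N i) p - cc hT n m (gr 0 h N i) p) * Δx := by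
        simp only [d]; rw [e1]; ring
      set H := ss hT n (gr 0 h N i) p - cc hT n m (gr 0 h N i) p
      have e4 : H ^ 2 ≤ eps m ^ 2 := by
        rw [← sq_abs]; exact pow_le_pow_left₀ (abs_nonneg _) e2 2
      have e5 : (H * Δx) ^ 2 ≤ eps m ^ 2 * Δx ^ 2 := by
        rw [mul_pow]; exact mul_le_mul_of_nonneg_right e4 (sq_nonneg _)
      change d N i p ^ 2 ≤ qv' ^ 2 + 2 * eps m ^ 2 * Δx ^ 2
      rw [e3]
      nlinarith [sq_nonneg (qv' / 2 - H * Δx), sq_nonneg qv']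
    refine h1.trans (add_le_add le_rfl ?_)
    unfold K1
    have : 0 ≤ 2 * eps m ^ 2 := by positivity
    nlinarith
  refine liminf_meas (F := fun N => {p | ∃ i ≤ J * 2 ^ N, l < |∑ k ∈ Finset.range i, d N k p|})
    (b := fun N => ENNReal.ofReal ((q N + eps m ^ 2 * K1 n) / l ^ 2)) ?_ ?_ ?_
  · rintro p ⟨j, hj, hp⟩
    have hjT : 0 + (j:ℝ) * h ≤ T := by
      have : (j:ℝ) ≤ J := by exact_mod_cast hj
      nlinarith
    have hlim : Tendsto (fun N => ∑ k ∈ Finset.range (j * 2 ^ N), d N k p) atTop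
        (𝓝 (yy hT n (j * h) p - Sm T hT m (min (rho hT n p) (j * h)) p.1)) := by
      have g := grid_lim hT m p.1 (rho hT n p) hh j hjT
      rw [zero_add, min_eq_right (rho_nonneg hT n p), Sm_zero, sub_zero] at g
      refine (tendsto_const_nhds.sub g).congr fun N => ?_
      simp only [d]
      rw [Finset.sum_sub_distrib, Finset.sum_range_sub (fun i => yy hT n (gr 0 h N i) p), gr_last, gr_zero,
        zero_add]
      have y0 : yy hT n 0 p = 0 := by
        unfold yy vv; rw [min_eq_right (rho_nonneg hT n p)]; ring
      rw [y0, sub_zero]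
      congr 1
      refine Finset.sum_congr rfl fun i _ => ?_
      exact (cc_mul hT n m (hstep N i) p).symm
    filter_upwards [hlim.abs.eventually (lt_mem_nhds hp)] with N hN
    exact ⟨j * 2 ^ N, Nat.mul_le_mul_right _ hj, hN⟩
  · intro N
    refine (kolm (P := Q) (𝒢 := fun i => FbarRaw T (gr 0 h N i)) (hmono N) (fun i => FbarRaw_le _)
      (d := d N) (J * 2 ^ N) (hb N) (hd N) (h0 N) hlp).trans ?_
    refine ENNReal.ofReal_le_ofReal ?_
    exact div_le_div_of_nonneg_right (hL2 N) (by positivity)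
  · refine ENNReal.tendsto_ofReal ?_
    have := (hq.add_const (eps m ^ 2 * K1 n)).div_const (l ^ 2)
    rwa [zero_add] at this

lemma dyad (hT : 0 ≤ T) {t : ℝ} (ht : t ∈ Set.Icc (0:ℝ) T) : ∃ j : ℕ → ℕ, (∀ k, j k ≤ 2 ^ k) ∧
    Tendsto (fun k => (j k : ℝ) * (T / 2 ^ k)) atTop (𝓝 t) := by
  rcases hT.eq_or_lt with h | h
  · refine ⟨fun _ => 0, fun k => Nat.zero_le _, ?_⟩
    have : t = 0 := le_antisymm (ht.2.trans h.symm.le) ht.1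
    simp [this]
  refine ⟨fun k => ⌊t / (T / 2 ^ k)⌋₊, fun k => ?_, ?_⟩
  · have hp : 0 < T / 2 ^ k := by positivity
    refine Nat.floor_le_of_le ?_
    rw [div_le_iff₀ hp]; push_cast
    rw [mul_div_cancel₀ _ (by positivity)]
    exact ht.2
  · rw [tendsto_iff_dist_tendsto_zero]
    refine squeeze_zero (fun _ => dist_nonneg) (fun k => ?_) (half_lim T)
    have hp : 0 < T / 2 ^ k := by positivity
    have h1 : (⌊t / (T / 2 ^ k)⌋₊ : ℝ) * (T / 2 ^ k) ≤ t :=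
      (le_div_iff₀ hp).1 (Nat.floor_le (div_nonneg ht.1 hp.le))
    have h2 : t < ((⌊t / (T / 2 ^ k)⌋₊ : ℝ) + 1) * (T / 2 ^ k) :=
      (div_lt_iff₀ hp).1 (Nat.lt_floor_add_one _)
    rw [Real.dist_eq, abs_le]
    constructor <;> linarith

lemma dev2 (hl : IsLocalMartBar T Q (SbarProc T hT)) (hl2 : IsLocalMartBar T Q (SSbarProc T hT))
    (hV : ∀ᵐ p ∂Q, ev T hT p.2 0 = 0) (hVm : ∀ᵐ p ∂Q, Monotone p.2) (n m : ℕ) {l : ℝ} (hlp : 0 < l) :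
    Q {p | ∃ t ∈ Set.Icc (0:ℝ) T, l < |yy hT n t p - Sm T hT m (min (rho hT n p) t) p.1|} ≤
      ENNReal.ofReal (eps m ^ 2 * K1 n / l ^ 2) := by
  refine liminf_meas (F := fun k => {p | ∃ j : ℕ, j ≤ 2 ^ k ∧
    l < |yy hT n ((j:ℝ) * (T / 2 ^ k)) p - Sm T hT m (min (rho hT n p) ((j:ℝ) * (T / 2 ^ k))) p.1|})
    (b := fun _ => ENNReal.ofReal (eps m ^ 2 * K1 n / l ^ 2)) ?_ (fun k => ?_) tendsto_const_nhds
  · rintro p ⟨t, ht, hp⟩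
    obtain ⟨j, hj, hjt⟩ := dyad hT ht
    have hc : Continuous (fun u => |yy hT n u p - Sm T hT m (min (rho hT n p) u) p.1|) := by
      have h1 : Continuous (fun u : ℝ => min (rho hT n p) u) := continuous_const.min continuous_id
      have h2 := (ev_cont hT p.1).comp h1
      have h3 := (ev_cont hT p.2).comp h1
      have h4 := (Sm_cont hT m p.1).comp h1
      unfold yy vv
      exact (((((h2.pow 2).sub continuous_const).sub (h3.sub continuous_const)).div_const 2).sub h4).abs
    filter_upwards [((hc.tendsto t).comp hjt).eventually (lt_mem_nhds hp)] with k hk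
    exact ⟨j k, hj k, hk⟩
  · refine dev hT hl hl2 hV hVm n m (h := T / 2 ^ k) (by positivity) (2 ^ k) ?_ hlp
    push_cast
    rw [mul_div_cancel₀ _ (by positivity), zero_add]

lemma dev3 (hl : IsLocalMartBar T Q (SbarProc T hT)) (hl2 : IsLocalMartBar T Q (SSbarProc T hT))
    (hV : ∀ᵐ p ∂Q, ev T hT p.2 0 = 0) (hVm : ∀ᵐ p ∂Q, Monotone p.2) (n : ℕ) :
    ∀ᵐ p ∂Q, ∀ᶠ m in atTop, ∀ t ∈ Set.Icc (0:ℝ) T,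
      |yy hT n t p - Sm T hT m (min (rho hT n p) t) p.1| ≤ (3/4:ℝ) ^ m := by
  have hs : (∑' m, Q {p | ∃ t ∈ Set.Icc (0:ℝ) T,
      (3/4:ℝ) ^ m < |yy hT n t p - Sm T hT m (min (rho hT n p) t) p.1|}) ≠ ⊤ := by
    have hsum : Summable (fun m : ℕ => K1 n * (4/9:ℝ) ^ m) :=
      (summable_geometric_of_lt_one (by norm_num) (by norm_num)).mul_left _
    refine ne_top_of_le_ne_top hsum.tsum_ofReal_ne_top (ENNReal.tsum_le_tsum fun m => ?_)
    refine (dev2 hT hl hl2 hV hVm n m (by positivity)).trans (ENNReal.ofReal_le_ofReal (le_of_eq ?_))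
    have e : eps m = (1/2:ℝ) ^ m := by unfold eps; rw [zpow_neg, zpow_natCast, one_div, inv_pow]
    rw [e, ← pow_mul, ← pow_mul, mul_comm m 2, pow_mul, pow_mul, mul_comm, mul_div_assoc, ← div_pow]
    norm_num
  filter_upwards [ae_eventually_notMem hs] with p hp
  filter_upwards [hp] with m hm t ht
  by_contra hcon
  exact hm ⟨t, ht, not_le.1 hcon⟩

lemma dirB_Gam (hl : IsLocalMartBar T Q (SbarProc T hT)) (hl2 : IsLocalMartBar T Q (SSbarProc T hT))
    (hV : ∀ᵐ p ∂Q, ev T hT p.2 0 = 0) (hVm : ∀ᵐ p ∂Q, Monotone p.2) :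
    ∀ᵐ p ∂Q, p ∈ Gam hT := by
  filter_upwards [hV, hVm, ae_all_iff.2 (dev3 hT hl hl2 hV hVm)] with p h0 hmon hp
  refine ⟨hmon, ?_⟩
  obtain ⟨n, hn⟩ := ((rho_tendsto hT p).eventually_ge_atTop T).exists
  refine squeeze_zero' (Eventually.of_forall fun _ => norm_nonneg _) ?_
    (tendsto_pow_atTop_nhds_zero_of_lt_one (r := (3/4:ℝ)) (by norm_num) (by norm_num))
  filter_upwards [hp n] with m hm
  rw [ContinuousMap.norm_le _ (by positivity)]
  intro t
  have := hm t t.2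
  rw [yy_eq, h0, min_eq_right (t.2.2.trans hn), zero_div, add_zero] at this
  rw [ContinuousMap.sub_apply, SmP_apply, SbP_apply, Real.norm_eq_abs, abs_sub_comm]
  exact this

end P9
end PathwiseSuperhedging

namespace PathwiseSuperhedging
section P10
variable {T : ℝ} (hT : 0 ≤ T)

lemma fst_set {t : ℝ} {A : Set (Path T)} (hA : MeasurableSet[Fraw T t] A) :
    MeasurableSet[FbarRaw T t] (Prod.fst ⁻¹' A : Set (PathPair T)) := by
  have h : Measurable[Fraw T t] (fun ω => ω ∈ A) :=
    (@measurable_mem _ A (Fraw T t)).2 hA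
  have h2 := gal_fst t h
  exact (@measurable_mem _ (Prod.fst ⁻¹' A : Set (PathPair T)) (FbarRaw T t)).1 h2

lemma dirA_S {Q : Measure (Path T)} (hB : ∀ᵐ ω ∂Q, ω ∈ BigOmega T hT)
    (hl : IsLocalMart T Q (Sproc T hT)) : IsLocalMartBar T (Q.map (psiMap T hT)) (SbarProc T hT) := by
  obtain ⟨τ, h1, h2, h3⟩ := hl
  have he := psi_emb hT
  refine ⟨fun m p => τ m p.1, fun m t ht => fst_set (h1 m t ht), he.ae_map_iff.2 h2, fun m => ⟨?_, ?_⟩⟩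
  · intro t ht
    exact he.integrable_map_iff.2 ((h3 m).1 t ht)
  · intro s t hs ht hst A hA
    obtain ⟨A', hA', hAA⟩ := psi_transfer hT hs hA
    rw [he.setIntegral_map, he.setIntegral_map]
    have e : psiMap T hT ⁻¹' A =ᵐ[Q] A' := by
      filter_upwards [hB] with ω hω
      exact propext (hAA ω hω).symm
    rw [setIntegral_congr_set e, setIntegral_congr_set e]
    exact (h3 m).2 s t hs ht hst A' hA'

lemma dirB_S {Q : Measure (PathPair T)} [IsProbabilityMeasure Q]
    (hl : IsLocalMartBar T Q (SbarProc T hT)) : IsLocalMart T (Q.map Prod.fst) (Sproc T hT) := by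
  refine ⟨hit hT, hit_stop hT, ae_of_all _ fun ω => ⟨hit_mono hT ω, hit_tendsto hT ω⟩, fun n => ?_⟩
  have hM : IsMartBar T Q (fun t p => SbarProc T hT (min (hit hT n p.1) t) p) := by
    refine os (good_S hT) hl (hit_fst_stop hT n)
      (Y := fun p => |ev T hT p.1 0| + 2 * (n + 1)) ((S0_int hT hl).abs.add (integrable_const _))
      (ae_of_all _ fun p u => ?_)
    have := (bd_aux2 hT n p.1 (min_le_left (hit hT n p.1) u)).1
    have h3 := abs_sub_abs_le_abs_sub (ev T hT p.1 (min (hit hT n p.1) u)) (ev T hT p.1 0)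
    change |ev T hT p.1 (min (hit hT n p.1) u)| ≤ |ev T hT p.1 0| + 2 * (n + 1)
    linarith
  have hm : ∀ t ∈ Set.Icc (0:ℝ) T, Measurable (fun ω => Sproc T hT (min (hit hT n ω) t) ω) := by
    intro t ht
    have h1 : Measurable (fun p => SbarProc T hT (min (hit hT n p.1) t) p) :=
      (adapted (good_S hT) (hit_fst_stop hT n) ht).mono (FbarRaw_le t) le_rfl
    exact h1.comp (measurable_id.prodMk (measurable_const (a := (0 : Path T))))
  refine ⟨fun t ht => ?_, fun s t hs ht hst A hA => ?_⟩
  · exact (integrable_map_measure (hm t ht).aestronglyMeasurable measurable_fst.aemeasurable).2 (hM.1 t ht)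
  · have hA2 := Fraw_le s A hA
    rw [setIntegral_map hA2 (hm t ht).aestronglyMeasurable measurable_fst.aemeasurable,
      setIntegral_map hA2 (hm s hs).aestronglyMeasurable measurable_fst.aemeasurable]
    exact hM.2 s t hs ht hst _ (fst_set hA)

lemma ae_of_sub {α : Type*} [MeasurableSpace α] {Q : Measure α} [IsProbabilityMeasure Q] {A B : Set α}
    (hA : Q A = 1) (hAB : A ⊆ B) (hB : MeasurableSet B) : ∀ᵐ x ∂Q, x ∈ B := by
  refine (mem_ae_iff_prob_eq_one hB).2 (le_antisymm prob_le_one ?_)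
  rw [← hA]; exact measure_mono hAB

lemma psi_fst (Q : Measure (Path T)) : (Q.map (psiMap T hT)).map Prod.fst = Q := by
  rw [Measure.map_map measurable_fst (psi_meas hT)]
  exact Measure.map_id

lemma fst_psi {Q : Measure (PathPair T)} (hG : ∀ᵐ p ∂Q, p ∈ Gam hT) :
    (Q.map Prod.fst).map (psiMap T hT) = Q := by
  rw [Measure.map_map (psi_meas hT) measurable_fst]
  conv_rhs => rw [← Measure.map_id (μ := Q)]
  refine Measure.map_congr ?_
  filter_upwards [hG] with p hp
  exact (Gam_iff hT hp).2

variable {Ξ : Set (Path T)} {Xibar : Set (PathPair T)}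

lemma dirA (hform : Ξ = {ω ∈ BigOmega T hT | (ω, qv T hT ω) ∈ Xibar})
    {Q : Measure (Path T)} (hQ : Q ∈ MSet T hT Ξ) : Q.map (psiMap T hT) ∈ MbarSet T hT Xibar := by
  obtain ⟨hp, hl, h1⟩ := hQ
  have hB : ∀ᵐ ω ∂Q, ω ∈ BigOmega T hT :=
    ae_of_sub h1 (by rw [hform]; exact fun ω h => h.1) (BigOmega_meas hT)
  have hp' : IsProbabilityMeasure (Q.map (psiMap T hT)) :=
    Measure.isProbabilityMeasure_map (psi_meas hT).aemeasurable
  have hS := dirA_S hT hB hl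
  refine ⟨hp', hS, ?_, ?_⟩
  · refine dirA_SS hT hS ((psi_emb hT).ae_map_iff.2 ?_) ((psi_emb hT).ae_map_iff.2 ?_)
    · filter_upwards [hB] with ω hω using psi_mem_Gam hT hω
    · filter_upwards [hB] with ω hω
      have := psi_zero hT hω
      unfold SSbarProc at this
      linarith
  · rw [(psi_emb hT).map_apply]
    refine le_antisymm prob_le_one ?_
    rw [← h1]
    exact measure_mono (by rw [hform]; exact fun ω h => h.2)

lemma dirB (hform : Ξ = {ω ∈ BigOmega T hT | (ω, qv T hT ω) ∈ Xibar})
    (hA2 : ∀ p ∈ Xibar, p.2 (t0 T hT) = 0 ∧ Monotone p.2)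
    {Q : Measure (PathPair T)} (hQ : Q ∈ MbarSet T hT Xibar) :
    Q.map Prod.fst ∈ MSet T hT Ξ ∧ (Q.map Prod.fst).map (psiMap T hT) = Q := by
  obtain ⟨hp, hl, hl2, h1⟩ := hQ
  have hVm : ∀ᵐ p ∂Q, Monotone p.2 :=
    ae_of_sub h1 (fun p h => (hA2 p h).2) isClosed_mono.measurableSet
  have hV : ∀ᵐ p ∂Q, ev T hT p.2 0 = 0 := by
    refine ae_of_sub (B := {p : PathPair T | ev T hT p.2 0 = 0}) h1 (fun p h => ?_) ?_
    · exact (ev_coe hT p.2 (t0 T hT)).trans (hA2 p h).1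
    · exact measurableSet_eq_fun (ev_meas hT measurable_snd measurable_const) measurable_const
  have hG := dirB_Gam hT hl hl2 hV hVm
  have hfp := fst_psi hT hG
  have hp' : IsProbabilityMeasure (Q.map Prod.fst) :=
    Measure.isProbabilityMeasure_map measurable_fst.aemeasurable
  refine ⟨⟨hp', dirB_S hT hl, ?_⟩, hfp⟩
  have hB : ∀ᵐ ω ∂(Q.map Prod.fst), ω ∈ BigOmega T hT := by
    refine (ae_map_iff measurable_fst.aemeasurable (BigOmega_meas hT)).2 ?_
    filter_upwards [hG] with p hp using (Gam_iff hT hp).1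
  have h2 : Q.map Prod.fst (psiMap T hT ⁻¹' Xibar) = 1 := by
    rw [← (psi_emb hT).map_apply, hfp, h1]
  rw [← h2]
  refine measure_congr ?_
  filter_upwards [hB] with ω hω
  rw [hform]
  exact propext ⟨fun h => h.2, fun h => ⟨hω, h⟩⟩

end P10

/-- **Lemma 4.5 (transfer of martingale measures).** If `Ξ̄` satisfies (A2) and
`Ξ = {ω ∈ Ω : (ω,⟨ω⟩) ∈ Ξ̄}`, then `M(Ξ)` is the set of first-marginal laws of measures
in `M̄(Ξ̄)`, and `M̄(Ξ̄)` is the set of pushforwards under `ψ` of measures in `M(Ξ)`;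
the same holds for `M_Z(Ξ)` and `M̄_{Z̄}(Ξ̄)` when `Z = Z̄ ∘ ψ`. -/
theorem measure_transfer (T : ℝ) (hT : 0 ≤ T)
    (Ξ : Set (Path T)) (Xibar : Set (PathPair T))
    (hform : Ξ = {ω ∈ BigOmega T hT | (ω, qv T hT ω) ∈ Xibar})
    (hA2 : ∀ p ∈ Xibar, p.2 (t0 T hT) = 0 ∧ Monotone p.2) :
    (MSet T hT Ξ = (fun Q : Measure (PathPair T) => Q.map Prod.fst) '' MbarSet T hT Xibar) ∧
    (MbarSet T hT Xibar = (fun Q : Measure (Path T) => Q.map (psiMap T hT)) '' MSet T hT Ξ) ∧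
    ∀ Zbar : PathPair T → ℝ≥0∞, Measurable Zbar → (∀ p, 1 ≤ Zbar p) →
      (MZSet T hT Ξ (fun ω => Zbar (psiMap T hT ω)) =
        (fun Q : Measure (PathPair T) => Q.map Prod.fst) '' MbarZSet T hT Xibar Zbar) ∧
      (MbarZSet T hT Xibar Zbar =
        (fun Q : Measure (Path T) => Q.map (psiMap T hT)) ''
          MZSet T hT Ξ (fun ω => Zbar (psiMap T hT ω))) := by
  have iA : ∀ Q ∈ MSet T hT Ξ, Q.map (psiMap T hT) ∈ MbarSet T hT Xibar := fun Q h => dirA hT hform h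
  have iB : ∀ Q ∈ MbarSet T hT Xibar, Q.map Prod.fst ∈ MSet T hT Ξ ∧
    (Q.map Prod.fst).map (psiMap T hT) = Q := fun Q h => dirB hT hform hA2 h
  refine ⟨?_, ?_, fun Zbar hZ _ => ?_⟩
  · ext Q; constructor
    · exact fun h => ⟨_, iA Q h, psi_fst hT Q⟩
    · rintro ⟨R, hR, rfl⟩; exact (iB R hR).1
  · ext Q; constructor
    · exact fun h => ⟨_, (iB Q h).1, (iB Q h).2⟩
    · rintro ⟨R, hR, rfl⟩; exact iA R hR
  have jA : ∀ Q ∈ MZSet T hT Ξ (fun ω => Zbar (psiMap T hT ω)),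
      Q.map (psiMap T hT) ∈ MbarZSet T hT Xibar Zbar := by
    rintro Q ⟨a, b, c, d⟩
    obtain ⟨a', b', c', d'⟩ := iA Q ⟨a, b, c⟩
    exact ⟨a', b', c', d', by rwa [lintegral_map hZ (psi_meas hT)]⟩
  have jB : ∀ Q ∈ MbarZSet T hT Xibar Zbar,
      Q.map Prod.fst ∈ MZSet T hT Ξ (fun ω => Zbar (psiMap T hT ω)) ∧
      (Q.map Prod.fst).map (psiMap T hT) = Q := by
    rintro Q ⟨a, b, c, d, e⟩
    obtain ⟨⟨a', b', c'⟩, h⟩ := iB Q ⟨a, b, c, d⟩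
    refine ⟨⟨a', b', c', ?_⟩, h⟩
    rwa [← lintegral_map hZ (psi_meas hT), h]
  refine ⟨?_, ?_⟩
  · ext Q; constructor
    · exact fun h => ⟨_, jA Q h, psi_fst hT Q⟩
    · rintro ⟨R, hR, rfl⟩; exact (jB R hR).1
  · ext Q; constructor
    · exact fun h => ⟨_, (jB Q h).1, (jB Q h).2⟩
    · rintro ⟨R, hR, rfl⟩; exact jA R hR

end PathwiseSuperhedging
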